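/- Assume N = 3, −λ₁(B) < λ < 0, 2 < p ≤ 4 and ks ≤ 4 − p. Then the problem (P_λ) admits exactly one positive solution, and this solution is radially symmetric and decreasing with respect to the radial variable r = |x|. -/

import Mathlib

open MeasureTheory Set Filter Topology

noncomputable section

/-- `N`-dimensional Euclidean space. -/
abbrev Euc (N : ℕ) := EuclideanSpace ℝ (Fin N)

/-- The Laplacian of a real-valued function on Euclidean space, defined as the
sum of the pure second partial derivatives in the coordinate directions. -/
def lap {N : ℕ} (u : Euc N → ℝ) (x : Euc N) : ℝ :=
  ∑ i : Fin N,
    fderiv ℝ (fun y => fderiv ℝ u y (EuclideanSpace.single i 1)) x (EuclideanSpace.single i 1)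

/-- The first Dirichlet eigenvalue of `-Δ` on `Ω`, defined as the infimum of
Rayleigh quotients of nonzero smooth functions with compact support contained in `Ω`. -/
def firstEig {N : ℕ} (Ω : Set (Euc N)) : ℝ :=
  sInf { r : ℝ | ∃ φ : Euc N → ℝ, ContDiff ℝ (⊤ : ℕ∞) φ ∧ HasCompactSupport φ ∧
    tsupport φ ⊆ Ω ∧ φ ≠ 0 ∧
    r = (∫ x, ‖fderiv ℝ φ x‖ ^ 2) / (∫ x, (φ x) ^ 2) }

/-- `u` is a (classical) positive solution of `-Δ u + lam • u = f(x, u)` in `Ω`,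
vanishing on the boundary: `u ∈ C²(Ω) ∩ C(closure Ω)`, `u > 0` in `Ω`, `u = 0` on `∂Ω`. -/
def IsPosSolution {N : ℕ} (Ω : Set (Euc N)) (f : Euc N → ℝ → ℝ) (lam : ℝ)
    (u : Euc N → ℝ) : Prop :=
  ContDiffOn ℝ 2 u Ω ∧ ContinuousOn u (closure Ω) ∧ (∀ x ∈ Ω, 0 < u x) ∧
    (∀ x ∈ frontier Ω, u x = 0) ∧ ∀ x ∈ Ω, - lap u x + lam * u x = f x (u x)


/-- The nonlinearity `(1 + |x|^k)^{-s} t^{p-1}` of problem `(P_λ)` on the unit ball. -/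
def fker (N : ℕ) (k s p : ℝ) : Euc N → ℝ → ℝ :=
  fun x t => (1 + ‖x‖ ^ k) ^ (-s) * t ^ (p - 1)

section

open scoped Laplacian

theorem lap_eq_laplacian {N : ℕ} {u : Euc N → ℝ} {x : Euc N} (hu : ContDiffAt ℝ 2 u x) :
    lap u x = (Δ u) x := by
  rw [InnerProductSpace.laplacian_eq_iteratedFDeriv_orthonormalBasis u
    (EuclideanSpace.basisFun (Fin N) ℝ)]
  unfold lap
  refine Finset.sum_congr rfl fun i _ => ?_
  have h1 : DifferentiableAt ℝ (fderiv ℝ u) x :=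
    (hu.fderiv_right (m := 1) (by norm_num)).differentiableAt (by norm_num)
  rw [iteratedFDeriv_two_apply, fderiv_clm_apply h1 (differentiableAt_const _)]
  simp

/-- The restriction of a `C²` function to a line has second derivative given by the Hessian. -/
theorem deriv_deriv_line {E : Type*} [NormedAddCommGroup E] [NormedSpace ℝ E] {f : E → ℝ} {x : E}
    (hf : ContDiffAt ℝ 2 f x) (h : E) :
    deriv (deriv fun t : ℝ => f (x + t • h)) 0 = iteratedFDeriv ℝ 2 f x ![h, h] := by
  have hline : ∀ t : ℝ, HasDerivAt (fun t : ℝ => x + t • h) h t := fun t => by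
    have := ((hasDerivAt_id t).smul_const h).const_add x
    rwa [one_smul] at this
  have hc : Tendsto (fun t : ℝ => x + t • h) (𝓝 0) (𝓝 x) := by
    have := (hline 0).continuousAt.tendsto
    simpa using this
  have h1 : deriv (fun t : ℝ => f (x + t • h)) =ᶠ[𝓝 0] fun t => fderiv ℝ f (x + t • h) h := by
    filter_upwards [hc.eventually (hf.eventually (by simp))] with t ht
    exact ((ht.differentiableAt (by norm_num)).hasFDerivAt.comp_hasDerivAt t (hline t)).deriv
  rw [h1.deriv_eq, iteratedFDeriv_two_apply]
  have h2 : DifferentiableAt ℝ (fderiv ℝ f) (x + (0 : ℝ) • h) := by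
    simpa using (hf.fderiv_right (m := 1) (by norm_num)).differentiableAt (by norm_num)
  have h3 : HasDerivAt (fun t : ℝ => fderiv ℝ f (x + t • h)) (fderiv ℝ (fderiv ℝ f) x h) 0 := by
    have := h2.hasFDerivAt.comp_hasDerivAt (0 : ℝ) (hline 0)
    rwa [zero_smul, add_zero] at this
  have h4 := ((ContinuousLinearMap.apply ℝ ℝ h).hasFDerivAt.comp_hasDerivAt (0 : ℝ) h3).deriv
  exact h4

theorem deriv_deriv_nonneg_of_isLocalMin {g : ℝ → ℝ} {a : ℝ} (hg : IsLocalMin g a)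
    (hc : ContinuousAt g a) : 0 ≤ deriv (deriv g) a := by
  by_contra! hneg
  have hmax := isLocalMax_of_deriv_deriv_neg hneg hg.deriv_eq_zero hc
  have h0 : g =ᶠ[𝓝 a] fun _ => g a := by
    filter_upwards [hg, hmax] with x h1 h2
    exact le_antisymm h2 h1
  have h1 : deriv g =ᶠ[𝓝 a] fun _ => 0 := by
    have := h0.deriv
    simpa using this
  rw [h1.deriv_eq] at hneg
  simp at hneg

theorem laplacian_nonneg_of_isLocalMin {N : ℕ} {f : Euc N → ℝ} {x : Euc N}
    (hf : ContDiffAt ℝ 2 f x) (hmin : IsLocalMin f x) : 0 ≤ (Δ f) x := by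
  rw [InnerProductSpace.laplacian_eq_iteratedFDeriv_orthonormalBasis f
    (EuclideanSpace.basisFun (Fin N) ℝ)]
  refine Finset.sum_nonneg fun i _ => ?_
  set h := (EuclideanSpace.basisFun (Fin N) ℝ) i
  rw [← deriv_deriv_line hf h]
  have hc : ContinuousAt (fun t : ℝ => x + t • h) 0 := by fun_prop
  have hc' : Tendsto (fun t : ℝ => x + t • h) (𝓝 0) (𝓝 x) := by
    simpa [ContinuousAt] using hc
  apply deriv_deriv_nonneg_of_isLocalMin
  · have := hc'.eventually hmin
    simpa [IsLocalMin, IsMinFilter] using this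
  · have h1 : ContinuousAt f (x + (0 : ℝ) • h) := by simpa using hf.continuousAt
    exact ContinuousAt.comp (f := fun t : ℝ => x + t • h) h1 hc

/-- The Laplacian is invariant under affine isometries. -/
theorem laplacian_comp_isometry {N : ℕ} {f : Euc N → ℝ} {x c : Euc N} (R : Euc N ≃ₗᵢ[ℝ] Euc N)
    (hf : ContDiffAt ℝ 2 f (R x + c)) :
    (Δ fun y => f (R y + c)) x = (Δ f) (R x + c) := by
  have hR : ContDiff ℝ 2 fun y => R y + c := by
    exact (R.contDiff).add contDiff_const
  have hfR : ContDiffAt ℝ 2 (fun y => f (R y + c)) x := hf.comp x hR.contDiffAt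
  rw [InnerProductSpace.laplacian_eq_iteratedFDeriv_orthonormalBasis f
    ((EuclideanSpace.basisFun (Fin N) ℝ).map R),
    InnerProductSpace.laplacian_eq_iteratedFDeriv_orthonormalBasis _
    (EuclideanSpace.basisFun (Fin N) ℝ)]
  refine Finset.sum_congr rfl fun i _ => ?_
  rw [← deriv_deriv_line hf, ← deriv_deriv_line hfR]
  congr 2
  ext t
  simp only [OrthonormalBasis.map_apply, map_add, map_smul]
  congr 1
  abel

end

section

open scoped Laplacian RealInnerProductSpace

theorem contDiff_cos_inner {N : ℕ} (e : Euc N) (K a : ℝ) :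
    ContDiff ℝ 2 fun y : Euc N => Real.cos (K * (⟪e, y⟫ - a)) :=
  (contDiff_const.mul ((contDiff_const.inner ℝ contDiff_id).sub contDiff_const)).cos

theorem laplacian_cos_inner {N : ℕ} {e : Euc N} (he : ‖e‖ = 1) (K a : ℝ) (x : Euc N) :
    (Δ fun y => Real.cos (K * (⟪e, y⟫ - a))) x = -(K ^ 2 * Real.cos (K * (⟪e, x⟫ - a))) := by
  have hC : ContDiff ℝ 2 fun y : Euc N => Real.cos (K * (⟪e, y⟫ - a)) := contDiff_cos_inner e K a
  rw [InnerProductSpace.laplacian_eq_iteratedFDeriv_orthonormalBasis _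
    (EuclideanSpace.basisFun (Fin N) ℝ)]
  have key : ∀ h : Euc N,
      iteratedFDeriv ℝ 2 (fun y : Euc N => Real.cos (K * (⟪e, y⟫ - a))) x ![h, h]
      = -(K ^ 2 * Real.cos (K * (⟪e, x⟫ - a))) * ⟪e, h⟫ ^ 2 := by
    intro h
    rw [← deriv_deriv_line hC.contDiffAt]
    have hlin : ∀ t : ℝ, HasDerivAt (fun t : ℝ => K * (⟪e, x + t • h⟫ - a)) (K * ⟪e, h⟫) t := by
      intro t
      have h1 : (fun t : ℝ => K * (⟪e, x + t • h⟫ - a)) =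
          fun t : ℝ => t * (K * ⟪e, h⟫) + K * (⟪e, x⟫ - a) := by
        ext t; rw [inner_add_right, inner_smul_right]; ring
      rw [h1]
      simpa using ((hasDerivAt_id t).mul_const (K * ⟪e, h⟫)).add_const (K * (⟪e, x⟫ - a))
    have h1 : (deriv fun t : ℝ => Real.cos (K * (⟪e, x + t • h⟫ - a))) =
        fun t => -Real.sin (K * (⟪e, x + t • h⟫ - a)) * (K * ⟪e, h⟫) := by
      ext t; exact (hlin t).cos.deriv
    rw [h1, (((hlin 0).sin.fun_neg).mul_const _).deriv]
    simp only [zero_smul, add_zero]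
    ring
  simp only [key]
  rw [← Finset.mul_sum]
  have := (EuclideanSpace.basisFun (Fin N) ℝ).sum_sq_inner_left e
  rw [this, he]; ring

/-- Maximum principle in a strip of the unit ball which is narrow relative to the zeroth-order
coefficient. -/
theorem strip_maximum_principle {N : ℕ} {e : Euc N} (he : ‖e‖ = 1) {a b K : ℝ} (hK : 0 < K)
    (hab : K * (b - a) < Real.pi / 2) {F : Euc N → ℝ}
    (hF : ContinuousOn F {x | ‖x‖ ≤ 1 ∧ a ≤ ⟪e, x⟫ ∧ ⟪e, x⟫ ≤ b})
    (hbd : ∀ x : Euc N, ‖x‖ ≤ 1 → a ≤ ⟪e, x⟫ → ⟪e, x⟫ ≤ b →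
      (‖x‖ = 1 ∨ ⟪e, x⟫ = a ∨ ⟪e, x⟫ = b) → 0 ≤ F x)
    (hineq : ∀ x : Euc N, ‖x‖ < 1 → a < ⟪e, x⟫ → ⟪e, x⟫ < b → F x < 0 →
      ContDiffAt ℝ 2 F x ∧ (Δ F) x < K ^ 2 * (-F x)) :
    ∀ x : Euc N, ‖x‖ ≤ 1 → a ≤ ⟪e, x⟫ → ⟪e, x⟫ ≤ b → 0 ≤ F x := by
  set S : Set (Euc N) := {x | ‖x‖ ≤ 1 ∧ a ≤ ⟪e, x⟫ ∧ ⟪e, x⟫ ≤ b} with hS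
  have hScl : IsCompact S := by
    have h1 : S = Metric.closedBall 0 1 ∩ ((fun x => ⟪e, x⟫) ⁻¹' Icc a b) := by
      ext x; simp [hS]
    rw [h1]
    exact (isCompact_closedBall _ _).inter_right (isClosed_Icc.preimage (by fun_prop))
  set g : Euc N → ℝ := fun y => Real.cos (K * (⟪e, y⟫ - a)) with hg
  have hgpos : ∀ x ∈ S, 0 < g x := by
    rintro x ⟨_, h2, h3⟩
    apply Real.cos_pos_of_mem_Ioo
    constructor
    · nlinarith [Real.pi_pos, mul_nonneg hK.le (sub_nonneg.2 h2)]
    · have : K * (⟪e, x⟫ - a) ≤ K * (b - a) := by gcongr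
      linarith
  have hgC : ContDiff ℝ 2 g := contDiff_cos_inner e K a
  by_contra! hcon
  obtain ⟨y, hy1, hy2, hy3, hyneg⟩ := hcon
  have hyS : y ∈ S := ⟨hy1, hy2, hy3⟩
  obtain ⟨x, hxS, hxmin⟩ := hScl.exists_isMinOn ⟨y, hyS⟩
    (hF.div hgC.continuous.continuousOn fun x hx => (hgpos x hx).ne')
  set τ := F x / g x with hτ
  have hτneg : τ < 0 :=
    lt_of_le_of_lt (hxmin hyS) (div_neg_of_neg_of_pos hyneg (hgpos y hyS))
  have hFx : F x = τ * g x := by rw [hτ]; field_simp [(hgpos x hxS).ne']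
  have hFneg : F x < 0 := by rw [hFx]; exact mul_neg_of_neg_of_pos hτneg (hgpos x hxS)
  obtain ⟨hx1, hx2, hx3⟩ := hxS
  have hnb : ¬ (‖x‖ = 1 ∨ ⟪e, x⟫ = a ∨ ⟪e, x⟫ = b) := fun h =>
    absurd (hbd x hx1 hx2 hx3 h) (not_le.2 hFneg)
  push Not at hnb
  have hx1' := lt_of_le_of_ne hx1 hnb.1
  have hx2' := lt_of_le_of_ne hx2 (Ne.symm hnb.2.1)
  have hx3' := lt_of_le_of_ne hx3 hnb.2.2
  obtain ⟨hFC, hΔ⟩ := hineq x hx1' hx2' hx3' hFneg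
  have hSnhds : S ∈ 𝓝 x := by
    have h1 : ∀ᶠ z : Euc N in 𝓝 x, ‖z‖ < 1 := (continuous_norm.tendsto x).eventually_lt_const hx1'
    have hi : Continuous fun z : Euc N => ⟪e, z⟫ := by fun_prop
    have h2 := (hi.tendsto x).eventually_const_lt hx2'
    have h3 := (hi.tendsto x).eventually_lt_const hx3'
    filter_upwards [h1, h2, h3] with z a b c using ⟨a.le, b.le, c.le⟩
  have hmin : IsLocalMin (F - τ • g) x := by
    filter_upwards [hSnhds] with z hz
    have h1 : τ ≤ F z / g z := hxmin hz
    rw [le_div_iff₀ (hgpos z hz)] at h1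
    simp only [Pi.sub_apply, Pi.smul_apply, smul_eq_mul]
    linarith
  have hC2 : ContDiffAt ℝ 2 (τ • g) x := contDiffAt_const.smul hgC.contDiffAt
  have hpos : 0 ≤ (Δ (F - τ • g)) x := laplacian_nonneg_of_isLocalMin (hFC.sub hC2) hmin
  rw [hFC.laplacian_sub hC2, InnerProductSpace.laplacian_smul τ hgC.contDiffAt, hg,
    laplacian_cos_inner he, smul_eq_mul] at hpos
  change 0 ≤ (Δ F) x - τ * -(K ^ 2 * g x) at hpos
  nlinarith

end

section

open scoped Laplacian RealInnerProductSpace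

/-- A positive classical solution of `-Δv = g(|x|, v)` in the unit ball with zero boundary values,
where `g` is nonincreasing in the radius, and nondecreasing and locally Lipschitz in the second
variable. -/
structure IsBallSolution {N : ℕ} (g : ℝ → ℝ → ℝ) (v : Euc N → ℝ) : Prop where
  anti : ∀ r₁ r₂ t, 0 ≤ r₁ → r₁ ≤ r₂ → 0 ≤ t → g r₂ t ≤ g r₁ t
  mono : ∀ r a b, 0 ≤ r → 0 ≤ a → a ≤ b → g r a ≤ g r b
  lip : ∀ M, ∃ C, 0 < C ∧ ∀ r a b, 0 ≤ r → 0 ≤ a → a ≤ b → b ≤ M → g r b - g r a ≤ C * (b - a)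
  smooth : ∀ x, ‖x‖ < 1 → ContDiffAt ℝ 2 v x
  cont : ContinuousOn v (Metric.closedBall 0 1)
  pos : ∀ x, ‖x‖ < 1 → 0 < v x
  zero : ∀ x, ‖x‖ = 1 → v x = 0
  eqn : ∀ x, ‖x‖ < 1 → (Δ v) x = -g ‖x‖ (v x)

/-- Reflection in the hyperplane `⟪e, x⟫ = l`. -/
def planeRefl {N : ℕ} (e : Euc N) (l : ℝ) (x : Euc N) : Euc N := x + (2 * (l - ⟪e, x⟫)) • e

section MovingPlanes

variable {N : ℕ} {e : Euc N} {l : ℝ} {x : Euc N} {g : ℝ → ℝ → ℝ} {v : Euc N → ℝ}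

theorem continuous_planeRefl (e : Euc N) (l : ℝ) : Continuous (planeRefl e l) := by
  unfold planeRefl; fun_prop

theorem planeRefl_eq (he : ‖e‖ = 1) (l : ℝ) (x : Euc N) :
    planeRefl e l x = (Submodule.reflection (ℝ ∙ e)ᗮ) x + (2 * l) • e := by
  rw [Submodule.reflection_orthogonal_apply, Submodule.reflection_singleton_apply, he, planeRefl]
  simp only [RCLike.ofReal_real_eq_id, id, one_pow, div_one]
  module

theorem norm_planeRefl_sq (he : ‖e‖ = 1) (l : ℝ) (x : Euc N) :
    ‖planeRefl e l x‖ ^ 2 = ‖x‖ ^ 2 + 4 * (l - ⟪e, x⟫) * l := by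
  rw [planeRefl, norm_add_sq_real, norm_smul, he, inner_smul_right, real_inner_comm x e]
  simp only [Real.norm_eq_abs, mul_one, sq_abs]
  ring

theorem norm_planeRefl_le (he : ‖e‖ = 1) (hl : 0 ≤ l) (hx : l ≤ ⟪e, x⟫) :
    ‖planeRefl e l x‖ ≤ ‖x‖ := by
  apply le_of_sq_le_sq _ (norm_nonneg _)
  rw [norm_planeRefl_sq he]
  nlinarith [mul_nonneg hl (sub_nonneg.2 hx)]

theorem norm_planeRefl_lt (he : ‖e‖ = 1) (hl : 0 < l) (hx : l < ⟪e, x⟫) :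
    ‖planeRefl e l x‖ < ‖x‖ := by
  apply lt_of_pow_lt_pow_left₀ 2 (norm_nonneg _)
  rw [norm_planeRefl_sq he]
  nlinarith [mul_pos hl (sub_pos.2 hx)]

theorem IsBallSolution.nonneg (h : IsBallSolution g v) (hx : ‖x‖ ≤ 1) : 0 ≤ v x := by
  rcases hx.lt_or_eq with h1 | h1
  · exact (h.pos x h1).le
  · exact (h.zero x h1).ge

theorem IsBallSolution.laplacian_diff (h : IsBallSolution g v) (he : ‖e‖ = 1) (hl : 0 < l)
    (hx : ‖x‖ < 1) (hlx : l < ⟪e, x⟫) :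
    ContDiffAt ℝ 2 (fun y => v (planeRefl e l y) - v y) x ∧
    (Δ fun y => v (planeRefl e l y) - v y) x =
      g ‖x‖ (v x) - g ‖planeRefl e l x‖ (v (planeRefl e l x)) := by
  have hs : ‖planeRefl e l x‖ < 1 := (norm_planeRefl_lt he hl hlx).trans hx
  have hC := h.smooth _ hs
  have hE : planeRefl e l = fun y => (Submodule.reflection (ℝ ∙ e)ᗮ) y + (2 * l) • e :=
    funext (planeRefl_eq he l)
  have hC' := hC
  rw [hE] at hC'
  have hlap := laplacian_comp_isometry (Submodule.reflection (ℝ ∙ e)ᗮ) hC'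
  have hC2 : ContDiffAt ℝ 2 (fun y => v (planeRefl e l y)) x := by
    have : ContDiff ℝ 2 (planeRefl e l) := by
      rw [hE]
      exact ((Submodule.reflection (ℝ ∙ e)ᗮ).contDiff).add contDiff_const
    exact ContDiffAt.comp x hC this.contDiffAt
  have hC3 := h.smooth x hx
  refine ⟨hC2.sub hC3, ?_⟩
  have h1 : (Δ ((fun y => v (planeRefl e l y)) - v)) x =
      (Δ fun y => v (planeRefl e l y)) x - (Δ v) x := hC2.laplacian_sub hC3
  have h2 : (Δ fun y => v (planeRefl e l y)) x = -g ‖planeRefl e l x‖ (v (planeRefl e l x)) := by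
    rw [← h.eqn _ hs, hE]; exact hlap
  have h3 : (fun y => v (planeRefl e l y) - v y) = (fun y => v (planeRefl e l y)) - v := rfl
  rw [h3, h1, h2, h.eqn x hx]; ring

theorem IsBallSolution.continuousOn_comp_planeRefl (h : IsBallSolution g v) (he : ‖e‖ = 1)
    (hl : 0 ≤ l) :
    ContinuousOn (fun y => v (planeRefl e l y) - v y) {x | ‖x‖ ≤ 1 ∧ l ≤ ⟪e, x⟫} := by
  refine ContinuousOn.sub (h.cont.comp (continuous_planeRefl e l).continuousOn ?_)
    (h.cont.mono ?_)
  · rintro y ⟨h1, h2⟩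
    simpa using (norm_planeRefl_le he hl h2).trans h1
  · rintro y ⟨h1, h2⟩
    simpa using h1

theorem IsBallSolution.planeRefl_narrow (h : IsBallSolution g v) (he : ‖e‖ = 1) (hl : 0 < l)
    {b C K M : ℝ} (hM : ∀ x : Euc N, ‖x‖ ≤ 1 → v x ≤ M)
    (hC : ∀ r a b, 0 ≤ r → 0 ≤ a → a ≤ b → b ≤ M → g r b - g r a ≤ C * (b - a))
    (hK : 0 < K) (hCK : C < K ^ 2) (hKb : K * (b - l) < Real.pi / 2)
    (hb : ∀ x : Euc N, ‖x‖ ≤ 1 → l ≤ ⟪e, x⟫ → b ≤ ⟪e, x⟫ → v x ≤ v (planeRefl e l x)) :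
    ∀ x : Euc N, ‖x‖ ≤ 1 → l ≤ ⟪e, x⟫ → v x ≤ v (planeRefl e l x) := by
  intro x hx hlx
  rcases le_total b ⟪e, x⟫ with hbx | hbx
  · exact hb x hx hlx hbx
  have := strip_maximum_principle he (a := l) (b := b) hK hKb
    (F := fun y => v (planeRefl e l y) - v y)
    ((h.continuousOn_comp_planeRefl he hl.le).mono fun y hy => ⟨hy.1, hy.2.1⟩) ?_ ?_ x hx hlx hbx
  · exact sub_nonneg.1 this
  · intro y hy hly hyb hor
    rcases hor with h1 | h1 | h1
    · rw [h.zero y h1, sub_zero]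
      exact h.nonneg ((norm_planeRefl_le he hl.le hly).trans hy)
    · simp [planeRefl, h1]
    · exact sub_nonneg.2 (hb y hy hly h1.ge)
  · intro y hy hly hyb hneg
    obtain ⟨h1, h2⟩ := h.laplacian_diff he hl hy hly
    refine ⟨h1, ?_⟩
    rw [h2]
    have hn := norm_planeRefl_le he hl.le hly.le
    have h3 := h.anti _ _ (v y) (norm_nonneg _) hn (h.nonneg hy.le)
    have h4 := hC ‖planeRefl e l y‖ (v (planeRefl e l y)) (v y) (norm_nonneg _)
      (h.nonneg (hn.trans hy.le)) (by linarith) (hM y hy.le)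
    have h5 : 0 < v y - v (planeRefl e l y) := by linarith
    nlinarith

theorem laplacian_inner_sub (e : Euc N) (c d : ℝ) (x : Euc N) :
    (Δ fun y : Euc N => c * (⟪e, y⟫ - d)) x = 0 := by
  have hC : ContDiff ℝ 2 fun y : Euc N => c * (⟪e, y⟫ - d) :=
    contDiff_const.mul ((contDiff_const.inner ℝ contDiff_id).sub contDiff_const)
  rw [InnerProductSpace.laplacian_eq_iteratedFDeriv_orthonormalBasis _
    (EuclideanSpace.basisFun (Fin N) ℝ)]
  refine Finset.sum_eq_zero fun i _ => ?_
  rw [← deriv_deriv_line hC.contDiffAt]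
  set h := (EuclideanSpace.basisFun (Fin N) ℝ) i
  have h1 : (fun t : ℝ => c * (⟪e, x + t • h⟫ - d)) =
      fun t : ℝ => t * (c * ⟪e, h⟫) + c * (⟪e, x⟫ - d) := by
    ext t; rw [inner_add_right, inner_smul_right]; ring
  have h2 : (deriv fun t : ℝ => t * (c * ⟪e, h⟫) + c * (⟪e, x⟫ - d)) = fun _ => c * ⟪e, h⟫ := by
    ext t
    simp
  rw [h1, h2]; simp

theorem IsBallSolution.planeRefl_strict (h : IsBallSolution g v) (he : ‖e‖ = 1) (hl : 0 < l)
    (hP : ∀ x : Euc N, ‖x‖ ≤ 1 → l ≤ ⟪e, x⟫ → v x ≤ v (planeRefl e l x))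
    (hx : ‖x‖ ≤ 1) (hlx : l < ⟪e, x⟫) : v x < v (planeRefl e l x) := by
  set l' := (l + ⟪e, x⟫) / 2 with hl'
  have hll' : l < l' := by linarith
  have hl'x : l' < ⟪e, x⟫ := by linarith
  have hin : ∀ y : Euc N, ‖y‖ ≤ 1 → ⟪e, y⟫ ≤ 1 := fun y hy => by
    have := real_inner_le_norm e y
    rw [he] at this; linarith
  have hcont := h.continuousOn_comp_planeRefl he hl.le
  have hT : IsCompact {y : Euc N | ‖y‖ = 1 ∧ l' ≤ ⟪e, y⟫} := by
    have h1 : {y : Euc N | ‖y‖ = 1 ∧ l' ≤ ⟪e, y⟫} =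
        Metric.sphere 0 1 ∩ ((fun x => ⟪e, x⟫) ⁻¹' Ici l') := by
      ext x; simp
    rw [h1]
    exact (isCompact_sphere _ _).inter_right (isClosed_Ici.preimage (by fun_prop))
  obtain ⟨m, hm0, hm⟩ := hT.exists_forall_le' (f := fun y => v (planeRefl e l y) - v y) (a := 0)
    (hcont.mono fun y hy => ⟨hy.1.le, hll'.le.trans hy.2⟩) (by
      rintro y ⟨h1, h2⟩
      rw [h.zero y h1, sub_zero]
      exact h.pos _ (h1 ▸ norm_planeRefl_lt he hl (hll'.trans_le h2)))
  have := strip_maximum_principle he (a := l') (b := 1) (K := 1) one_pos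
    (by linarith [Real.pi_gt_three])
    (F := fun y => (v (planeRefl e l y) - v y) - m * (⟪e, y⟫ - l'))
    (ContinuousOn.sub (hcont.mono fun y hy => ⟨hy.1, hll'.le.trans hy.2.1⟩)
      (Continuous.continuousOn (by fun_prop))) ?_ ?_ x hx hl'x.le (hin x hx)
  · have h2 : 0 < m * (⟪e, x⟫ - l') := mul_pos hm0 (by linarith)
    linarith
  · have hsph : ∀ y : Euc N, ‖y‖ = 1 → l' ≤ ⟪e, y⟫ →
        0 ≤ (v (planeRefl e l y) - v y) - m * (⟪e, y⟫ - l') := fun y hy hy2 => by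
      have h1 : m ≤ v (planeRefl e l y) - v y := hm y ⟨hy, hy2⟩
      have := hin y hy.le
      nlinarith
    intro y hy hly hyb hor
    rcases hor with h1 | h1 | h1
    · exact hsph y h1 hly
    · have := hP y hy (hll'.le.trans hly)
      simp only [h1]; linarith
    · refine hsph y (le_antisymm hy ?_) hly
      have := real_inner_le_norm e y
      rw [he] at this; linarith
  · intro y hy hly hyb hneg
    obtain ⟨h1, h2⟩ := h.laplacian_diff he hl hy (hll'.trans hly)
    have hC : ContDiffAt ℝ 2 (fun y : Euc N => m * (⟪e, y⟫ - l')) y :=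
      (contDiff_const.mul ((contDiff_const.inner ℝ contDiff_id).sub contDiff_const)).contDiffAt
    refine ⟨h1.sub hC, ?_⟩
    have h3 : (Δ ((fun y => v (planeRefl e l y) - v y) - fun y : Euc N => m * (⟪e, y⟫ - l'))) y =
      (Δ fun y => v (planeRefl e l y) - v y) y - (Δ fun y : Euc N => m * (⟪e, y⟫ - l')) y :=
      h1.laplacian_sub hC
    change (Δ ((fun y => v (planeRefl e l y) - v y) - fun y : Euc N => m * (⟪e, y⟫ - l'))) y < _
    rw [h3, laplacian_inner_sub, h2]
    have hn := norm_planeRefl_le he hl.le (hll'.trans hly).le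
    have h4 := h.anti _ _ (v y) (norm_nonneg _) hn (h.nonneg hy.le)
    have h5 := h.mono ‖planeRefl e l y‖ (v y) (v (planeRefl e l y)) (norm_nonneg _)
      (h.nonneg hy.le) (hP y hy.le (hll'.trans hly).le)
    have hneg' : (v (planeRefl e l y) - v y) - m * (⟪e, y⟫ - l') < 0 := hneg
    linarith

theorem IsBallSolution.planeRefl_limit (h : IsBallSolution g v) (he : ‖e‖ = 1) (hl : 0 ≤ l)
    (hl1 : l < 1) (hP : ∀ l' ∈ Ioo l 1, ∀ x : Euc N, ‖x‖ ≤ 1 → l' ≤ ⟪e, x⟫ →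
      v x ≤ v (planeRefl e l' x)) :
    ∀ x : Euc N, ‖x‖ ≤ 1 → l ≤ ⟪e, x⟫ → v x ≤ v (planeRefl e l x) := by
  intro x hx hlx
  rcases hlx.eq_or_lt with h1 | h1
  · simp [planeRefl, h1]
  have hc : ContinuousWithinAt (fun l' => v (planeRefl e l' x)) (Icc l ⟪e, x⟫) l := by
    refine ContinuousWithinAt.comp (t := Metric.closedBall 0 1) (h.cont _ ?_)
      (Continuous.continuousWithinAt (by unfold planeRefl; fun_prop)) ?_
    · simpa using (norm_planeRefl_le he hl hlx).trans hx
    · intro l' hl'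
      simpa using (norm_planeRefl_le he (hl.trans hl'.1) hl'.2).trans hx
  have hc2 : Tendsto (fun l' => v (planeRefl e l' x)) (𝓝[>] l) (𝓝 (v (planeRefl e l x))) :=
    hc.tendsto.mono_left (by
      rw [← nhdsWithin_Ioc_eq_nhdsGT h1]
      exact nhdsWithin_mono _ Ioc_subset_Icc_self)
  refine ge_of_tendsto hc2 ?_
  filter_upwards [Ioo_mem_nhdsGT h1, Ioo_mem_nhdsGT hl1] with l' h2 h3
  exact hP l' h3 x hx h2.2.le

theorem IsBallSolution.planeRefl_all (h : IsBallSolution g v) (he : ‖e‖ = 1) (hl : 0 < l)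
    (hl1 : l < 1) : ∀ x : Euc N, ‖x‖ ≤ 1 → l ≤ ⟪e, x⟫ → v x ≤ v (planeRefl e l x) := by
  obtain ⟨M, hM⟩ : ∃ M, ∀ x : Euc N, ‖x‖ ≤ 1 → v x ≤ M := by
    obtain ⟨M, hM⟩ := (isCompact_closedBall (0 : Euc N) 1).bddAbove_image h.cont
    exact ⟨M, fun x hx => hM ⟨x, by simpa using hx, rfl⟩⟩
  obtain ⟨C, hC0, hC⟩ := h.lip M
  have hK : (0 : ℝ) < C + 1 := by linarith
  have hCK : C < (C + 1) ^ 2 := by nlinarith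
  have hin : ∀ y : Euc N, ⟪e, y⟫ ≤ ‖y‖ := fun y => by
    simpa [he] using real_inner_le_norm e y
  set P : ℝ → Prop := fun l => ∀ x : Euc N, ‖x‖ ≤ 1 → l ≤ ⟪e, x⟫ → v x ≤ v (planeRefl e l x)
    with hPdef
  set S := {l : ℝ | 0 < l ∧ l < 1 ∧ ¬ P l} with hS
  by_contra hcon
  have hlS : l ∈ S := ⟨hl, hl1, hcon⟩
  have hSb : BddAbove S := ⟨1, fun y hy => hy.2.1.le⟩
  have hnear : ∀ l, 0 < l → (C + 1) * (1 - l) < Real.pi / 2 → P l := by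
    intro l hl hlK
    refine h.planeRefl_narrow he hl hM hC hK hCK hlK fun y hy hly h1y => ?_
    rw [h.zero y (le_antisymm hy (h1y.trans (hin y)))]
    exact h.nonneg ((norm_planeRefl_le he hl.le hly).trans hy)
  set L := sSup S with hL
  have hlL : l ≤ L := le_csSup hSb hlS
  have hL0 : 0 < L := hl.trans_le hlL
  set ε : ℝ := 1 / (2 * (C + 1)) with hε
  have hε0 : 0 < ε := by positivity
  have hεK : (C + 1) * ε = 1 / 2 := by rw [hε]; field_simp
  have hL1 : L < 1 := by
    have : L ≤ 1 - ε := by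
      refine csSup_le ⟨l, hlS⟩ fun y hy => ?_
      by_contra! hy2
      refine hy.2.2 (hnear y hy.1 ?_)
      have : (C + 1) * (1 - y) ≤ (C + 1) * ε := by gcongr; linarith
      linarith [Real.pi_gt_three]
    linarith
  have hPgt : ∀ l' ∈ Ioo L 1, P l' := fun l' hl' => by
    by_contra hn
    exact absurd (le_csSup hSb (show l' ∈ S from ⟨hL0.trans hl'.1, hl'.2, hn⟩)) (not_le.2 hl'.1)
  have hPL : P L := h.planeRefl_limit he hL0.le hL1 hPgt
  have hT : IsCompact {y : Euc N | ‖y‖ ≤ 1 ∧ L + ε ≤ ⟪e, y⟫} := by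
    have h1 : {y : Euc N | ‖y‖ ≤ 1 ∧ L + ε ≤ ⟪e, y⟫} =
        Metric.closedBall 0 1 ∩ ((fun x => ⟪e, x⟫) ⁻¹' Ici (L + ε)) := by
      ext x; simp
    rw [h1]
    exact (isCompact_closedBall _ _).inter_right (isClosed_Ici.preimage (by fun_prop))
  obtain ⟨m, hm0, hm⟩ := hT.exists_forall_le' (f := fun y => v (planeRefl e L y) - v y) (a := 0)
    ((h.continuousOn_comp_planeRefl he hL0.le).mono fun y hy =>
      ⟨hy.1, (le_add_of_nonneg_right hε0.le).trans hy.2⟩) (by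
      rintro y ⟨h1, h2⟩
      exact sub_pos.2 (h.planeRefl_strict he hL0 hPL h1 (by linarith)))
  have huc := (isCompact_closedBall (0 : Euc N) 1).uniformContinuousOn_of_continuous h.cont
  rw [Metric.uniformContinuousOn_iff] at huc
  obtain ⟨δ, hδ0, hδ⟩ := huc m hm0
  obtain ⟨l', hl'S, hl'⟩ := exists_lt_of_lt_csSup ⟨l, hlS⟩
    (show L - min (δ / 2) ε < sSup S by
      have : 0 < min (δ / 2) ε := lt_min (by positivity) hε0
      linarith)
  have hl'L : l' ≤ L := le_csSup hSb hl'S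
  refine hl'S.2.2 (h.planeRefl_narrow (b := L + ε) he hl'S.1 hM hC hK hCK ?_ ?_)
  · have h1 : (C + 1) * (L + ε - l') ≤ (C + 1) * (ε + ε) := by
      gcongr
      linarith [min_le_right (δ / 2) ε]
    linarith [Real.pi_gt_three]
  · intro y hy hly hyb
    have h1 : m ≤ v (planeRefl e L y) - v y := hm y ⟨hy, hyb⟩
    have h2 := hδ (planeRefl e L y)
      (by simpa using (norm_planeRefl_le he hL0.le (by linarith)).trans hy)
      (planeRefl e l' y)
      (by simpa using (norm_planeRefl_le he hl'S.1.le hly).trans hy) (by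
        have : planeRefl e L y - planeRefl e l' y = (2 * (L - l')) • e := by
          unfold planeRefl; module
        rw [dist_eq_norm, this, norm_smul, he, mul_one, Real.norm_eq_abs,
          abs_of_nonneg (by linarith)]
        linarith [min_le_left (δ / 2) ε])
    rw [Real.dist_eq] at h2
    linarith [(abs_lt.1 h2).2]

theorem IsBallSolution.le_reflection (h : IsBallSolution g v) (he : ‖e‖ = 1) (hx : ‖x‖ ≤ 1)
    (hex : 0 ≤ ⟪e, x⟫) : v x ≤ v ((Submodule.reflection (ℝ ∙ e)ᗮ) x) := by
  have := h.planeRefl_limit he le_rfl one_pos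
    (fun l' hl' => h.planeRefl_all he hl'.1 hl'.2) x hx hex
  rw [planeRefl_eq he] at this
  simpa using this

theorem IsBallSolution.radial (h : IsBallSolution g v) {x y : Euc N} (hx : ‖x‖ ≤ 1)
    (hxy : ‖x‖ = ‖y‖) : v x = v y := by
  have key : ∀ x y : Euc N, ‖x‖ ≤ 1 → ‖x‖ = ‖y‖ → v x ≤ v y := by
    intro x y hx hxy
    rcases eq_or_ne x y with rfl | hne
    · exact le_rfl
    have hn : 0 < ‖x - y‖ := norm_pos_iff.2 (sub_ne_zero.2 hne)
    set e : Euc N := ‖x - y‖⁻¹ • (x - y) with he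
    have he1 : ‖e‖ = 1 := by
      rw [he, norm_smul, norm_inv, norm_norm, inv_mul_cancel₀ hn.ne']
    have hspan : (ℝ ∙ e) = (ℝ ∙ (x - y)) :=
      Submodule.span_singleton_smul_eq (IsUnit.mk0 _ (inv_ne_zero hn.ne')) _
    have hin : 0 ≤ ⟪e, x⟫ := by
      rw [he, inner_smul_left]
      refine mul_nonneg (by simp) ?_
      rw [inner_sub_left, real_inner_self_eq_norm_sq]
      have := real_inner_le_norm y x
      rw [← hxy] at this; nlinarith
    have h1 := h.le_reflection he1 hx hin
    have h2 : (Submodule.reflection (ℝ ∙ e)ᗮ) x = y := by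
      simp only [hspan]
      exact Submodule.reflection_sub hxy
    rwa [h2] at h1
  exact le_antisymm (key x y hx hxy) (key y x (hxy ▸ hx) hxy.symm)

end MovingPlanes

end

section

theorem first_crossing {f f' : ℝ → ℝ} {a b : ℝ} (hab : a ≤ b) (hfa : 0 < f a) (hfb : f b ≤ 0)
    (hf : ∀ r ∈ Icc a b, HasDerivAt f (f' r) r) :
    ∃ c ∈ Ioc a b, f c = 0 ∧ f' c ≤ 0 ∧ ∀ r ∈ Ico a c, 0 < f r := by
  have hcont : ContinuousOn f (Icc a b) := fun r hr => (hf r hr).continuousAt.continuousWithinAt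
  set S := Icc a b ∩ f ⁻¹' Iic 0 with hS
  have hSc : IsClosed S := hcont.preimage_isClosed_of_isClosed isClosed_Icc isClosed_Iic
  have hSne : S.Nonempty := ⟨b, ⟨hab, le_rfl⟩, hfb⟩
  have hSb : BddBelow S := ⟨a, fun x hx => hx.1.1⟩
  have hcS : sInf S ∈ S := hSc.csInf_mem hSne hSb
  set c := sInf S with hc
  have hpos : ∀ r ∈ Ico a c, 0 < f r := by
    intro r hr
    by_contra! hn
    have : c ≤ r := csInf_le hSb ⟨⟨hr.1, hr.2.le.trans hcS.1.2⟩, hn⟩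
    exact absurd hr.2 (not_lt.2 this)
  have hac : a < c := by
    refine lt_of_le_of_ne hcS.1.1 fun h => ?_
    have : f c ≤ 0 := hcS.2
    rw [← h] at this; linarith
  have hnb : (𝓝[<] c).NeBot := nhdsLT_neBot c
  have hlt : ∀ᶠ r in 𝓝[<] c, r ∈ Ico a c := by
    filter_upwards [Ioo_mem_nhdsLT hac] with r hr using ⟨hr.1.le, hr.2⟩
  have hfc : f c = 0 := by
    refine le_antisymm hcS.2 ?_
    refine ge_of_tendsto ((hf c hcS.1).continuousAt.tendsto.mono_left nhdsWithin_le_nhds :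
      Tendsto f (𝓝[<] c) (𝓝 (f c))) ?_
    filter_upwards [hlt] with r hr using (hpos r hr).le
  refine ⟨c, ⟨hac, hcS.1.2⟩, hfc, ?_, hpos⟩
  have h1 := (hasDerivAt_iff_tendsto_slope.1 (hf c hcS.1)).mono_left
    (nhdsWithin_mono c (fun x (hx : x < c) => hx.ne) : 𝓝[<] c ≤ 𝓝[≠] c)
  refine le_of_tendsto h1 ?_
  filter_upwards [hlt] with r hr
  rw [slope_def_field, hfc]
  exact div_nonpos_of_nonneg_of_nonpos (by linarith [hpos r hr]) (by linarith [hr.2])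

/-- The radial weight. -/
def weight (k s r : ℝ) : ℝ := (1 + r ^ k) ^ (-s)

/-- `w = r u(r)` and its derivative `y`, for a positive radial solution `u`. -/
structure IsProfile (mu k s p : ℝ) (w y : ℝ → ℝ) : Prop where
  w_zero : w 0 = 0
  w_one : w 1 = 0
  y_zero : 0 < y 0
  pos : ∀ r, 0 < r → r < 1 → 0 < w r
  hw : ∀ r, 0 ≤ r → r ≤ 1 → HasDerivAt w (y r) r
  hy : ∀ r, 0 ≤ r → r ≤ 1 →
    HasDerivAt y (-(r * (mu * (w r / r) + weight k s r * (w r / r) ^ (p - 1)))) r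

/-- `r` times the logarithmic derivative of `1 + r ^ k`, divided by `k`. -/
def theta (k r : ℝ) : ℝ := r ^ k / (1 + r ^ k)

/-- The multiplier shift in the generalized Pohozaev identity. -/
def pohA (k s p r : ℝ) : ℝ := (p - 2 + k * s * theta k r) / (p + 2)

/-- `r` times the derivative of `pohA`. -/
def pohD (k s p r : ℝ) : ℝ := k ^ 2 * s * theta k r * (1 - theta k r) / (p + 2)

/-- The coefficient of the Hardy term in `pohE`. -/
def pohQ (k s p r : ℝ) : ℝ := pohA k s p r ^ 2 - pohA k s p r + pohD k s p r

/-- The weight of the generalized Pohozaev energy. -/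
def pohPhi (k s p r : ℝ) : ℝ := r ^ (2 * ((p - 2) / (p + 2))) * (1 + r ^ k) ^ (2 * s / (p + 2))

/-- The density of the generalized Pohozaev energy. -/
def pohE (mu k s p : ℝ) (w y : ℝ → ℝ) (r : ℝ) : ℝ :=
  (y r - pohA k s p r * (w r / r)) ^ 2 + (pohQ k s p r + mu * r ^ 2) * (w r / r) ^ 2 +
    2 / p * (weight k s r * r ^ 2 * (w r / r) ^ p)

/-- The factor governing the sign of the derivative of the generalized Pohozaev energy. -/
def pohF (mu k s p r : ℝ) : ℝ :=
  (1 - 2 * pohA k s p r) * (2 * (pohA k s p r * (1 - pohA k s p r)) - 3 * pohD k s p r) +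
    k * pohD k s p r * (1 - 2 * theta k r) + 4 * pohA k s p r * mu * r ^ 2

section

variable {mu k s p r : ℝ} {w y : ℝ → ℝ}

theorem one_add_rpow_pos (hr : 0 ≤ r) : 0 < 1 + r ^ k := by positivity

theorem hasDerivAt_one_add_rpow (hr : 0 < r) :
    HasDerivAt (fun r : ℝ => 1 + r ^ k) (k * r ^ k / r) r := by
  have := (Real.hasDerivAt_rpow_const (p := k) (Or.inl hr.ne')).const_add 1
  refine this.congr_deriv ?_
  rw [Real.rpow_sub_one hr.ne']; ring

theorem hasDerivAt_weight (hr : 0 < r) :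
    HasDerivAt (weight k s) (-(k * s * theta k r * weight k s r) / r) r := by
  have h0 := one_add_rpow_pos (k := k) hr.le
  have := (hasDerivAt_one_add_rpow (k := k) hr).rpow_const (p := -s) (Or.inl h0.ne')
  refine this.congr_deriv ?_
  rw [Real.rpow_sub_one h0.ne', theta, weight]
  field_simp

theorem hasDerivAt_theta (hr : 0 < r) :
    HasDerivAt (theta k) (k * theta k r * (1 - theta k r) / r) r := by
  have h0 := one_add_rpow_pos (k := k) hr.le
  have h1 : HasDerivAt (fun r : ℝ => r ^ k) (k * r ^ k / r) r := by
    have := hasDerivAt_one_add_rpow (k := k) hr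
    simpa using this.sub_const 1
  have := h1.fun_div (hasDerivAt_one_add_rpow (k := k) hr) h0.ne'
  refine this.congr_deriv ?_
  rw [theta]
  field_simp

theorem hasDerivAt_pohA (hr : 0 < r) :
    HasDerivAt (pohA k s p) (pohD k s p r / r) r := by
  have := (((hasDerivAt_theta (k := k) hr).const_mul (k * s)).const_add (p - 2)).div_const (p + 2)
  refine this.congr_deriv ?_
  rw [pohD]; ring

theorem hasDerivAt_pohD (hr : 0 < r) :
    HasDerivAt (pohD k s p) (k * (1 - 2 * theta k r) * pohD k s p r / r) r := by
  have h1 := hasDerivAt_theta (k := k) hr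
  have := ((h1.const_mul (k ^ 2 * s)).mul (h1.const_sub 1)).div_const (p + 2)
  refine this.congr_deriv ?_
  rw [pohD]; ring

theorem hasDerivAt_pohPhi (hp : 0 < p) (hr : 0 < r) :
    HasDerivAt (pohPhi k s p) (2 * pohA k s p r * pohPhi k s p r / r) r := by
  have h0 := one_add_rpow_pos (k := k) hr.le
  have h1 := Real.hasDerivAt_rpow_const (x := r) (p := 2 * ((p - 2) / (p + 2))) (Or.inl hr.ne')
  have h2 := (hasDerivAt_one_add_rpow (k := k) hr).rpow_const (p := 2 * s / (p + 2))
    (Or.inl h0.ne')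
  refine (h1.mul h2).congr_deriv ?_
  have h3 : p + 2 ≠ 0 := by positivity
  rw [Real.rpow_sub_one h0.ne', Real.rpow_sub_one hr.ne', pohA, pohPhi, theta]
  field_simp

theorem IsProfile.hasDerivAt_div (h : IsProfile mu k s p w y) (hr : 0 < r) (hr1 : r < 1) :
    HasDerivAt (fun r => w r / r) ((y r - w r / r) / r) r := by
  have := (h.hw r hr.le hr1.le).fun_div (hasDerivAt_id r) hr.ne'
  refine this.congr_deriv ?_
  simp only [id]
  field_simp

theorem IsProfile.div_pos (h : IsProfile mu k s p w y) (hr : 0 < r) (hr1 : r < 1) :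
    0 < w r / r := _root_.div_pos (h.pos r hr hr1) hr

theorem IsProfile.hasDerivAt_div_rpow (h : IsProfile mu k s p w y) (hr : 0 < r) (hr1 : r < 1)
    (q : ℝ) :
    HasDerivAt (fun r => (w r / r) ^ q)
      (q * (w r / r) ^ q * (y r - w r / r) / (r * (w r / r))) r := by
  have h0 := h.div_pos hr hr1
  have := (h.hasDerivAt_div hr hr1).rpow_const (p := q) (Or.inl h0.ne')
  refine this.congr_deriv ?_
  rw [Real.rpow_sub_one h0.ne']
  field_simp

theorem IsProfile.hasDerivAt_y (h : IsProfile mu k s p w y) (hr : 0 < r) (hr1 : r < 1) :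
    HasDerivAt y (-(r * (mu * (w r / r) + weight k s r * ((w r / r) ^ p / (w r / r))))) r := by
  have := h.hy r hr.le hr1.le
  rwa [Real.rpow_sub_one (h.div_pos hr hr1).ne'] at this

theorem IsProfile.hasDerivAt_pohE (h : IsProfile mu k s p w y) (hp : 0 < p) (hr : 0 < r)
    (hr1 : r < 1) :
    HasDerivAt (pohE mu k s p w y)
      ((-2 * pohA k s p r * pohE mu k s p w y r + pohF mu k s p r * (w r / r) ^ 2) / r) r := by
  have hu0 := h.div_pos hr hr1
  have hu := h.hasDerivAt_div hr hr1
  have hA := hasDerivAt_pohA (k := k) (s := s) (p := p) hr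
  have hD := hasDerivAt_pohD (k := k) (s := s) (p := p) hr
  have hQ := ((hA.fun_pow 2).fun_sub hA).fun_add hD
  have hr2 := (hasDerivAt_id r).fun_pow 2
  have h1 := ((h.hasDerivAt_y hr hr1).fun_sub (hA.fun_mul hu)).fun_pow 2
  have h2 := (hQ.fun_add (hr2.const_mul mu)).fun_mul (hu.fun_pow 2)
  have h3 := (((hasDerivAt_weight (k := k) (s := s) hr).fun_mul hr2).fun_mul
    (h.hasDerivAt_div_rpow hr hr1 p)).const_mul (2 / p)
  have := (h1.fun_add h2).fun_add h3
  refine this.congr_deriv ?_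
  simp only [pohE, pohQ, pohF, id]
  have hA' : k * s * theta k r = (p + 2) * pohA k s p r - p + 2 := by
    rw [pohA]; field_simp; ring
  rw [hA']
  generalize (w r / r) ^ p = U
  generalize w r / r = u at hu0
  field_simp
  ring

end

end

section

theorem le_of_hasDerivAt_nonneg {f f' : ℝ → ℝ} {a b : ℝ} (hab : a ≤ b)
    (hf : ∀ r ∈ Icc a b, HasDerivAt f (f' r) r) (hf' : ∀ r ∈ Ioo a b, 0 ≤ f' r) : f a ≤ f b := by
  refine monotoneOn_of_deriv_nonneg (convex_Icc a b)
    (fun r hr => (hf r hr).continuousAt.continuousWithinAt) ?_ ?_ ⟨le_rfl, hab⟩ ⟨hab, le_rfl⟩ hab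
  · rw [interior_Icc]
    exact fun r hr => (hf r (Ioo_subset_Icc_self hr)).differentiableAt.differentiableWithinAt
  · rw [interior_Icc]
    intro r hr
    rw [(hf r (Ioo_subset_Icc_self hr)).deriv]
    exact hf' r hr

/-- The range of parameters. -/
structure Admissible (mu k s p : ℝ) : Prop where
  mu_pos : 0 < mu
  k_nonneg : 0 ≤ k
  one_lt_s : 1 < s
  two_lt_p : 2 < p
  p_le : p ≤ 4
  ks_le : k * s ≤ 4 - p

section

variable {mu k s p r : ℝ} {w y : ℝ → ℝ}

theorem theta_nonneg (hr : 0 ≤ r) : 0 ≤ theta k r := by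
  unfold theta; positivity

theorem theta_le (hk : 0 ≤ k) (hr : 0 ≤ r) (hr1 : r ≤ 1) : theta k r ≤ 1 / 2 := by
  have h1 : r ^ k ≤ 1 := Real.rpow_le_one hr hr1 hk
  have h2 : 0 ≤ r ^ k := by positivity
  rw [theta, div_le_div_iff₀ (by positivity) (by norm_num)]
  linarith

theorem weight_pos (hr : 0 ≤ r) : 0 < weight k s r := by
  unfold weight; positivity

theorem Admissible.ks_nonneg (hA : Admissible mu k s p) : 0 ≤ k * s :=
  mul_nonneg hA.k_nonneg (by linarith [hA.one_lt_s])

theorem Admissible.pohA_pos (hA : Admissible mu k s p) (hr : 0 ≤ r) :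
    0 < pohA k s p r := by
  have h1 := hA.two_lt_p
  have h2 := mul_nonneg hA.ks_nonneg (theta_nonneg (k := k) hr)
  exact _root_.div_pos (by linarith) (by linarith)

theorem Admissible.ks_theta_le (hA : Admissible mu k s p) (hr : 0 ≤ r) (hr1 : r ≤ 1) :
    k * s * theta k r ≤ (4 - p) / 2 := by
  have := mul_le_mul hA.ks_le (theta_le hA.k_nonneg hr hr1) (theta_nonneg hr)
    (by linarith [hA.p_le])
  linarith

theorem Admissible.pohA_le (hA : Admissible mu k s p) (hr : 0 ≤ r) (hr1 : r ≤ 1) :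
    pohA k s p r ≤ 1 / 3 := by
  have h1 := hA.two_lt_p
  have h2 := hA.ks_theta_le hr hr1
  rw [pohA, div_le_div_iff₀ (by linarith) (by norm_num)]
  linarith [hA.p_le]

theorem Admissible.pohD_nonneg (hA : Admissible mu k s p) (hr : 0 ≤ r) (hr1 : r ≤ 1) :
    0 ≤ pohD k s p r := by
  have h1 := hA.two_lt_p
  have h2 := theta_nonneg (k := k) hr
  have h3 := theta_le hA.k_nonneg hr hr1
  have h4 := hA.one_lt_s
  have h5 : 0 ≤ 1 - theta k r := by linarith
  unfold pohD; positivity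

theorem Admissible.pohD_le (hA : Admissible mu k s p) (hr : 0 ≤ r) (hr1 : r ≤ 1) :
    pohD k s p r ≤ k * pohA k s p r := by
  have h1 := hA.two_lt_p
  have h2 := theta_nonneg (k := k) hr
  have h3 := theta_le hA.k_nonneg hr hr1
  have h4 := hA.one_lt_s
  have hk := hA.k_nonneg
  rw [pohD, pohA, mul_div_assoc']
  refine div_le_div_of_nonneg_right ?_ (by linarith)
  have h5 : 0 ≤ k * s * theta k r := mul_nonneg hA.ks_nonneg h2
  have h6 : k * (k * s * theta k r) * (1 - theta k r) ≤ k * (k * s * theta k r) * 1 := by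
    gcongr; linarith
  nlinarith

theorem IsProfile.tendsto_y (h : IsProfile mu k s p w y) : Tendsto y (𝓝[>] 0) (𝓝 (y 0)) :=
  (h.hy 0 le_rfl zero_le_one).continuousAt.tendsto.mono_left nhdsWithin_le_nhds

theorem IsProfile.tendsto_div (h : IsProfile mu k s p w y) :
    Tendsto (fun r => w r / r) (𝓝[>] 0) (𝓝 (y 0)) := by
  have h1 := (hasDerivAt_iff_tendsto_slope.1 (h.hw 0 le_rfl zero_le_one)).mono_left
    (nhdsWithin_mono 0 (fun x (hx : 0 < x) => hx.ne') : 𝓝[>] (0 : ℝ) ≤ 𝓝[≠] 0)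
  refine h1.congr fun r => ?_
  rw [slope_def_field, h.w_zero]; simp

theorem pohE_pos_of_lt (hA : Admissible mu k s p) (hr : 0 < r) (hr1 : r < 1)
    (hu : 0 < w r / r) (hy : 9 / 10 * (w r / r) < y r) : 0 < pohE mu k s p w y r := by
  have h1 := hA.pohA_pos hr.le
  have h2 := hA.pohA_le hr.le hr1.le
  have h3 := hA.pohD_nonneg hr.le hr1.le
  have h4 := weight_pos (k := k) (s := s) hr.le
  have h5 := hA.mu_pos
  have h6 := hA.two_lt_p
  have h7 : 0 ≤ 2 / p * (weight k s r * r ^ 2 * (w r / r) ^ p) := by positivity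
  rw [pohE, pohQ]
  generalize w r / r = u at *
  generalize pohA k s p r = A at *
  have h8 : ((9 / 10 - A) * u) ^ 2 ≤ (y r - A * u) ^ 2 := by
    apply pow_le_pow_left₀ (mul_nonneg (by linarith) hu.le)
    linarith
  have h9 : 0 ≤ (pohD k s p r + mu * r ^ 2) * u ^ 2 := by positivity
  have h10 : 0 < ((9 / 10 - A) ^ 2 + A ^ 2 - A) * u ^ 2 := by
    apply mul_pos _ (by positivity)
    nlinarith
  nlinarith

theorem IsProfile.eventually_lt_y (h : IsProfile mu k s p w y) {c : ℝ} (hc : c < 1) :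
    ∀ᶠ r in 𝓝[>] 0, c * (w r / r) < y r := by
  refine (h.tendsto_div.const_mul c).eventually_lt h.tendsto_y ?_
  nlinarith [h.y_zero]

/-- `1 - u⁻¹ y = - r u' / u`. -/
def pohB (w y : ℝ → ℝ) (r : ℝ) : ℝ := 1 - y r / (w r / r)

def pohM (mu k s p : ℝ) (w : ℝ → ℝ) (r : ℝ) : ℝ :=
  mu * r ^ 2 + weight k s r * r ^ 2 * (w r / r) ^ (p - 2)

theorem IsProfile.hasDerivAt_pohB (h : IsProfile mu k s p w y) (hr : 0 < r) (hr1 : r < 1) :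
    HasDerivAt (pohB w y) ((pohB w y r ^ 2 - pohB w y r + pohM mu k s p w r) / r) r := by
  have hu := h.div_pos hr hr1
  have := ((h.hasDerivAt_y hr hr1).fun_div (h.hasDerivAt_div hr hr1) hu.ne').const_sub 1
  refine this.congr_deriv ?_
  rw [pohB, pohM, Real.rpow_sub hu, Real.rpow_two]
  generalize (w r / r) ^ p = U
  generalize w r / r = u at hu
  field_simp
  ring

theorem IsProfile.hasDerivAt_pohM (h : IsProfile mu k s p w y) (hr : 0 < r) (hr1 : r < 1) :
    HasDerivAt (pohM mu k s p w) ((2 * mu * r ^ 2 + weight k s r * r ^ 2 * (w r / r) ^ (p - 2) *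
      (2 - k * s * theta k r - (p - 2) * pohB w y r)) / r) r := by
  have hu := h.div_pos hr hr1
  have hr2 := (hasDerivAt_id r).fun_pow 2
  have := (hr2.const_mul mu).fun_add (((hasDerivAt_weight (k := k) (s := s) hr).fun_mul hr2).fun_mul
    (h.hasDerivAt_div_rpow hr hr1 (p - 2)))
  refine this.congr_deriv ?_
  rw [pohB]
  simp only [id]
  generalize (w r / r) ^ (p - 2) = U
  generalize w r / r = u at hu
  field_simp
  ring

theorem IsProfile.pohE_eq (h : IsProfile mu k s p w y) (hr : 0 < r) (hr1 : r < 1) :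
    pohE mu k s p w y r = ((1 - pohB w y r - pohA k s p r) ^ 2 + pohQ k s p r + mu * r ^ 2 +
      2 / p * (weight k s r * r ^ 2 * (w r / r) ^ (p - 2))) * (w r / r) ^ 2 := by
  have hu := h.div_pos hr hr1
  rw [pohE, pohB, Real.rpow_sub hu, Real.rpow_two]
  generalize (w r / r) ^ p = U
  generalize w r / r = u at hu
  field_simp
  ring

theorem lt_of_sq_lt {A b : ℝ} (hA : 0 < A) (h : (1 - b - A) ^ 2 < A * (1 - A) / 3) :
    b < 11 / 10 := by
  by_contra! hb
  have : (A + 1 / 10) ^ 2 ≤ (1 - b - A) ^ 2 := by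
    rw [← neg_sq (1 - b - A)]
    exact pow_le_pow_left₀ (by linarith) (by linarith) 2
  nlinarith [sq_nonneg (A - 1 / 20)]

theorem gt_of_sq_lt {A b : ℝ} (hA : A ≤ 1 / 3) (h : (1 - b - A) ^ 2 < A * (1 - A) / 3) :
    3 / 8 < b := by
  by_contra! hb
  have : (5 / 8 - A) ^ 2 ≤ (1 - b - A) ^ 2 :=
    pow_le_pow_left₀ (by linarith) (by linarith) 2
  nlinarith

theorem IsProfile.pohE_pos (h : IsProfile mu k s p w y) (hA : Admissible mu k s p)
    (hr : 0 < r) (hr1 : r < 1) : 0 < pohE mu k s p w y r := by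
  by_contra! hneg
  have hp0 : 0 < p := by linarith [hA.two_lt_p]
  have hsmall : ∀ᶠ t in 𝓝[>] 0, 0 < t ∧ t < r ∧ 9 / 10 * (w t / t) < y t := by
    filter_upwards [Ioo_mem_nhdsGT hr, h.eventually_lt_y (c := 9 / 10) (by norm_num)] with t h1 h2
      using ⟨h1.1, h1.2, h2⟩
  obtain ⟨r0, hr0, hr0r, hy0⟩ := hsmall.exists
  have he0 : 0 < pohE mu k s p w y r0 :=
    pohE_pos_of_lt hA hr0 (hr0r.trans hr1) (h.div_pos hr0 (hr0r.trans hr1)) hy0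
  obtain ⟨c, hc, hec, hec', -⟩ := first_crossing hr0r.le he0 hneg
    (fun t ht => h.hasDerivAt_pohE hp0 (hr0.trans_le ht.1) (ht.2.trans_lt hr1))
  have hc0 : 0 < c := hr0.trans hc.1
  have hc1 : c < 1 := hc.2.trans_lt hr1
  have hu := h.div_pos hc0 hc1
  have hA1 := hA.pohA_pos hc0.le
  have hA2 := hA.pohA_le hc0.le hc1.le
  have hD1 := hA.pohD_nonneg hc0.le hc1.le
  have hD2 := hA.pohD_le hc0.le hc1.le
  have hθ := theta_le hA.k_nonneg hc0.le hc1.le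
  have hF : pohF mu k s p c ≤ 0 := by
    rw [hec, mul_zero, zero_add] at hec'
    by_contra! hF
    have : 0 < pohF mu k s p c * (w c / c) ^ 2 / c := by positivity
    linarith
  have h3D : 2 * (pohA k s p c * (1 - pohA k s p c)) < 3 * pohD k s p c := by
    by_contra! hX
    have h1 : 0 ≤ (1 - 2 * pohA k s p c) *
        (2 * (pohA k s p c * (1 - pohA k s p c)) - 3 * pohD k s p c) :=
      mul_nonneg (by linarith) (by linarith)
    have h2 : 0 ≤ k * pohD k s p c * (1 - 2 * theta k c) :=
      mul_nonneg (mul_nonneg hA.k_nonneg hD1) (by linarith)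
    have h3 : 0 < 4 * pohA k s p c * mu * c ^ 2 := by
      have := hA.mu_pos
      positivity
    rw [pohF] at hF
    linarith
  have hk : 4 / 9 < k := by
    have h1 : 2 * (1 - pohA k s p c) < 3 * k := by
      refine lt_of_mul_lt_mul_left ?_ hA1.le
      linarith
    linarith
  have hp : p < 32 / 9 := by nlinarith [hA.ks_le, hA.one_lt_s]
  have hen := h.pohE_eq hc0 hc1
  rw [hec] at hen
  have hen' : (1 - pohB w y c - pohA k s p c) ^ 2 + pohQ k s p c + mu * c ^ 2 +
      2 / p * (weight k s c * c ^ 2 * (w c / c) ^ (p - 2)) = 0 := by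
    rcases mul_eq_zero.1 hen.symm with h1 | h1
    · exact h1
    · exact absurd h1 (by positivity)
  rw [pohQ] at hen'
  have hM1 : 0 ≤ weight k s c * c ^ 2 * (w c / c) ^ (p - 2) := by
    have := weight_pos (k := k) (s := s) hc0.le
    positivity
  have hmuc : 0 ≤ mu * c ^ 2 := by have := hA.mu_pos; positivity
  have hp2 : 1 / 2 ≤ 2 / p := by
    rw [div_le_div_iff₀ (by norm_num) hp0]; linarith [hA.p_le]
  have hMc : pohM mu k s p w c < 15 / 64 := by
    have h1 : 1 / 2 * (weight k s c * c ^ 2 * (w c / c) ^ (p - 2)) ≤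
      2 / p * (weight k s c * c ^ 2 * (w c / c) ^ (p - 2)) := by gcongr
    have h2 : pohA k s p c * (1 - pohA k s p c) ≤ 2 / 9 := by nlinarith
    have h3 := sq_nonneg (1 - pohB w y c - pohA k s p c)
    rw [pohM]
    linarith
  have hM2 : 0 ≤ 2 / p * (weight k s c * c ^ 2 * (w c / c) ^ (p - 2)) := by positivity
  have hsq : (1 - pohB w y c - pohA k s p c) ^ 2 < pohA k s p c * (1 - pohA k s p c) / 3 := by
    linarith
  have hb1 : pohB w y c < 11 / 10 := lt_of_sq_lt hA1 hsq
  have hb2 : 3 / 8 < pohB w y c := gt_of_sq_lt hA2 hsq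
  have hbB : ∀ t, 0 < t → t ≤ c → pohB w y t ≤ 11 / 10 := by
    intro t ht htc
    by_contra! hbt
    obtain ⟨d, hd, hd0, hd', -⟩ := first_crossing (f := fun t => pohB w y t - 11 / 10) htc
      (by simpa using hbt) (by simpa using hb1.le)
      (fun τ hτ => (h.hasDerivAt_pohB (ht.trans_le hτ.1) (hτ.2.trans_lt hc1)).sub_const _)
    have hd0' : pohB w y d = 11 / 10 := by linarith
    have hdpos : 0 < d := ht.trans hd.1
    rw [hd0'] at hd'
    have : 0 ≤ pohM mu k s p w d := by
      have h1 := weight_pos (k := k) (s := s) hdpos.le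
      have h2 := hA.mu_pos
      have h3 := h.div_pos hdpos (hd.2.trans_lt hc1)
      unfold pohM; positivity
    have : 0 < ((11 / 10 : ℝ) ^ 2 - 11 / 10 + pohM mu k s p w d) / d :=
      _root_.div_pos (by norm_num; linarith) hdpos
    linarith
  have hMmono : ∀ t, 0 < t → t ≤ c → pohM mu k s p w t ≤ pohM mu k s p w c := by
    intro t ht htc
    refine le_of_hasDerivAt_nonneg htc
      (fun τ hτ => h.hasDerivAt_pohM (ht.trans_le hτ.1) (hτ.2.trans_lt hc1)) fun τ hτ => ?_
    have hτ0 : 0 < τ := ht.trans hτ.1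
    have hτ1 : τ < 1 := hτ.2.trans hc1
    have h1 := weight_pos (k := k) (s := s) hτ0.le
    have h2 := hA.mu_pos
    have h3 := h.div_pos hτ0 hτ1
    have h4 := hA.ks_theta_le hτ0.le hτ1.le
    have h5 := mul_le_mul_of_nonneg_left (hbB τ hτ0 hτ.2.le) (sub_nonneg.2 hA.two_lt_p.le)
    have h6 : 0 ≤ 2 - k * s * theta k τ - (p - 2) * pohB w y τ := by linarith
    positivity
  have hsmall2 : ∀ᶠ t in 𝓝[>] 0, 0 < t ∧ t < c ∧ 7 / 10 * (w t / t) < y t := by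
    filter_upwards [Ioo_mem_nhdsGT hc0, h.eventually_lt_y (c := 7 / 10) (by norm_num)] with t h1 h2
      using ⟨h1.1, h1.2, h2⟩
  obtain ⟨t, ht, htc, hyt⟩ := hsmall2.exists
  have hbt : pohB w y t < 3 / 8 := by
    have := (lt_div_iff₀ (h.div_pos ht (htc.trans hc1))).2 hyt
    rw [pohB]; linarith
  obtain ⟨d, hd, hd0, hd', -⟩ := first_crossing (f := fun t => 3 / 8 - pohB w y t) htc.le
    (by simpa using hbt) (by simpa using hb2.le)
    (fun τ hτ => (h.hasDerivAt_pohB (ht.trans_le hτ.1) (hτ.2.trans_lt hc1)).const_sub _)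
  have hd0' : pohB w y d = 3 / 8 := by linarith
  have hdpos : 0 < d := ht.trans hd.1
  have hMd := hMmono d hdpos hd.2
  rw [hd0'] at hd'
  have : ((3 / 8 : ℝ) ^ 2 - 3 / 8 + pohM mu k s p w d) / d < 0 :=
    div_neg_of_neg_of_pos (by norm_num; linarith) hdpos
  linarith

end

end

section

theorem lt_of_hasDerivAt_neg {f f' : ℝ → ℝ} {a b : ℝ} (hab : a < b)
    (hc : ContinuousOn f (Icc a b))
    (hf : ∀ r ∈ Ioo a b, HasDerivAt f (f' r) r) (hf' : ∀ r ∈ Ioo a b, f' r < 0) : f b < f a := by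
  refine strictAntiOn_of_deriv_neg (convex_Icc a b) hc ?_ ⟨le_rfl, hab.le⟩ ⟨hab.le, le_rfl⟩ hab
  rw [interior_Icc]
  intro r hr
  rw [(hf r hr).deriv]
  exact hf' r hr

section

variable {mu k s p r : ℝ} {w y w₁ w₂ y₁ y₂ : ℝ → ℝ}

theorem continuousAt_rpow_left (hk : 0 ≤ k) : ContinuousAt (fun r : ℝ => r ^ k) r :=
  (Real.continuous_rpow_const hk).continuousAt

theorem continuousAt_theta (hk : 0 ≤ k) (hr : 0 ≤ r) : ContinuousAt (theta k) r :=
  (continuousAt_rpow_left hk).div (continuousAt_const.add (continuousAt_rpow_left hk))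
    (one_add_rpow_pos hr).ne'

theorem continuousAt_weight (hk : 0 ≤ k) (hr : 0 ≤ r) : ContinuousAt (weight k s) r :=
  (continuousAt_const.add (continuousAt_rpow_left hk)).rpow_const
    (Or.inl (one_add_rpow_pos hr).ne')

theorem continuousAt_pohA (hk : 0 ≤ k) (hr : 0 ≤ r) : ContinuousAt (pohA k s p) r :=
  (continuousAt_const.add (continuousAt_const.mul (continuousAt_theta hk hr))).div_const _

theorem continuousAt_pohQ (hk : 0 ≤ k) (hr : 0 ≤ r) : ContinuousAt (pohQ k s p) r := by
  have hA := continuousAt_pohA (s := s) (p := p) hk hr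
  have hθ := continuousAt_theta hk hr
  exact ((hA.pow 2).sub hA).add
    (((continuousAt_const.mul hθ).mul (continuousAt_const.sub hθ)).div_const _)

theorem continuousAt_pohPhi (hk : 0 ≤ k) (hp : 2 ≤ p) (hr : 0 ≤ r) :
    ContinuousAt (pohPhi k s p) r :=
  (continuousAt_rpow_left (mul_nonneg zero_le_two
    (div_nonneg (by linarith) (by linarith)))).mul
    ((continuousAt_const.add (continuousAt_rpow_left hk)).rpow_const
      (Or.inl (one_add_rpow_pos hr).ne'))

theorem tendsto_pohE {l : Filter ℝ} {a u₀ v₀ : ℝ} (hk : 0 ≤ k) (hp : 0 < p) (hl : l ≤ 𝓝 a)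
    (ha : 0 ≤ a) (hy : Tendsto y l (𝓝 v₀)) (hu : Tendsto (fun r => w r / r) l (𝓝 u₀)) :
    Tendsto (pohE mu k s p w y) l (𝓝 ((v₀ - pohA k s p a * u₀) ^ 2 +
      (pohQ k s p a + mu * a ^ 2) * u₀ ^ 2 + 2 / p * (weight k s a * a ^ 2 * u₀ ^ p))) := by
  have hA := (continuousAt_pohA (s := s) (p := p) hk ha).tendsto.mono_left hl
  have hQ := (continuousAt_pohQ (s := s) (p := p) hk ha).tendsto.mono_left hl
  have hV := (continuousAt_weight (s := s) hk ha).tendsto.mono_left hl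
  have hr : Tendsto (fun r : ℝ => r ^ 2) l (𝓝 (a ^ 2)) := (tendsto_id'.2 hl).pow 2
  exact (((hy.sub (hA.mul hu)).pow 2).add ((hQ.add (hr.const_mul mu)).mul (hu.pow 2))).add
    (((hV.mul hr).mul (hu.rpow_const (Or.inr hp.le))).const_mul _)

theorem IsProfile.y_one_neg (h : IsProfile mu k s p w y) (hmu : 0 < mu) : y 1 < 0 := by
  by_contra! h1
  have hy : ∀ r, 0 ≤ r → r ≤ 1 → 0 ≤ y r := fun r hr hr1 => by
    refine h1.trans ?_
    have := le_of_hasDerivAt_nonneg (f := fun r => -y r) hr1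
      (fun t ht => (h.hy t (hr.trans ht.1) ht.2).neg) fun t ht => by
        have ht0 : 0 < t := hr.trans_lt ht.1
        have := h.div_pos ht0 ht.2
        have := weight_pos (k := k) (s := s) ht0.le
        rw [neg_neg]; positivity
    linarith
  have h2 := le_of_hasDerivAt_nonneg (f := w) (a := 1 / 2) (b := 1) (by norm_num)
    (fun t ht => h.hw t (by linarith [ht.1]) ht.2) fun t ht => hy t (by linarith [ht.1]) ht.2.le
  have h3 := h.pos (1 / 2) (by norm_num) (by norm_num)
  rw [h.w_one] at h2
  linarith

theorem IsProfile.continuousAt (h : IsProfile mu k s p w y) (hr : 0 ≤ r) (hr1 : r ≤ 1) :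
    ContinuousAt w r ∧ ContinuousAt y r :=
  ⟨(h.hw r hr hr1).continuousAt, (h.hy r hr hr1).continuousAt⟩

theorem IsProfile.hasDerivAt_wronskian (h₁ : IsProfile mu k s p w₁ y₁)
    (h₂ : IsProfile mu k s p w₂ y₂) (hr : 0 < r) (hr1 : r < 1) :
    HasDerivAt (fun r => y₂ r * w₁ r - w₂ r * y₁ r)
      (weight k s r * w₁ r * w₂ r * ((w₁ r / r) ^ (p - 2) - (w₂ r / r) ^ (p - 2))) r := by
  have hu1 := h₁.div_pos hr hr1
  have hu2 := h₂.div_pos hr hr1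
  have := ((h₂.hasDerivAt_y hr hr1).fun_mul (h₁.hw r hr.le hr1.le)).fun_sub
    ((h₂.hw r hr.le hr1.le).fun_mul (h₁.hasDerivAt_y hr hr1))
  refine this.congr_deriv ?_
  have hw1 := h₁.pos r hr hr1
  have hw2 := h₂.pos r hr hr1
  rw [Real.rpow_sub hu1, Real.rpow_two, Real.rpow_sub hu2, Real.rpow_two]
  generalize (w₁ r / r) ^ p = U
  generalize (w₂ r / r) ^ p = U'
  field_simp
  ring

theorem IsProfile.hasDerivAt_quotient (h₁ : IsProfile mu k s p w₁ y₁)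
    (h₂ : IsProfile mu k s p w₂ y₂) (hr : 0 < r) (hr1 : r < 1) :
    HasDerivAt (fun r => w₂ r / w₁ r) ((y₂ r * w₁ r - w₂ r * y₁ r) / w₁ r ^ 2) r :=
  (h₂.hw r hr.le hr1.le).fun_div (h₁.hw r hr.le hr1.le) (h₁.pos r hr hr1).ne'

theorem IsProfile.hasDerivAt_energy_diff (h₁ : IsProfile mu k s p w₁ y₁)
    (h₂ : IsProfile mu k s p w₂ y₂) (hp : 0 < p) (hr : 0 < r) (hr1 : r < 1) :
    HasDerivAt (fun r => pohPhi k s p r *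
        (pohE mu k s p w₂ y₂ r - (w₂ r / w₁ r) ^ 2 * pohE mu k s p w₁ y₁ r))
      (-2 * (w₂ r / w₁ r) * ((y₂ r * w₁ r - w₂ r * y₁ r) / w₁ r ^ 2) *
        (pohPhi k s p r * pohE mu k s p w₁ y₁ r)) r := by
  have := (hasDerivAt_pohPhi (k := k) (s := s) hp hr).fun_mul
    ((h₂.hasDerivAt_pohE hp hr hr1).fun_sub (((h₁.hasDerivAt_quotient h₂ hr hr1).fun_pow 2).fun_mul
      (h₁.hasDerivAt_pohE hp hr hr1)))
  refine this.congr_deriv ?_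
  have hw1 := h₁.pos r hr hr1
  simp only [Nat.add_one_sub_one, pow_one, Nat.cast_ofNat]
  field_simp
  ring

theorem pohPhi_pos (hr : 0 < r) : 0 < pohPhi k s p r := by
  unfold pohPhi; positivity

theorem IsProfile.not_lt (h₁ : IsProfile mu k s p w₁ y₁) (h₂ : IsProfile mu k s p w₂ y₂)
    (hA : Admissible mu k s p) : ¬ y₁ 0 < y₂ 0 := by
  intro hlt
  have hp2 := hA.two_lt_p
  have hp0 : 0 < p := by linarith
  set W : ℝ → ℝ := fun r => y₂ r * w₁ r - w₂ r * y₁ r with hW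
  set q : ℝ → ℝ := fun r => w₂ r / w₁ r with hq
  set H : ℝ → ℝ := fun r => pohPhi k s p r *
    (pohE mu k s p w₂ y₂ r - (w₂ r / w₁ r) ^ 2 * pohE mu k s p w₁ y₁ r) with hH
  have hW0 : W 0 = 0 := by simp [hW, h₁.w_zero, h₂.w_zero]
  have hWcont : ∀ a b, 0 ≤ a → b ≤ 1 → ContinuousOn W (Icc a b) := fun a b ha hb r hr => by
    have c1 := h₁.continuousAt (ha.trans hr.1) (hr.2.trans hb)
    have c2 := h₂.continuousAt (ha.trans hr.1) (hr.2.trans hb)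
    exact ((c2.2.mul c1.1).sub (c2.1.mul c1.2)).continuousWithinAt
  have hWneg : ∀ r, 0 < r → r ≤ 1 → (∀ t, 0 < t → t < r → w₁ t / t < w₂ t / t) → W r < 0 := by
    intro r hr hr1 hlt
    rw [← hW0]
    refine lt_of_hasDerivAt_neg hr (hWcont 0 r le_rfl hr1)
      (fun t ht => h₁.hasDerivAt_wronskian h₂ ht.1 (ht.2.trans_le hr1)) fun t ht => ?_
    have ht1 : t < 1 := ht.2.trans_le hr1
    have hv := weight_pos (k := k) (s := s) ht.1.le
    have hw1 := h₁.pos t ht.1 ht1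
    have hw2 := h₂.pos t ht.1 ht1
    have := Real.rpow_lt_rpow (h₁.div_pos ht.1 ht1).le (hlt t ht.1 ht.2) (sub_pos.2 hp2)
    exact mul_neg_of_pos_of_neg (by positivity) (by linarith)
  have hqlim : Tendsto q (𝓝[>] 0) (𝓝 (y₂ 0 / y₁ 0)) := by
    refine (h₂.tendsto_div.div h₁.tendsto_div h₁.y_zero.ne').congr' ?_
    filter_upwards [self_mem_nhdsWithin] with r hr
    have hr : (0 : ℝ) < r := hr
    simp only [hq, Pi.div_apply]
    rw [div_div_div_cancel_right₀ hr.ne']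
  have hHlim : Tendsto H (𝓝[>] 0) (𝓝 0) := by
    have h1 := tendsto_pohE (mu := mu) (s := s) hA.k_nonneg hp0 nhdsWithin_le_nhds le_rfl
      h₁.tendsto_y h₁.tendsto_div
    have h2 := tendsto_pohE (mu := mu) (s := s) hA.k_nonneg hp0 nhdsWithin_le_nhds le_rfl
      h₂.tendsto_y h₂.tendsto_div
    have h3 : Tendsto (pohPhi k s p) (𝓝[>] 0) (𝓝 0) := by
      have h4 := (continuousAt_pohPhi (s := s) hA.k_nonneg hp2.le le_rfl).tendsto.mono_left
        (nhdsWithin_le_nhds (s := Ioi 0))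
      have h5 : 2 * ((p - 2) / (p + 2)) ≠ 0 :=
        (mul_pos two_pos (_root_.div_pos (by linarith) (by linarith))).ne'
      have h6 : pohPhi k s p 0 = 0 := by rw [pohPhi, Real.zero_rpow h5, zero_mul]
      rwa [h6] at h4
    have := h3.mul (h2.sub ((hqlim.pow 2).mul h1))
    rwa [zero_mul] at this
  obtain ⟨δ, hδ0, hδ1, hδ⟩ : ∃ δ, 0 < δ ∧ δ < 1 ∧ ∀ t, 0 < t → t < δ → w₁ t / t < w₂ t / t := by
    have h1 := h₁.tendsto_div.eventually_lt h₂.tendsto_div hlt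
    obtain ⟨δ, hδ, hsub⟩ := mem_nhdsGT_iff_exists_Ioo_subset.1 h1
    have hδ : (0 : ℝ) < δ := hδ
    refine ⟨min δ (1 / 2), lt_min hδ (by norm_num), (min_le_right _ _).trans_lt (by norm_num),
      fun t ht0 ht => hsub ⟨ht0, ht.trans_le (min_le_left _ _)⟩⟩
  have hWsmall : ∀ r, 0 < r → r ≤ δ → W r < 0 := fun r hr hrδ =>
    hWneg r hr (hrδ.trans hδ1.le) fun t ht0 ht => hδ t ht0 (ht.trans_le hrδ)
  have hHmono : ∀ a b, 0 < a → a < b → b < 1 → (∀ r, 0 < r → r < b → W r < 0) → H a < H b := by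
    intro a b ha hab hb hWb
    have hd : ∀ r ∈ Icc a b, HasDerivAt H _ r := fun r hr =>
      h₁.hasDerivAt_energy_diff h₂ hp0 (ha.trans_le hr.1) (hr.2.trans_lt hb)
    have := lt_of_hasDerivAt_neg (f := fun r => -H r) hab
      (fun r hr => (hd r hr).continuousAt.neg.continuousWithinAt)
      (fun r hr => (hd r (Ioo_subset_Icc_self hr)).neg) fun r hr => by
        have hr0 : 0 < r := ha.trans hr.1
        have hr1 : r < 1 := hr.2.trans hb
        have h1 : 0 < -W r := by linarith [hWb r hr0 hr.2]
        have h2 := h₁.pos r hr0 hr1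
        have h3 := h₂.pos r hr0 hr1
        have h4 := h₁.pohE_pos hA hr0 hr1
        have h5 := pohPhi_pos (k := k) (s := s) (p := p) hr0
        have h6 : 0 < 2 * (w₂ r / w₁ r) * (-W r / w₁ r ^ 2) *
          (pohPhi k s p r * pohE mu k s p w₁ y₁ r) := by positivity
        have h7 : 2 * (w₂ r / w₁ r) * (-W r / w₁ r ^ 2) *
          (pohPhi k s p r * pohE mu k s p w₁ y₁ r) = -2 * (w₂ r / w₁ r) * (W r / w₁ r ^ 2) *
          (pohPhi k s p r * pohE mu k s p w₁ y₁ r) := by ring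
        rw [h7] at h6
        exact neg_lt_zero.2 h6
    exact neg_lt_neg_iff.1 this
  have hHpos : ∀ b, 0 < b → b < 1 → (∀ r, 0 < r → r < b → W r < 0) → 0 < H b := by
    intro b hb hb1 hWb
    have h1 : 0 ≤ H (b / 2) := by
      refine le_of_tendsto hHlim ?_
      filter_upwards [Ioo_mem_nhdsGT (half_pos hb)] with t ht
      exact (hHmono t (b / 2) ht.1 ht.2 (by linarith)
        fun r hr hr2 => hWb r hr (by linarith)).le
    exact h1.trans_lt (hHmono (b / 2) b (by linarith) (by linarith) hb1 hWb)
  by_cases hex : ∃ r, 0 < r ∧ r < 1 ∧ 0 ≤ W r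
  · obtain ⟨r1, hr10, hr11, hWr1⟩ := hex
    have hδr1 : δ < r1 := by
      by_contra! hn
      linarith [hWsmall r1 hr10 hn]
    obtain ⟨c, hc, hWc, -, hcpos⟩ := first_crossing (f := fun r => -W r) hδr1.le
      (by linarith [hWsmall δ hδ0 le_rfl]) (by linarith)
      (fun r hr => (h₁.hasDerivAt_wronskian h₂ (hδ0.trans_le hr.1) (hr.2.trans_lt hr11)).neg)
    have hc0 : 0 < c := hδ0.trans hc.1
    have hc1 : c < 1 := hc.2.trans_lt hr11
    have hWlt : ∀ r, 0 < r → r < c → W r < 0 := fun r hr hrc => by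
      rcases le_total r δ with h1 | h1
      · exact hWsmall r hr h1
      · linarith [hcpos r ⟨h1, hrc⟩]
    have hW0c : y₂ c * w₁ c - w₂ c * y₁ c = 0 := by linarith
    have hw1 := h₁.pos c hc0 hc1
    have hw2 := h₂.pos c hc0 hc1
    have hHc := hHpos c hc0 hc1 hWlt
    have huu : w₁ c / c < w₂ c / c := by
      by_contra! hn
      have hy2 : y₂ c = w₂ c / w₁ c * y₁ c := by field_simp; linarith
      have hu2 : w₂ c / c = w₂ c / w₁ c * (w₁ c / c) := by field_simp
      have hle := Real.rpow_le_rpow (h₂.div_pos hc0 hc1).le hn (sub_pos.2 hp2).le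
      have hE : pohE mu k s p w₂ y₂ c - (w₂ c / w₁ c) ^ 2 * pohE mu k s p w₁ y₁ c =
          2 / p * (weight k s c * w₂ c ^ 2 *
            ((w₂ c / c) ^ (p - 2) - (w₁ c / c) ^ (p - 2))) := by
        rw [Real.rpow_sub (h₁.div_pos hc0 hc1), Real.rpow_sub (h₂.div_pos hc0 hc1),
          Real.rpow_two, Real.rpow_two, pohE, pohE, hy2]
        generalize (w₁ c / c) ^ p = U
        generalize (w₂ c / c) ^ p = U'
        field_simp
        ring
      have hv := weight_pos (k := k) (s := s) hc0.le
      have hΦ := pohPhi_pos (k := k) (s := s) (p := p) hc0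
      have : H c ≤ 0 := by
        simp only [hH]
        rw [hE]
        refine mul_nonpos_of_nonneg_of_nonpos hΦ.le
          (mul_nonpos_of_nonneg_of_nonpos (by positivity)
            (mul_nonpos_of_nonneg_of_nonpos (by positivity) (by linarith)))
      linarith
    have hqanti : ∀ t, 0 < t → t < c → q c < q t := fun t ht htc =>
      lt_of_hasDerivAt_neg htc (fun r hr =>
        (h₁.hasDerivAt_quotient h₂ (ht.trans_le hr.1)
          (hr.2.trans_lt hc1)).continuousAt.continuousWithinAt)
        (fun r hr => h₁.hasDerivAt_quotient h₂ (ht.trans hr.1) (hr.2.trans hc1)) fun r hr =>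
          div_neg_of_neg_of_pos (hWlt r (ht.trans hr.1) hr.2)
            (pow_pos (h₁.pos r (ht.trans hr.1) (hr.2.trans hc1)) 2)
    have hqc : 1 < q c := by
      rw [hq]
      exact (one_lt_div hw1).2 ((div_lt_div_iff_of_pos_right hc0).1 huu)
    have := hWneg c hc0 hc1.le fun t ht htc => by
      have h1 := hqc.trans (hqanti t ht htc)
      have h2 := (one_lt_div (h₁.pos t ht (htc.trans hc1))).1 h1
      exact (div_lt_div_iff_of_pos_right ht).2 h2
    have hWc' : W c = 0 := hW0c
    linarith
  · push Not at hex
    have hW1 : ∀ r, 0 < r → r < 1 → W r < 0 := hex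
    have hn1 := h₁.y_one_neg hA.mu_pos
    have hslope : ∀ {w y : ℝ → ℝ}, IsProfile mu k s p w y →
        Tendsto (fun r => w r / (r - 1)) (𝓝[<] 1) (𝓝 (y 1)) := fun {w y} h => by
      have h1 := (hasDerivAt_iff_tendsto_slope.1 (h.hw 1 zero_le_one le_rfl)).mono_left
        (nhdsWithin_mono 1 (fun x (hx : x < 1) => hx.ne) : 𝓝[<] (1 : ℝ) ≤ 𝓝[≠] 1)
      refine h1.congr fun r => ?_
      rw [slope_def_field, h.w_one, sub_zero]
    have hq1 : Tendsto q (𝓝[<] 1) (𝓝 (y₂ 1 / y₁ 1)) := by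
      refine ((hslope h₂).div (hslope h₁) hn1.ne).congr' ?_
      filter_upwards [self_mem_nhdsWithin] with r hr
      have hr : r < 1 := hr
      simp only [hq, Pi.div_apply]
      rw [div_div_div_cancel_right₀ (by linarith)]
    have hE1 : ∀ {w y : ℝ → ℝ}, IsProfile mu k s p w y →
        Tendsto (pohE mu k s p w y) (𝓝[<] 1) (𝓝 (y 1 ^ 2)) := fun {w y} h => by
      have c := h.continuousAt zero_le_one le_rfl
      have hu : Tendsto (fun r => w r / r) (𝓝[<] 1) (𝓝 0) := by
        have : Tendsto (fun r => w r / r) (𝓝[<] 1) (𝓝 (w 1 / 1)) :=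
          (c.1.tendsto.div tendsto_id one_ne_zero).mono_left nhdsWithin_le_nhds
        simpa [h.w_one] using this
      have := tendsto_pohE (mu := mu) (s := s) hA.k_nonneg hp0
        (nhdsWithin_le_nhds (s := Iio 1)) zero_le_one
        (c.2.tendsto.mono_left nhdsWithin_le_nhds) hu
      simpa [Real.zero_rpow hp0.ne'] using this
    have hΦ := (continuousAt_pohPhi (s := s) hA.k_nonneg hp2.le zero_le_one).tendsto.mono_left
        (nhdsWithin_le_nhds (s := Iio 1))
    have hHlim1 : Tendsto H (𝓝[<] 1) (𝓝 0) := by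
      have := hΦ.mul ((hE1 h₂).sub ((hq1.pow 2).mul (hE1 h₁)))
      have h0 : y₂ 1 ^ 2 - (y₂ 1 / y₁ 1) ^ 2 * y₁ 1 ^ 2 = 0 := by
        field_simp [hn1.ne]
        ring
      rwa [h0, mul_zero] at this
    have hhalf := hHpos (1 / 2) (by norm_num) (by norm_num) fun r hr hr2 => hW1 r hr (by linarith)
    have : H (1 / 2) ≤ 0 := by
      refine ge_of_tendsto hHlim1 ?_
      filter_upwards [Ioo_mem_nhdsLT (show (1 / 2 : ℝ) < 1 by norm_num)] with t ht
      exact (hHmono (1 / 2) t (by norm_num) ht.1 ht.2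
        fun r hr hr2 => hW1 r hr (hr2.trans ht.2)).le
    linarith

theorem IsProfile.y_zero_unique (h₁ : IsProfile mu k s p w₁ y₁) (h₂ : IsProfile mu k s p w₂ y₂)
    (hA : Admissible mu k s p) : y₁ 0 = y₂ 0 :=
  le_antisymm (_root_.not_lt.1 (h₂.not_lt h₁ hA)) (_root_.not_lt.1 (h₁.not_lt h₂ hA))

end

end

section

theorem rpow_sub_rpow_le {q a b M : ℝ} (hq : 1 ≤ q) (ha : 0 ≤ a) (hab : a ≤ b) (hbM : b ≤ M) :
    b ^ q - a ^ q ≤ q * M ^ (q - 1) * (b - a) := by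
  rcases (ha.trans hab).eq_or_lt with hb | hb
  · have : a = 0 := by linarith
    simp [this, ← hb]
  have h1 := one_add_mul_self_le_rpow_one_add (s := (a - b) / b)
    (by rw [le_div_iff₀ hb]; linarith) hq
  have h2 : 1 + (a - b) / b = a / b := by field_simp; ring
  rw [h2, Real.div_rpow ha hb.le] at h1
  have hbq : 0 < b ^ q := by positivity
  rw [le_div_iff₀ hbq] at h1
  have h3 : b ^ (q - 1) ≤ M ^ (q - 1) := Real.rpow_le_rpow hb.le hbM (by linarith)
  have h4 : b ^ (q - 1) = b ^ q / b := Real.rpow_sub_one hb.ne' q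
  have h5 : (1 + q * ((a - b) / b)) * b ^ q = b ^ q - q * b ^ (q - 1) * (b - a) := by
    rw [h4]; field_simp; ring
  have h6 : q * b ^ (q - 1) * (b - a) ≤ q * M ^ (q - 1) * (b - a) := by
    have : 0 ≤ b - a := by linarith
    gcongr
  linarith

theorem exists_second_order_solution {G : ℝ → ℝ → ℝ} {K B : ℝ} (hK : 0 ≤ K) (hB : 0 ≤ B)
    (hlip : ∀ r w w', |G r w - G r w'| ≤ K * |w - w'|) (hcont : ∀ w, Continuous fun r => G r w)
    (hbd : ∀ r ∈ Icc (-1 : ℝ) 2, ∀ w, |G r w| ≤ B) (α : ℝ) :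
    ∃ w y : ℝ → ℝ, w 0 = 0 ∧ y 0 = α ∧
      ∀ r, 0 ≤ r → r ≤ 1 → HasDerivAt w (y r) r ∧ HasDerivAt y (-G r (w r)) r := by
  set Y : ℝ := |α| + 2 * B with hY
  have hY0 : 0 ≤ Y := by positivity
  set c : ℝ → ℝ := fun t => max (-Y) (min t Y) with hc
  have hclip : ∀ t t', |c t - c t'| ≤ |t - t'| := fun t t' => by
    simp only [hc]
    refine (abs_max_sub_max_le_max _ _ _ _).trans ?_
    rw [sub_self, abs_zero]
    refine max_le (abs_nonneg _) ((abs_min_sub_min_le_max _ _ _ _).trans ?_)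
    simp
  have hcY : ∀ t, |c t| ≤ Y := fun t =>
    abs_le.2 ⟨le_max_left _ _, max_le (by linarith) (min_le_right _ _)⟩
  set F : ℝ → ℝ × ℝ → ℝ × ℝ := fun r z => (c z.2, -G r z.1) with hF
  have ht0 : (0 : ℝ) ∈ Icc (-1 : ℝ) 2 := by constructor <;> norm_num
  have hPL : IsPicardLindelof F (⟨0, ht0⟩ : Icc (-1 : ℝ) 2) ((0 : ℝ), α)
      (2 * ⟨Y + B, by positivity⟩) 0 ⟨Y + B, by positivity⟩ ⟨1 + K, by positivity⟩ := by
    refine ⟨fun r _ => LipschitzWith.lipschitzOnWith (LipschitzWith.of_dist_le_mul fun z z' => ?_),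
      fun z _ => ?_, fun r hr z _ => ?_, ?_⟩
    · have h1 : |z.1 - z'.1| ≤ dist z z' := by
        rw [Prod.dist_eq, ← Real.dist_eq]; exact le_max_left _ _
      have h2 : |z.2 - z'.2| ≤ dist z z' := by
        rw [Prod.dist_eq, ← Real.dist_eq]; exact le_max_right _ _
      have h3 : (0 : ℝ) ≤ dist z z' := dist_nonneg
      change dist (F r z) (F r z') ≤ (1 + K) * dist z z'
      rw [Prod.dist_eq]
      simp only [hF, Real.dist_eq]
      refine max_le ((hclip _ _).trans ?_) ?_
      · nlinarith
      · rw [neg_sub_neg, abs_sub_comm]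
        refine (hlip r z.1 z'.1).trans ?_
        nlinarith
    · exact (continuous_const.prodMk (hcont z.1).neg).continuousOn
    · change ‖F r z‖ ≤ Y + B
      rw [Prod.norm_def]
      simp only [hF, norm_neg, Real.norm_eq_abs]
      refine max_le ((hcY _).trans (by linarith)) ((hbd r hr z.1).trans (by linarith))
    · simp only [sub_zero, zero_sub, neg_neg, NNReal.coe_zero]
      rw [max_eq_left (by norm_num)]
      exact (mul_comm _ _).le
  obtain ⟨f, hf0, hf⟩ := hPL.exists_eq_forall_mem_Icc_hasDerivWithinAt₀
  have hf0 : f 0 = (0, α) := hf0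
  have hy' : ∀ t ∈ Icc (-1 : ℝ) 2, HasDerivWithinAt (fun t => (f t).2) (-G t (f t).1)
      (Icc (-1 : ℝ) 2) t := fun t ht =>
    (ContinuousLinearMap.snd ℝ ℝ ℝ).hasFDerivAt.comp_hasDerivWithinAt t (hf t ht)
  have hw' : ∀ t ∈ Icc (-1 : ℝ) 2, HasDerivWithinAt (fun t => (f t).1) (c (f t).2)
      (Icc (-1 : ℝ) 2) t := fun t ht =>
    (ContinuousLinearMap.fst ℝ ℝ ℝ).hasFDerivAt.comp_hasDerivWithinAt t (hf t ht)
  refine ⟨fun t => (f t).1, fun t => (f t).2, by simp [hf0], by simp [hf0], fun r hr hr1 => ?_⟩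
  have hrm : r ∈ Icc (-1 : ℝ) 2 := ⟨by linarith, by linarith⟩
  have hnh : Icc (-1 : ℝ) 2 ∈ 𝓝 r := Icc_mem_nhds (by linarith) (by linarith)
  have hbound : |(f r).2 - α| ≤ B * |r - 0| := by
    have := (convex_Icc (-1 : ℝ) 2).norm_image_sub_le_of_norm_hasDerivWithin_le (C := B) hy'
      (fun t ht => by rw [norm_neg]; exact hbd t ht _) ht0 hrm
    simpa [hf0] using this
  have hcr : c (f r).2 = (f r).2 := by
    have h1 : B * |r - 0| ≤ 2 * B := by
      rw [sub_zero, abs_of_nonneg hr]; nlinarith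
    have h2 : |(f r).2| ≤ Y := by
      have := abs_sub_abs_le_abs_sub (f r).2 α
      rw [hY]; linarith
    rw [abs_le] at h2
    simp only [hc]
    rw [min_eq_left h2.2, max_eq_right h2.1]
  refine ⟨?_, (hy' r hrm).hasDerivAt hnh⟩
  have := (hw' r hrm).hasDerivAt hnh
  rwa [hcr] at this

theorem second_order_dist_le {G : ℝ → ℝ → ℝ} {K : ℝ} (hK : 0 ≤ K)
    (hlip : ∀ r w w', |G r w - G r w'| ≤ K * |w - w'|) {w y w' y' : ℝ → ℝ} {b : ℝ}
    (hw0 : w 0 = w' 0)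
    (h : ∀ r, 0 ≤ r → r ≤ b → HasDerivAt w (y r) r ∧ HasDerivAt y (-G r (w r)) r)
    (h' : ∀ r, 0 ≤ r → r ≤ b → HasDerivAt w' (y' r) r ∧ HasDerivAt y' (-G r (w' r)) r) :
    ∀ r, 0 ≤ r → r ≤ b → |w r - w' r| ≤ |y 0 - y' 0| * Real.exp ((1 + K) * r) ∧
      |y r - y' r| ≤ |y 0 - y' 0| * Real.exp ((1 + K) * r) := by
  intro r hr hrb
  set F : ℝ → ℝ × ℝ → ℝ × ℝ := fun r z => (z.2, -G r z.1) with hF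
  have hL : ∀ r, LipschitzWith ⟨1 + K, by positivity⟩ (F r) := fun r => by
    refine LipschitzWith.of_dist_le_mul fun z z' => ?_
    have h1 : |z.1 - z'.1| ≤ dist z z' := by
      rw [Prod.dist_eq, ← Real.dist_eq]; exact le_max_left _ _
    have h2 : |z.2 - z'.2| ≤ dist z z' := by
      rw [Prod.dist_eq, ← Real.dist_eq]; exact le_max_right _ _
    have h3 : (0 : ℝ) ≤ dist z z' := dist_nonneg
    change dist (F r z) (F r z') ≤ (1 + K) * dist z z'
    rw [Prod.dist_eq]
    simp only [hF, Real.dist_eq]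
    refine max_le (h2.trans ?_) ?_
    · nlinarith
    · rw [neg_sub_neg, abs_sub_comm]
      refine (hlip r z.1 z'.1).trans ?_
      nlinarith
  have hd : ∀ {w y : ℝ → ℝ},
      (∀ r, 0 ≤ r → r ≤ b → HasDerivAt w (y r) r ∧ HasDerivAt y (-G r (w r)) r) →
      ∀ t, 0 ≤ t → t ≤ b → HasDerivAt (fun t => (w t, y t)) (F t (w t, y t)) t :=
    fun h t ht htb => (h t ht htb).1.prodMk (h t ht htb).2
  have key := dist_le_of_trajectories_ODE (a := 0) (b := b) (δ := |y 0 - y' 0|) hL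
    (fun t ht => (hd h t ht.1 ht.2).continuousAt.continuousWithinAt)
    (fun t ht => (hd h t ht.1 ht.2.le).hasDerivWithinAt)
    (fun t ht => (hd h' t ht.1 ht.2).continuousAt.continuousWithinAt)
    (fun t ht => (hd h' t ht.1 ht.2.le).hasDerivWithinAt)
    (by rw [Prod.dist_eq]; simp [hw0, Real.dist_eq]) r ⟨hr, hrb⟩
  rw [Prod.dist_eq, sub_zero] at key
  simp only [Real.dist_eq] at key
  exact ⟨(le_max_left _ _).trans key, (le_max_right _ _).trans key⟩

/-- Truncation to `[0, Λ]`. -/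
def clamp (Λ t : ℝ) : ℝ := max 0 (min t Λ)

theorem clamp_nonneg (Λ t : ℝ) : 0 ≤ clamp Λ t := le_max_left _ _

theorem clamp_le {Λ : ℝ} (hΛ : 0 ≤ Λ) (t : ℝ) : clamp Λ t ≤ Λ := max_le hΛ (min_le_right _ _)

theorem clamp_eq {Λ t : ℝ} (h0 : 0 ≤ t) (h1 : t ≤ Λ) : clamp Λ t = t := by
  rw [clamp, min_eq_left h1, max_eq_right h0]

theorem abs_clamp_sub_le (Λ t t' : ℝ) : |clamp Λ t - clamp Λ t'| ≤ |t - t'| := by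
  simp only [clamp]
  refine (abs_max_sub_max_le_max _ _ _ _).trans ?_
  rw [sub_self, abs_zero]
  refine max_le (abs_nonneg _) ((abs_min_sub_min_le_max _ _ _ _).trans ?_)
  simp

/-- Truncated nonlinearity for `w = r u`. -/
def clampG (mu k s p Λ r w : ℝ) : ℝ :=
  r * (mu * clamp Λ (w / r) + weight k s |r| * clamp Λ (w / r) ^ (p - 1))

section

variable {mu k s p Λ : ℝ}

theorem weight_le_one (hs : 0 ≤ s) {r : ℝ} (hr : 0 ≤ r) : weight k s r ≤ 1 :=
  Real.rpow_le_one_of_one_le_of_nonpos (by linarith [Real.rpow_nonneg hr k]) (by linarith)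

theorem clamp_bound (hmu : 0 ≤ mu) (hs : 0 ≤ s) (hp : 1 ≤ p) (hΛ : 0 ≤ Λ) (r t : ℝ) :
    0 ≤ mu * clamp Λ t + weight k s |r| * clamp Λ t ^ (p - 1) ∧
    mu * clamp Λ t + weight k s |r| * clamp Λ t ^ (p - 1) ≤ mu * Λ + Λ ^ (p - 1) := by
  have h1 := clamp_nonneg Λ t
  have h2 := clamp_le hΛ t
  have h3 := (weight_pos (k := k) (s := s) (abs_nonneg r)).le
  have h4 := weight_le_one (k := k) hs (abs_nonneg r)
  have h5 : clamp Λ t ^ (p - 1) ≤ Λ ^ (p - 1) := Real.rpow_le_rpow h1 h2 (by linarith)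
  have h6 : 0 ≤ clamp Λ t ^ (p - 1) := Real.rpow_nonneg h1 _
  refine ⟨by positivity, add_le_add (by gcongr) ?_⟩
  calc _ ≤ 1 * clamp Λ t ^ (p - 1) := by gcongr
    _ ≤ _ := by rwa [one_mul]

theorem clampG_lip (hmu : 0 ≤ mu) (hs : 0 ≤ s) (hp : 2 ≤ p) (hΛ : 0 ≤ Λ) (r w w' : ℝ) :
    |clampG mu k s p Λ r w - clampG mu k s p Λ r w'| ≤
      (mu + (p - 1) * Λ ^ (p - 2)) * |w - w'| := by
  have hKK : 0 ≤ mu + (p - 1) * Λ ^ (p - 2) := by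
    have : 0 ≤ p - 1 := by linarith
    positivity
  rcases eq_or_ne r 0 with rfl | hr
  · simp only [clampG, zero_mul, sub_self, abs_zero]; positivity
  have hpow : ∀ t t', |clamp Λ t ^ (p - 1) - clamp Λ t' ^ (p - 1)| ≤
      (p - 1) * Λ ^ (p - 2) * |clamp Λ t - clamp Λ t'| := by
    have key : ∀ a b, 0 ≤ a → a ≤ b → b ≤ Λ → |b ^ (p - 1) - a ^ (p - 1)| ≤
        (p - 1) * Λ ^ (p - 2) * |b - a| := fun a b ha hab hb => by
      rw [abs_of_nonneg (sub_nonneg.2 hab),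
        abs_of_nonneg (sub_nonneg.2 (Real.rpow_le_rpow ha hab (by linarith)))]
      have := rpow_sub_rpow_le (q := p - 1) (by linarith) ha hab hb
      rwa [show p - 1 - 1 = p - 2 by ring] at this
    intro t t'
    rcases le_total (clamp Λ t') (clamp Λ t) with h | h
    · exact key _ _ (clamp_nonneg _ _) h (clamp_le hΛ _)
    · rw [abs_sub_comm, abs_sub_comm (clamp Λ t)]
      exact key _ _ (clamp_nonneg _ _) h (clamp_le hΛ _)
  have h3 := (weight_pos (k := k) (s := s) (abs_nonneg r)).le
  have h4 := weight_le_one (k := k) hs (abs_nonneg r)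
  set t := clamp Λ (w / r)
  set t' := clamp Λ (w' / r)
  have h5 : clampG mu k s p Λ r w - clampG mu k s p Λ r w' =
      r * (mu * (t - t') + weight k s |r| * (t ^ (p - 1) - t' ^ (p - 1))) := by
    rw [clampG, clampG]; ring
  have h6 : |t - t'| ≤ |w - w'| / |r| := by
    rw [← abs_div, sub_div]; exact abs_clamp_sub_le _ _ _
  have h7 : |mu * (t - t') + weight k s |r| * (t ^ (p - 1) - t' ^ (p - 1))| ≤
      (mu + (p - 1) * Λ ^ (p - 2)) * |t - t'| := by
    refine (abs_add_le _ _).trans ?_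
    rw [abs_mul, abs_mul, abs_of_nonneg hmu, abs_of_nonneg h3, add_mul]
    refine add_le_add le_rfl ?_
    calc _ ≤ 1 * |t ^ (p - 1) - t' ^ (p - 1)| := mul_le_mul_of_nonneg_right h4 (abs_nonneg _)
      _ ≤ _ := by rw [one_mul]; exact hpow _ _
  rw [h5, abs_mul]
  have hr' : 0 < |r| := abs_pos.2 hr
  calc _ ≤ |r| * ((mu + (p - 1) * Λ ^ (p - 2)) * (|w - w'| / |r|)) := by
        gcongr
        exact h7.trans (by gcongr)
    _ = _ := by field_simp

theorem clampG_cont (hmu : 0 ≤ mu) (hk : 0 ≤ k) (hs : 0 ≤ s) (hp : 2 ≤ p) (hΛ : 0 ≤ Λ) (w : ℝ) :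
    Continuous fun r => clampG mu k s p Λ r w := by
  have hcl : Continuous (clamp Λ) := continuous_const.max (continuous_id.min continuous_const)
  rw [continuous_iff_continuousAt]
  intro r
  rcases eq_or_ne r 0 with rfl | hr
  · set B := mu * Λ + Λ ^ (p - 1) with hB
    have h0 : Tendsto (fun r : ℝ => |r| * B) (𝓝 0) (𝓝 0) := by
      have : Continuous fun r : ℝ => |r| * B := by fun_prop
      simpa using this.tendsto 0
    rw [ContinuousAt, show clampG mu k s p Λ 0 w = 0 by simp [clampG]]
    refine squeeze_zero_norm (fun r => ?_) h0
    rw [clampG, Real.norm_eq_abs, abs_mul]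
    have := clamp_bound (k := k) hmu hs (by linarith : 1 ≤ p) hΛ r (w / r)
    rw [abs_of_nonneg this.1]
    exact mul_le_mul_of_nonneg_left this.2 (abs_nonneg _)
  · have h1 : ContinuousAt (fun r => clamp Λ (w / r)) r :=
      ContinuousAt.comp (g := clamp Λ) hcl.continuousAt (continuousAt_const.div continuousAt_id hr)
    have h2 : ContinuousAt (fun r => weight k s |r|) r :=
      ContinuousAt.comp (g := weight k s) (continuousAt_weight hk (abs_nonneg r))
        continuous_abs.continuousAt
    exact continuousAt_id.mul ((continuousAt_const.mul h1).add
      (h2.mul (h1.rpow_const (Or.inr (by linarith)))))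

/-- For every slope at the origin there is a solution of the truncated radial equation. -/
theorem exists_clamp_solution (hmu : 0 ≤ mu) (hk : 0 ≤ k) (hs : 0 ≤ s) (hp : 2 ≤ p) (hΛ : 0 ≤ Λ)
    (α : ℝ) : ∃ w y : ℝ → ℝ, w 0 = 0 ∧ y 0 = α ∧ ∀ r, 0 ≤ r → r ≤ 1 →
      HasDerivAt w (y r) r ∧ HasDerivAt y (-clampG mu k s p Λ r (w r)) r := by
  have hp1 : 0 ≤ p - 1 := by linarith
  refine exists_second_order_solution (K := mu + (p - 1) * Λ ^ (p - 2))
    (B := 2 * (mu * Λ + Λ ^ (p - 1))) (by positivity) (by positivity)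
    (clampG_lip hmu hs hp hΛ) (clampG_cont hmu hk hs hp hΛ) (fun r hr w => ?_) α
  have := clamp_bound (k := k) hmu hs (by linarith : 1 ≤ p) hΛ r (w / r)
  rw [clampG, abs_mul, abs_of_nonneg this.1]
  exact mul_le_mul (abs_le.2 ⟨by linarith [hr.1], hr.2⟩) this.2 this.1 zero_le_two

end

end

section

variable {mu k s p Λ α r r' b : ℝ} {w y : ℝ → ℝ}

/-- A solution of the truncated radial equation on `[0, 1]` with slope `α` at the origin. -/
structure IsShot (mu k s p Λ α : ℝ) (w y : ℝ → ℝ) : Prop where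
  w_zero : w 0 = 0
  y_zero : y 0 = α
  pos : 0 < α
  le : α ≤ Λ
  hw : ∀ r, 0 ≤ r → r ≤ 1 → HasDerivAt w (y r) r
  hy : ∀ r, 0 ≤ r → r ≤ 1 → HasDerivAt y (-clampG mu k s p Λ r (w r)) r

theorem two_rpow_le_weight (hk : 0 ≤ k) (hs : 0 ≤ s) (hr : 0 ≤ r) (hr1 : r ≤ 1) :
    (2 : ℝ) ^ (-s) ≤ weight k s r := by
  have h1 : r ^ k ≤ 1 := Real.rpow_le_one hr hr1 hk
  have h2 : 0 ≤ r ^ k := by positivity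
  exact Real.rpow_le_rpow_of_nonpos (by linarith) (by linarith) (by linarith)

theorem clampG_nonneg (hmu : 0 ≤ mu) (hr : 0 ≤ r) (t : ℝ) : 0 ≤ clampG mu k s p Λ r t := by
  have h1 := clamp_nonneg Λ (t / r)
  have h2 := (weight_pos (k := k) (s := s) (abs_nonneg r)).le
  unfold clampG
  positivity

theorem IsShot.y_anti (h : IsShot mu k s p Λ α w y) (hmu : 0 ≤ mu) (hr : 0 ≤ r) (hrr : r ≤ r')
    (hr' : r' ≤ 1) : y r' ≤ y r := by
  have := le_of_hasDerivAt_nonneg (f := fun t => -y t) hrr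
    (fun t ht => (h.hy t (hr.trans ht.1) (ht.2.trans hr')).fun_neg)
    (fun t ht => by rw [neg_neg]; exact clampG_nonneg hmu (hr.trans ht.1.le) _)
  simpa using this

theorem IsShot.tangent (h : IsShot mu k s p Λ α w y) (hmu : 0 ≤ mu) (hr : 0 ≤ r) (hr1 : r ≤ 1)
    (hr' : 0 ≤ r') (hr1' : r' ≤ 1) : w r' ≤ w r + y r * (r' - r) := by
  rcases le_total r r' with hrr | hrr
  · have := le_of_hasDerivAt_nonneg (f := fun t => y r * t - w t) hrr
      (fun t ht => (((hasDerivAt_id t).const_mul (y r)).fun_sub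
        (h.hw t (hr.trans ht.1) (ht.2.trans hr1'))))
      (fun t ht => by
        have := h.y_anti hmu hr ht.1.le (ht.2.le.trans hr1')
        linarith)
    linarith
  · have := le_of_hasDerivAt_nonneg (f := fun t => w t - y r * t) hrr
      (fun t ht => ((h.hw t (hr'.trans ht.1) (ht.2.trans hr1)).fun_sub
        ((hasDerivAt_id t).const_mul (y r))))
      (fun t ht => by
        have := h.y_anti hmu (hr'.trans ht.1.le) ht.2.le hr1
        linarith)
    linarith

theorem IsShot.le_mul (h : IsShot mu k s p Λ α w y) (hmu : 0 ≤ mu) (hr : 0 ≤ r) (hr1 : r ≤ 1) :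
    w r ≤ α * r := by
  have := h.tangent hmu le_rfl zero_le_one hr hr1
  rw [h.w_zero, h.y_zero] at this
  linarith

theorem IsShot.eventually_pos (h : IsShot mu k s p Λ α w y) : ∀ᶠ t in 𝓝[>] 0, 0 < w t := by
  have h1 := h.hw 0 le_rfl zero_le_one
  rw [h.y_zero, hasDerivAt_iff_tendsto_slope] at h1
  have h2 := h1.mono_left (nhdsWithin_mono 0 (fun t (ht : 0 < t) => ht.ne'))
  filter_upwards [h2.eventually (lt_mem_nhds h.pos), self_mem_nhdsWithin] with t ht ht0
  rw [slope_def_field, h.w_zero, sub_zero, sub_zero] at ht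
  exact (div_pos_iff_of_pos_right ht0).1 ht

theorem IsShot.pos_of_nonneg (h : IsShot mu k s p Λ α w y) (hmu : 0 ≤ mu) (hr : 0 < r)
    (hrb : r < b) (hb : b ≤ 1) (hwb : 0 ≤ w b) : 0 < w r := by
  obtain ⟨e, he, he0, her⟩ := (h.eventually_pos.and (Ioo_mem_nhdsGT hr)).exists
  by_contra! hle
  have h1 := h.tangent hmu hr.le (hrb.le.trans hb) he0.le (by linarith)
  have h2 := h.tangent hmu hr.le (hrb.le.trans hb) (by linarith) hb
  have h3 : 0 < y r * (e - r) := by linarith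
  have h4 : y r < 0 := by
    by_contra! h5
    nlinarith
  nlinarith

theorem IsShot.clampG_eq (h : IsShot mu k s p Λ α w y) (hmu : 0 ≤ mu) (hr : 0 ≤ r) (hr1 : r ≤ 1)
    (hw : 0 ≤ w r) : clampG mu k s p Λ r (w r) =
      r * (mu * (w r / r) + weight k s r * (w r / r) ^ (p - 1)) := by
  have h1 : w r / r ≤ Λ := by
    rcases hr.eq_or_lt with rfl | hr0
    · simpa using h.pos.le.trans h.le
    · rw [div_le_iff₀ hr0]
      exact (h.le_mul hmu hr hr1).trans (mul_le_mul_of_nonneg_right h.le hr)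
  rw [clampG, clamp_eq (by positivity) h1, abs_of_nonneg hr]

/-- A small slope at the origin forces positivity on `(0, 1]`. -/
theorem IsShot.pos_of_small (h : IsShot mu k s p Λ α w y) (hA : Admissible mu k s p)
    (hα : mu + α ^ (p - 2) < Real.pi ^ 2) : 0 < w 1 := by
  have hmu := hA.mu_pos.le
  by_contra! h1
  obtain ⟨e, he, he0, he1⟩ := (h.eventually_pos.and (Ioo_mem_nhdsGT one_pos)).exists
  have hwc : ContinuousOn w (Icc e 1) := fun t ht =>
    (h.hw t (he0.le.trans ht.1) ht.2).continuousAt.continuousWithinAt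
  obtain ⟨b, hb, hwb⟩ := intermediate_value_Icc' he1.le hwc ⟨h1, he.le⟩
  have hb0 : 0 < b := he0.trans_le hb.1
  have hbπ : Real.pi ≤ Real.pi / b := by
    rw [le_div_iff₀ hb0]; nlinarith [Real.pi_pos, hb.2]
  set m := Real.pi / b with hm
  have hm0 : 0 < m := by positivity
  have hmb : m * b = Real.pi := by rw [hm]; field_simp
  have hder : ∀ t, 0 ≤ t → t ≤ b → HasDerivAt
      (fun t => y t * Real.sin (m * t) - m * (w t * Real.cos (m * t)))
      ((m ^ 2 * w t - clampG mu k s p Λ t (w t)) * Real.sin (m * t)) t := fun t ht htb => by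
    have a1 := h.hy t ht (htb.trans hb.2)
    have a2 := h.hw t ht (htb.trans hb.2)
    have a3 : HasDerivAt (fun t => m * t) m t := by simpa using (hasDerivAt_id t).const_mul m
    refine ((a1.fun_mul a3.sin).fun_sub ((a2.fun_mul a3.cos).const_mul m)).congr_deriv ?_
    ring
  have hlt := lt_of_hasDerivAt_neg
    (f := fun t => -(y t * Real.sin (m * t) - m * (w t * Real.cos (m * t)))) hb0
    (fun t ht => (hder t ht.1 ht.2).fun_neg.continuousAt.continuousWithinAt)
    (fun t ht => (hder t ht.1.le ht.2.le).fun_neg) (fun t ht => by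
      have hwt := h.pos_of_nonneg hmu ht.1 ht.2 hb.2 hwb.ge
      have ht1 : t ≤ 1 := ht.2.le.trans hb.2
      have hsin : 0 < Real.sin (m * t) := by
        refine Real.sin_pos_of_pos_of_lt_pi (mul_pos hm0 ht.1) ?_
        rw [← hmb]
        exact mul_lt_mul_of_pos_left ht.2 hm0
      have hu : 0 < w t / t := div_pos hwt ht.1
      have hu1 : w t / t ≤ α := by
        rw [div_le_iff₀ ht.1]; exact h.le_mul hmu ht.1.le ht1
      have e1 : (w t / t) ^ (p - 1) = (w t / t) ^ (p - 2) * (w t / t) := by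
        rw [← Real.rpow_add_one hu.ne']; congr 1; ring
      have e2 : (w t / t) ^ (p - 2) ≤ α ^ (p - 2) :=
        Real.rpow_le_rpow hu.le hu1 (by linarith [hA.two_lt_p])
      have e3 := weight_le_one (k := k) (s := s) (by linarith [hA.one_lt_s]) ht.1.le
      have e4 := (weight_pos (k := k) (s := s) ht.1.le).le
      have e5 : weight k s t * (w t / t) ^ (p - 2) ≤ α ^ (p - 2) := by
        have : 0 ≤ (w t / t) ^ (p - 2) := by positivity
        nlinarith
      have hG : clampG mu k s p Λ t (w t) = (mu + weight k s t * (w t / t) ^ (p - 2)) * w t := by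
        rw [h.clampG_eq hmu ht.1.le ht1 hwt.le, e1]
        have : t ≠ 0 := ht.1.ne'
        field_simp
      have hm2 : Real.pi ^ 2 ≤ m ^ 2 := by
        have := Real.pi_pos
        gcongr
      have : 0 < m ^ 2 * w t - clampG mu k s p Λ t (w t) := by
        rw [hG, ← sub_mul]
        exact mul_pos (by linarith) hwt
      have := mul_pos this hsin
      linarith)
  simp [h.w_zero, hmb, hwb] at hlt

end

section

variable {mu k s p Λ α r r' b : ℝ} {w y : ℝ → ℝ}

theorem IsShot.half_le (h : IsShot mu k s p Λ α w y) (hmu : 0 ≤ mu) (h1 : 0 ≤ w 1) (hr : 0 ≤ r)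
    (hr1 : r ≤ 1) : w r ≤ 2 * w (1 / 2) := by
  have a1 := h.tangent hmu (r := 1 / 2) (r' := 1) (by norm_num) (by norm_num) (by norm_num) le_rfl
  have a2 := h.tangent hmu (r := 1 / 2) (r' := 0) (by norm_num) (by norm_num) le_rfl (by norm_num)
  have a3 := h.tangent hmu (r := 1 / 2) (by norm_num) (by norm_num) hr hr1
  rw [h.w_zero] at a2
  rcases le_total r (1 / 2) with hr2 | hr2 <;> nlinarith

theorem IsShot.le_half (h : IsShot mu k s p Λ α w y) (hmu : 0 ≤ mu) (h1 : 0 ≤ w 1)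
    (hr : 1 / 4 ≤ r) (hr1 : r ≤ 3 / 4) : w (1 / 2) / 2 ≤ w r := by
  have hr0 : 0 ≤ r := by linarith
  have a1 := h.tangent hmu hr0 (r' := 1) (by linarith) (by norm_num) le_rfl
  have a2 := h.tangent hmu hr0 (r' := 0) (by linarith) le_rfl (by norm_num)
  have a3 := h.tangent hmu hr0 (r' := 1 / 2) (by linarith) (by norm_num) (by norm_num)
  have a4 : 0 < w (1 / 2) := h.pos_of_nonneg hmu (by norm_num) (by norm_num) le_rfl h1
  rw [h.w_zero] at a2
  rcases le_total r (1 / 2) with hr2 | hr2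
  · rcases le_total (y r) 0 with hy | hy <;> nlinarith
  · rcases le_total (y r) 0 with hy | hy <;> nlinarith

theorem IsShot.le_neg_deriv (h : IsShot mu k s p Λ α w y) (hA : Admissible mu k s p) {d : ℝ}
    (hd : 0 ≤ d) (hr : 0 < r) (hr1 : r ≤ 1) (hw : d ≤ w r) :
    r * (2 ^ (-s) * (d / r) ^ (p - 1)) ≤ clampG mu k s p Λ r (w r) := by
  rw [h.clampG_eq hA.mu_pos.le hr.le hr1 (hd.trans hw)]
  have h1 := two_rpow_le_weight (k := k) (s := s) hA.k_nonneg (by linarith [hA.one_lt_s]) hr.le hr1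
  have h2 : d / r ≤ w r / r := by gcongr
  have h3 : (d / r) ^ (p - 1) ≤ (w r / r) ^ (p - 1) :=
    Real.rpow_le_rpow (by positivity) h2 (by linarith [hA.two_lt_p])
  have h4 : (2 : ℝ) ^ (-s) * (d / r) ^ (p - 1) ≤ weight k s r * (w r / r) ^ (p - 1) :=
    mul_le_mul h1 h3 (by positivity) (h1.trans' (by positivity))
  have h5 : 0 ≤ mu * (w r / r) := mul_nonneg hA.mu_pos.le (h2.trans' (by positivity))
  gcongr
  linarith

/-- A bound at the midpoint that does not depend on the slope at the origin. -/
theorem IsShot.exists_bound (hA : Admissible mu k s p) : ∃ M : ℝ, 0 < M ∧ ∀ Λ α w y,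
    IsShot mu k s p Λ α w y → 0 ≤ w 1 → w (1 / 2) ≤ M := by
  have hmu := hA.mu_pos.le
  have hp : 0 < p - 2 := by linarith [hA.two_lt_p]
  set v : ℝ := 2 ^ (-s) with hv
  have hv0 : 0 < v := by positivity
  refine ⟨2 * (256 / v) ^ (1 / (p - 2)), by positivity, fun Λ α w y h h1 => ?_⟩
  set M := w (1 / 2) with hM
  have hM0 : 0 < M := h.pos_of_nonneg hmu (by norm_num) (by norm_num) le_rfl h1
  have a1 := h.tangent hmu (r := 1 / 4) (r' := 0) (by norm_num) (by norm_num) le_rfl (by norm_num)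
  have a2 := h.tangent hmu (r := 3 / 4) (r' := 1) (by norm_num) (by norm_num) (by norm_num) le_rfl
  have a3 := h.half_le hmu h1 (r := 1 / 4) (by norm_num) (by norm_num)
  have a4 := h.half_le hmu h1 (r := 3 / 4) (by norm_num) (by norm_num)
  rw [h.w_zero] at a1
  have key := le_of_hasDerivAt_nonneg (a := 1 / 4) (b := 3 / 4)
    (f := fun t => -y t - v / 4 * (M / 2) ^ (p - 1) * t) (by norm_num)
    (fun t ht => ((h.hy t (by linarith [ht.1]) (by linarith [ht.2])).fun_neg.fun_sub
      ((hasDerivAt_id t).const_mul _))) (fun t ht => by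
      have ht0 : 0 < t := by linarith [ht.1]
      have b1 := h.le_neg_deriv hA (d := M / 2) (by positivity) ht0 (by linarith [ht.2])
        (h.le_half hmu h1 ht.1.le ht.2.le)
      have b2 : (M / 2) ^ (p - 1) ≤ (M / 2 / t) ^ (p - 1) := by
        refine Real.rpow_le_rpow (by positivity) ?_ (by linarith)
        rw [le_div_iff₀ ht0]; nlinarith [ht.2]
      have b3 : 1 / 4 * (v * (M / 2) ^ (p - 1)) ≤ t * (v * (M / 2 / t) ^ (p - 1)) := by
        have := ht.1.le
        gcongr
      linarith)
  have hMp : (M / 2) ^ (p - 1) = (M / 2) ^ (p - 2) * (M / 2) := by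
    rw [← Real.rpow_add_one (by positivity)]; congr 1; ring
  have h5 : v * (M / 2) ^ (p - 2) ≤ 256 := by
    have : v / 8 * (M / 2) ^ (p - 1) ≤ 16 * M := by linarith
    rw [hMp] at this
    by_contra! hc
    nlinarith
  have h6 : (M / 2) ^ (p - 2) ≤ 256 / v := by
    rw [le_div_iff₀ hv0]; linarith
  have h7 : M / 2 ≤ (256 / v) ^ (1 / (p - 2)) := by
    have := Real.rpow_le_rpow (by positivity) h6 (by positivity : 0 ≤ 1 / (p - 2))
    rwa [← Real.rpow_mul (by positivity), mul_one_div_cancel hp.ne', Real.rpow_one] at this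
  linarith

/-- Behaviour on the inner scale. -/
theorem IsShot.inner_scale (h : IsShot mu k s p Λ α w y) (hA : Admissible mu k s p) (hα : 1 ≤ α)
    {e : ℝ} (he : 0 < e) (he1 : e ^ 2 * (mu + 1) ≤ 1) (hw1 : 0 ≤ w 1)
    (hr : r = e * α ^ (-((p - 2) / 2))) :
    r ≤ 1 ∧ e / 2 * α ^ ((4 - p) / 2) ≤ w r := by
  have hmu := hA.mu_pos.le
  have hp := hA.two_lt_p
  have hα0 : 0 < α := h.pos
  have he2 : e ≤ 1 := by nlinarith
  have hr0 : 0 < r := by rw [hr]; positivity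
  have hr1 : r ≤ 1 := by
    have : α ^ (-((p - 2) / 2)) ≤ 1 := Real.rpow_le_one_of_one_le_of_nonpos hα (by linarith)
    have : 0 < α ^ (-((p - 2) / 2)) := by positivity
    rw [hr]; nlinarith
  have hαp : α ^ (p - 1) * r ^ 2 = e ^ 2 * α := by
    rw [hr, mul_pow, ← Real.rpow_natCast (α ^ _), ← Real.rpow_mul hα0.le, mul_left_comm,
      ← Real.rpow_add hα0]
    congr 1
    nth_rewrite 2 [← Real.rpow_one α]
    congr 1
    push_cast; ring
  have hy : ∀ t, 0 ≤ t → t ≤ r → α / 2 ≤ y t := fun t ht htr => by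
    have key := le_of_hasDerivAt_nonneg (a := 0) (b := t)
      (f := fun t => y t + (mu + 1) * α ^ (p - 1) * (t ^ 2 / 2)) ht
      (fun t' ht' => ((h.hy t' ht'.1 (ht'.2.trans (htr.trans hr1))).fun_add
        ((((hasDerivAt_id t').fun_pow 2).div_const 2).const_mul _))) (fun t' ht' => by
        have ht1 : t' < 1 := ht'.2.trans_le (htr.trans hr1)
        have hwt : 0 < w t' := h.pos_of_nonneg hmu ht'.1 ht1 le_rfl hw1
        rw [h.clampG_eq hmu ht'.1.le ht1.le hwt.le]
        have hu : 0 < w t' / t' := div_pos hwt ht'.1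
        have hu1 : w t' / t' ≤ α := by
          rw [div_le_iff₀ ht'.1]; exact h.le_mul hmu ht'.1.le ht1.le
        have e2 : (w t' / t') ^ (p - 1) ≤ α ^ (p - 1) :=
          Real.rpow_le_rpow hu.le hu1 (by linarith)
        have e3 := weight_le_one (k := k) (s := s) (by linarith [hA.one_lt_s]) ht'.1.le
        have e5 : weight k s t' * (w t' / t') ^ (p - 1) ≤ 1 * α ^ (p - 1) :=
          mul_le_mul e3 e2 (by positivity) zero_le_one
        have e6 : α ≤ α ^ (p - 1) := by
          conv_lhs => rw [← Real.rpow_one α]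
          exact Real.rpow_le_rpow_of_exponent_le hα (by linarith)
        have e7 : mu * (w t' / t') ≤ mu * α ^ (p - 1) :=
          mul_le_mul_of_nonneg_left (hu1.trans e6) hmu
        have e8 : mu * (w t' / t') + weight k s t' * (w t' / t') ^ (p - 1) ≤
          (mu + 1) * α ^ (p - 1) := by linarith
        have e9 := mul_le_mul_of_nonneg_left e8 ht'.1.le
        simp only [id, Nat.add_one_sub_one, pow_one, Nat.cast_ofNat]
        linarith)
    have h3 : t ^ 2 ≤ r ^ 2 := by gcongr
    have h4 : 0 ≤ (mu + 1) * α ^ (p - 1) := by positivity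
    have h5 : (mu + 1) * α ^ (p - 1) * t ^ 2 ≤ α := by
      calc (mu + 1) * α ^ (p - 1) * t ^ 2 ≤ (mu + 1) * α ^ (p - 1) * r ^ 2 := by gcongr
        _ = (e ^ 2 * (mu + 1)) * α := by rw [mul_assoc, hαp]; ring
        _ ≤ 1 * α := by gcongr
        _ = α := one_mul _
    simp only [h.y_zero] at key
    linarith
  have key := le_of_hasDerivAt_nonneg (f := fun t => w t - α / 2 * t) hr0.le
    (fun t ht => ((h.hw t ht.1 (ht.2.trans hr1)).fun_sub ((hasDerivAt_id t).const_mul _)))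
    (fun t ht => by linarith [hy t ht.1.le ht.2.le])
  have h6 : α * r = e * α ^ ((4 - p) / 2) := by
    rw [hr, mul_left_comm]
    congr 1
    nth_rewrite 1 [← Real.rpow_one α]
    rw [← Real.rpow_add hα0]
    congr 1
    ring
  simp only [h.w_zero] at key
  exact ⟨hr1, by linarith⟩

/-- A large slope at the origin forces a zero in `(0, 1)`. -/
theorem IsShot.neg_of_large (hA : Admissible mu k s p) : ∃ A : ℝ, 1 ≤ A ∧ ∀ Λ w y,
    IsShot mu k s p Λ A w y → w 1 < 0 := by
  have hmu := hA.mu_pos.le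
  obtain ⟨M, hM, hbound⟩ := IsShot.exists_bound hA
  obtain ⟨e, he, he1⟩ : ∃ e : ℝ, 0 < e ∧ e ^ 2 * (mu + 1) ≤ 1 := by
    refine ⟨1 / (mu + 1), by positivity, ?_⟩
    rw [div_pow, one_pow, div_mul_eq_mul_div, one_mul, div_le_one (by positivity)]
    nlinarith
  rcases hA.p_le.lt_or_eq with hp4 | hp4
  · have ht : Tendsto (fun A : ℝ => e / 2 * A ^ ((4 - p) / 2)) atTop atTop :=
      (tendsto_rpow_atTop (by linarith)).const_mul_atTop (by positivity)
    obtain ⟨A, hA1, hA2⟩ := ((eventually_ge_atTop 1).and (ht.eventually_gt_atTop (2 * M))).exists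
    refine ⟨A, hA1, fun Λ w y h => ?_⟩
    by_contra! hw1
    obtain ⟨hr1, hwr⟩ := h.inner_scale hA hA1 he he1 hw1 rfl
    have hr0 : 0 ≤ e * A ^ (-((p - 2) / 2)) := by positivity
    have := h.half_le hmu hw1 hr0 hr1
    linarith [hbound _ _ _ _ h hw1]
  · set c : ℝ := 2 ^ (-s) * (e / 4) ^ 3 with hc
    have hc0 : 0 < c := by positivity
    obtain ⟨A, ⟨hA1, hA3⟩, hA2⟩ := (((eventually_ge_atTop 1).and (eventually_ge_atTop (2 * e))).and
      (Real.tendsto_log_atTop.eventually_gt_atTop ((2 * M + 2 * c) / c + Real.log e))).exists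
    refine ⟨A, hA1, fun Λ w y h => ?_⟩
    by_contra! hw1
    have hA0 : 0 < A := h.pos
    obtain ⟨hr1, hwr⟩ := h.inner_scale hA hA1 he he1 hw1 rfl
    have hrA : e * A ^ (-((p - 2) / 2)) = e / A := by
      rw [hp4, show -(((4 : ℝ) - 2) / 2) = -1 by norm_num, Real.rpow_neg_one, div_eq_mul_inv]
    rw [hrA] at hr1 hwr
    rw [hp4, sub_self, zero_div, Real.rpow_zero, mul_one] at hwr
    set ρ := e / A with hρ
    have hρ0 : 0 < ρ := by positivity
    have hρ2 : ρ ≤ 1 / 2 := by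
      rw [hρ, div_le_iff₀ hA0]; linarith
    have hw2 := hbound _ _ _ _ h hw1
    have b0 := h.half_le hmu hw1 hρ0.le hr1
    have b1 := h.tangent hmu (r := 1 / 2) (r' := 1) (by norm_num) (by norm_num) (by norm_num) le_rfl
    have hlow : ∀ t, ρ ≤ t → t ≤ 1 / 2 → e / 4 ≤ w t := fun t ht ht2 => by
      have c1 := h.tangent hmu (r := t) (r' := ρ) (by linarith) (by linarith) hρ0.le hr1
      have c2 := h.tangent hmu (r := t) (r' := 1 / 2) (by linarith) (by linarith) (by norm_num)
        (by norm_num)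
      rcases le_total (y t) 0 with hy | hy <;> nlinarith
    have hyl : ∀ t, ρ ≤ t → t ≤ 1 / 2 → -(2 * M) + c * (t⁻¹ - 2) ≤ y t := fun t ht ht2 => by
      have key := le_of_hasDerivAt_nonneg (f := fun t => -y t + c * t⁻¹) ht2
        (fun t' ht' => ((h.hy t' (by linarith [ht'.1]) (by linarith [ht'.2])).fun_neg.fun_add
          ((hasDerivAt_inv (by linarith [ht'.1] : t' ≠ 0)).const_mul _))) (fun t' ht' => by
          have ht0 : 0 < t' := by linarith [ht'.1]
          have d1 := h.le_neg_deriv hA (d := e / 4) (by positivity) ht0 (by linarith [ht'.2])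
            (hlow t' (by linarith [ht'.1]) ht'.2.le)
          rw [show p - 1 = (3 : ℕ) by rw [hp4]; norm_num, Real.rpow_natCast] at d1
          have d2 : t' * (2 ^ (-s) * (e / 4 / t') ^ 3) = c * (t' ^ 2)⁻¹ := by
            rw [hc]; field_simp
          rw [d2] at d1
          linarith)
      norm_num at key
      linarith
    have key := le_of_hasDerivAt_nonneg
      (f := fun t => w t + (2 * M + 2 * c) * t - c * Real.log t) hρ2
      (fun t ht => ((h.hw t (by linarith [ht.1]) (by linarith [ht.2])).fun_add
        ((hasDerivAt_id t).const_mul _)).fun_sub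
          ((Real.hasDerivAt_log (by linarith [ht.1] : t ≠ 0)).const_mul _))
      (fun t ht => by linarith [hyl t ht.1.le ht.2.le])
    have hl2 : Real.log (1 / 2) = -Real.log 2 := by rw [one_div, Real.log_inv]
    have hl3 : Real.log 2 ≤ 1 := by linarith [Real.log_two_lt_d9]
    have hl4 : Real.log ρ = Real.log e - Real.log A := by
      rw [hρ, Real.log_div he.ne' hA0.ne']
    rw [hl2, hl4] at key
    have hl5 : 2 * M + 2 * c < c * (Real.log A - Real.log e) := by
      have := mul_lt_mul_of_pos_left (lt_sub_iff_add_lt.2 hA2) hc0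
      rwa [mul_div_cancel₀ _ hc0.ne'] at this
    have hl6 : 0 < (2 * M + 2 * c) * ρ := by positivity
    have hl7 : c * Real.log 2 ≤ c := by nlinarith
    linarith

theorem exists_shot (hA : Admissible mu k s p) (hα : 0 < α) (hΛ : α ≤ Λ) :
    ∃ w y, IsShot mu k s p Λ α w y := by
  obtain ⟨w, y, h0, h1, h2⟩ := exists_clamp_solution (k := k) (s := s) (p := p) (Λ := Λ)
    hA.mu_pos.le hA.k_nonneg (by linarith [hA.one_lt_s]) hA.two_lt_p.le (hα.le.trans hΛ) α
  exact ⟨w, y, h0, h1, hα, hΛ, fun r hr hr1 => (h2 r hr hr1).1, fun r hr hr1 => (h2 r hr hr1).2⟩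

theorem IsShot.isProfile (h : IsShot mu k s p Λ α w y) (hmu : 0 ≤ mu) (h1 : w 1 = 0) :
    IsProfile mu k s p w y := by
  have hpos : ∀ r, 0 < r → r < 1 → 0 < w r := fun r hr hr1 =>
    h.pos_of_nonneg hmu hr hr1 le_rfl h1.ge
  refine ⟨h.w_zero, h1, h.y_zero ▸ h.pos, hpos, h.hw, fun r hr hr1 => ?_⟩
  have hwr : 0 ≤ w r := by
    rcases hr.eq_or_lt with rfl | hr0
    · exact h.w_zero.ge
    rcases hr1.eq_or_lt with rfl | hr1'
    · exact h1.ge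
    exact (hpos r hr0 hr1').le
  rw [← h.clampG_eq hmu hr hr1 hwr]
  exact h.hy r hr hr1

theorem exists_profile (hA : Admissible mu k s p) (hmu : mu < Real.pi ^ 2) :
    ∃ w y, IsProfile mu k s p w y := by
  have hp := hA.two_lt_p
  obtain ⟨A, hA1, hlarge⟩ := IsShot.neg_of_large hA
  have hA0 : 0 < A := by linarith
  obtain ⟨a, ha0, haA, hsmall⟩ : ∃ a, 0 < a ∧ a ≤ A ∧ mu + a ^ (p - 2) < Real.pi ^ 2 := by
    have hc : ContinuousAt (fun a : ℝ => mu + a ^ (p - 2)) 0 :=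
      continuousAt_const.add (continuousAt_id.rpow_const (Or.inr (by linarith)))
    have h0 : mu + (0 : ℝ) ^ (p - 2) < Real.pi ^ 2 := by
      rwa [Real.zero_rpow (by linarith), add_zero]
    obtain ⟨a, h1, h2⟩ := ((hc.eventually (gt_mem_nhds h0)).filter_mono
      (nhdsWithin_le_nhds (s := Ioi 0)) |>.and (Ioo_mem_nhdsGT hA0)).exists
    exact ⟨a, h2.1, h2.2.le, h1⟩
  have hex : ∀ α : ℝ, ∃ w y : ℝ → ℝ, 0 < α → α ≤ A → IsShot mu k s p A α w y := fun α => by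
    by_cases hα : 0 < α ∧ α ≤ A
    · obtain ⟨w, y, h⟩ := exists_shot hA hα.1 hα.2
      exact ⟨w, y, fun _ _ => h⟩
    · exact ⟨id, id, fun h1 h2 => absurd ⟨h1, h2⟩ hα⟩
  choose W Y hWY using hex
  have hK : 0 ≤ mu + (p - 1) * A ^ (p - 2) := by
    have := hA.mu_pos
    have : 0 ≤ p - 1 := by linarith
    positivity
  have hcont : ContinuousOn (fun α => W α 1) (Icc a A) := by
    refine LipschitzOnWith.continuousOn (K := ⟨Real.exp (1 + (mu + (p - 1) * A ^ (p - 2))),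
      (Real.exp_pos _).le⟩) (LipschitzOnWith.of_dist_le_mul fun α hα β hβ => ?_)
    have hα' := hWY α (ha0.trans_le hα.1) hα.2
    have hβ' := hWY β (ha0.trans_le hβ.1) hβ.2
    have := (second_order_dist_le hK
      (clampG_lip (k := k) hA.mu_pos.le (by linarith [hA.one_lt_s]) hp.le hA0.le)
      (hα'.w_zero.trans hβ'.w_zero.symm)
      (fun r h0 h1 => ⟨hα'.hw r h0 h1, hα'.hy r h0 h1⟩)
      (fun r h0 h1 => ⟨hβ'.hw r h0 h1, hβ'.hy r h0 h1⟩) 1 zero_le_one le_rfl).1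
    rw [hα'.y_zero, hβ'.y_zero, mul_one] at this
    rw [Real.dist_eq, Real.dist_eq, mul_comm]
    exact this
  have e1 := (hWY a ha0 haA).pos_of_small hA hsmall
  have e2 := hlarge _ _ _ (hWY A hA0 le_rfl)
  obtain ⟨α, hα, hw1⟩ := intermediate_value_Icc' haA hcont ⟨e2.le, e1.le⟩
  exact ⟨W α, Y α, (hWY α (ha0.trans_le hα.1) hα.2).isProfile hA.mu_pos.le hw1⟩

end

section

section RadialTestFunction

variable {q : ℝ → ℝ} {δ : ℝ}

theorem eventually_norm_lt {E : Type*} [NormedAddCommGroup E] (hδ : 0 < δ) :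
    ∀ᶠ x : E in 𝓝 0, ‖x‖ < δ := by
  filter_upwards [Metric.ball_mem_nhds (0 : E) hδ] with x hx
  simpa using hx

theorem contDiff_radial {N : ℕ} (hq : ContDiff ℝ (⊤ : ℕ∞) q) (hδ : 0 < δ) (h0 : ∀ r ≤ δ, q r = 0) :
    ContDiff ℝ (⊤ : ℕ∞) (fun x : Euc N => q ‖x‖) := by
  rw [contDiff_iff_contDiffAt]
  intro x
  rcases eq_or_ne x 0 with rfl | hx
  · refine (contDiffAt_const (c := (0 : ℝ))).congr_of_eventuallyEq ?_
    filter_upwards [eventually_norm_lt hδ] with x hx using h0 _ hx.le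
  · exact hq.contDiffAt.comp x (contDiffAt_norm ℝ hx)

theorem norm_fderiv_radial {N : ℕ} [Nontrivial (Euc N)] (hq : ContDiff ℝ (⊤ : ℕ∞) q) (hδ : 0 < δ)
    (h0 : ∀ r ≤ δ, q r = 0) (x : Euc N) :
    ‖fderiv ℝ (fun x : Euc N => q ‖x‖) x‖ ^ 2 = deriv q ‖x‖ ^ 2 := by
  rcases eq_or_ne x 0 with rfl | hx
  · have h1 : (fun x : Euc N => q ‖x‖) =ᶠ[𝓝 0] fun _ => 0 := by
      filter_upwards [eventually_norm_lt hδ] with x hx using h0 _ hx.le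
    have h2 : q =ᶠ[𝓝 0] fun _ => 0 := by
      filter_upwards [gt_mem_nhds hδ] with r hr using h0 _ (le_of_lt hr)
    rw [h1.fderiv_eq, norm_zero, h2.deriv_eq]
    simp
  · have h1 : DifferentiableAt ℝ (fun x : Euc N => ‖x‖) x :=
      (contDiffAt_norm ℝ hx (n := 1)).differentiableAt one_ne_zero
    have h2 := ((hq.differentiable (by simp)) ‖x‖).hasDerivAt.comp_hasFDerivAt x h1.hasFDerivAt
    have h3 : fderiv ℝ (fun x : Euc N => q ‖x‖) x = deriv q ‖x‖ • fderiv ℝ (fun x => ‖x‖) x :=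
      h2.fderiv
    rw [h3, norm_smul, norm_fderiv_norm h1, mul_one, Real.norm_eq_abs, sq_abs]

theorem setIntegral_Ioi_eq_intervalIntegral {f : ℝ → ℝ} (hf : ∀ r, 1 < r → f r = 0) :
    ∫ r in Ioi 0, f r = ∫ r in (0 : ℝ)..1, f r := by
  rw [intervalIntegral.integral_of_le zero_le_one]
  refine setIntegral_eq_of_subset_of_forall_sdiff_eq_zero measurableSet_Ioi
    Ioc_subset_Ioi_self fun r hr => hf r ?_
  by_contra! h
  exact hr.2 ⟨hr.1, h⟩

theorem firstEig_mul_le (hq : ContDiff ℝ (⊤ : ℕ∞) q) (hδ : 0 < δ) (h0 : ∀ r ≤ δ, q r = 0)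
    (h1 : ∀ r, 1 - δ ≤ r → q r = 0) {t : ℝ} (ht : q t ≠ 0) :
    firstEig (Metric.ball (0 : Euc 3) 1) * ∫ r in (0 : ℝ)..1, (r * q r) ^ 2 ≤
      ∫ r in (0 : ℝ)..1, (q r + r * deriv q r) ^ 2 := by
  have hqd : ∀ r, HasDerivAt q (deriv q r) r := fun r =>
    ((hq.differentiable (by simp)) r).hasDerivAt
  have hqc := hq.continuous
  have hq'c : Continuous (deriv q) := hq.continuous_deriv (by simp)
  have hφ := contDiff_radial (N := 3) hq hδ h0
  set φ : Euc 3 → ℝ := fun x => q ‖x‖ with hφdef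
  have hsupp : Function.support φ ⊆ Metric.closedBall 0 (1 - δ) := fun x hx => by
    rw [mem_closedBall_zero_iff]
    by_contra! hc
    exact hx (h1 _ hc.le)
  have hc := HasCompactSupport.of_support_subset_isCompact (isCompact_closedBall _ _) hsupp
  have hts : tsupport φ ⊆ Metric.ball 0 1 :=
    (closure_minimal hsupp Metric.isClosed_closedBall).trans
      (Metric.closedBall_subset_ball (by linarith))
  have ht0 : δ < t := by
    by_contra! h; exact ht (h0 _ h)
  have hne : φ ≠ 0 := fun h => ht (by
    have := congrFun h (EuclideanSpace.single 0 t)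
    simpa [hφdef, abs_of_pos (hδ.trans ht0)] using this)
  set vol : ℝ := (volume : Measure (Euc 3)).real (Metric.ball 0 1)
  have hvol : 0 < vol := by
    refine ENNReal.toReal_pos (Metric.measure_ball_pos _ _ one_pos).ne' ?_
    exact measure_ball_lt_top.ne
  have hder1 : ∀ r, 1 < r → deriv q r = 0 := fun r hr => by
    have : q =ᶠ[𝓝 r] fun _ => 0 := by
      filter_upwards [lt_mem_nhds hr] with r' hr' using h1 _ (by linarith)
    rw [this.deriv_eq]; simp
  have hden : ∫ x, φ x ^ 2 = 3 * vol * ∫ r in (0 : ℝ)..1, (r * q r) ^ 2 := by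
    have := integral_fun_norm_addHaar (volume : Measure (Euc 3)) (fun r => q r ^ 2)
    simp only [finrank_euclideanSpace, Fintype.card_fin, smul_eq_mul, nsmul_eq_mul] at this
    rw [hφdef, this, setIntegral_Ioi_eq_intervalIntegral
      (fun r hr => by rw [h1 r (by linarith)]; simp)]
    simp only [mul_pow]
    push_cast; ring
  have hnum : ∫ x, ‖fderiv ℝ φ x‖ ^ 2 = 3 * vol * ∫ r in (0 : ℝ)..1, (r * deriv q r) ^ 2 := by
    have := integral_fun_norm_addHaar (volume : Measure (Euc 3)) (fun r => deriv q r ^ 2)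
    simp only [finrank_euclideanSpace, Fintype.card_fin, smul_eq_mul, nsmul_eq_mul] at this
    simp only [hφdef, norm_fderiv_radial hq hδ h0]
    rw [this, setIntegral_Ioi_eq_intervalIntegral (fun r hr => by rw [hder1 r hr]; simp)]
    simp only [mul_pow]
    push_cast; ring
  have hparts : ∫ r in (0 : ℝ)..1, (r * deriv q r) ^ 2 =
      ∫ r in (0 : ℝ)..1, (q r + r * deriv q r) ^ 2 := by
    have h2 : ∫ r in (0 : ℝ)..1, (q r ^ 2 + r * (2 * q r * deriv q r)) = 0 := by
      rw [intervalIntegral.integral_eq_sub_of_hasDerivAt (f := fun r => r * q r ^ 2)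
        (fun r _ => by
          refine ((hasDerivAt_id r).fun_mul ((hqd r).fun_pow 2)).congr_deriv ?_
          simp)
        (Continuous.intervalIntegrable (by fun_prop) _ _)]
      simp [h1 1 (by linarith)]
    rw [← sub_eq_zero, ← neg_eq_zero, neg_sub, ← intervalIntegral.integral_sub
      (Continuous.intervalIntegrable (by fun_prop) _ _)
      (Continuous.intervalIntegrable (by fun_prop) _ _), ← h2]
    congr 1; ext r; ring
  have hle : firstEig (Metric.ball (0 : Euc 3) 1) ≤
      (∫ x, ‖fderiv ℝ φ x‖ ^ 2) / (∫ x, φ x ^ 2) := by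
    refine csInf_le ⟨0, ?_⟩ ⟨φ, hφ, hc, hts, hne, rfl⟩
    rintro _ ⟨ψ, -, -, -, -, rfl⟩
    exact div_nonneg (integral_nonneg fun _ => sq_nonneg _) (integral_nonneg fun _ => sq_nonneg _)
  rw [hden, hnum, hparts, mul_div_mul_left _ _ (by positivity)] at hle
  have hD : 0 ≤ ∫ r in (0 : ℝ)..1, (r * q r) ^ 2 :=
    intervalIntegral.integral_nonneg zero_le_one fun _ _ => sq_nonneg _
  have hN : 0 ≤ ∫ r in (0 : ℝ)..1, (q r + r * deriv q r) ^ 2 :=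
    intervalIntegral.integral_nonneg zero_le_one fun _ _ => sq_nonneg _
  rcases hD.eq_or_lt with h | h
  · rw [← h, mul_zero]; exact hN
  · exact (le_div_iff₀ h).1 hle

end RadialTestFunction

/-- A smooth non-expansive truncation at level `e`. -/
theorem exists_smooth_truncation {e : ℝ} (he : 0 < e) : ∃ η : ℝ → ℝ, ContDiff ℝ (⊤ : ℕ∞) η ∧
    (∀ t ≤ e, η t = 0) ∧ (∀ t, 0 ≤ η t) ∧ (∀ t, t - 2 * e ≤ η t) ∧ ∀ t, |deriv η t| ≤ 1 := by
  set η : ℝ → ℝ := fun t => (t - e) * expNegInvGlue ((t - e) / e) with hη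
  have hsm : ContDiff ℝ (⊤ : ℕ∞) η := by
    have : ContDiff ℝ (⊤ : ℕ∞) (fun t : ℝ => (t - e) / e) := by fun_prop
    exact (contDiff_id.sub contDiff_const).mul (expNegInvGlue.contDiff.comp this)
  have hz : ∀ t ≤ e, η t = 0 := fun t ht => by
    simp only [hη]
    rw [expNegInvGlue.zero_of_nonpos (div_nonpos_of_nonpos_of_nonneg (by linarith) he.le), mul_zero]
  have hf : ∀ t, e < t → η t = (t - e) * Real.exp (-(e / (t - e))) := fun t ht => by
    have : ¬ (t - e) / e ≤ 0 := not_le.2 (div_pos (by linarith) he)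
    simp only [hη, expNegInvGlue, if_neg this, inv_div]
  have hpos : ∀ t, 0 ≤ η t := fun t => by
    rcases le_or_gt t e with h | h
    · rw [hz t h]
    · rw [hf t h]; have : 0 ≤ t - e := by linarith
      positivity
  refine ⟨η, hsm, hz, hpos, fun t => ?_, ?_⟩
  · rcases le_or_gt t e with h | h
    · rw [hz t h]; linarith
    · rw [hf t h]
      have h1 : 0 < t - e := by linarith
      have h2 := Real.add_one_le_exp (-(e / (t - e)))
      have h3 : (t - e) * (-(e / (t - e)) + 1) = t - 2 * e := by field_simp; ring
      rw [← h3]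
      gcongr
  · have hgt : ∀ t, e < t → |deriv η t| ≤ 1 := fun t ht => by
      have h1 : 0 < t - e := by linarith
      have h2 : HasDerivAt (fun t => (t - e) * Real.exp (-(e / (t - e))))
          ((1 + e / (t - e)) * Real.exp (-(e / (t - e)))) t := by
        have a1 : HasDerivAt (fun t => t - e) 1 t := (hasDerivAt_id t).sub_const e
        have a2 := ((hasDerivAt_const t e).fun_div a1 h1.ne').fun_neg.exp
        refine (a1.fun_mul a2).congr_deriv ?_
        generalize Real.exp (-(e / (t - e))) = X
        field_simp
        ring
      have h3 : η =ᶠ[𝓝 t] fun t => (t - e) * Real.exp (-(e / (t - e))) := by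
        filter_upwards [lt_mem_nhds ht] with t' ht' using hf t' ht'
      rw [h3.deriv_eq, h2.deriv, abs_of_nonneg (by positivity), Real.exp_neg,
        ← div_eq_mul_inv, div_le_one (Real.exp_pos _), add_comm]
      exact Real.add_one_le_exp _
    have hlt : ∀ t, t < e → |deriv η t| ≤ 1 := fun t ht => by
      have h3 : η =ᶠ[𝓝 t] fun _ => 0 := by
        filter_upwards [gt_mem_nhds ht] with t' ht' using hz t' ht'.le
      rw [h3.deriv_eq]; simp
    intro t
    rcases lt_trichotomy t e with h | rfl | h
    · exact hlt t h
    · have hcl : IsClosed {u | |deriv η u| ≤ 1} :=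
        isClosed_le (hsm.continuous_deriv (by simp)).abs continuous_const
      have : closure (Iio t) ⊆ {u | |deriv η u| ≤ 1} := closure_minimal (fun u hu => hlt u hu) hcl
      exact this (by rw [closure_Iio]; exact self_mem_Iic)
    · exact hgt t h

theorem firstEig_unit_ball_le : firstEig (Metric.ball (0 : Euc 3) 1) ≤ Real.pi ^ 2 := by
  set S := ∫ r in (0 : ℝ)..1, Real.sin (Real.pi * r) ^ 2 with hS
  set L := firstEig (Metric.ball (0 : Euc 3) 1)
  have hπ := Real.pi_pos
  have hsinpos : ∀ r : ℝ, 0 < r → r < 1 → 0 < Real.sin (Real.pi * r) := fun r h0 h1 =>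
    Real.sin_pos_of_pos_of_lt_pi (by positivity) (by nlinarith)
  have hSpos : 0 < S := by
    refine intervalIntegral.intervalIntegral_pos_of_pos_on
      (Continuous.intervalIntegrable (by fun_prop) _ _) (fun r hr => ?_) one_pos
    have := hsinpos r hr.1 hr.2
    positivity
  have hcos : ∫ r in (0 : ℝ)..1, (Real.pi * Real.cos (Real.pi * r)) ^ 2 = Real.pi ^ 2 * S := by
    have h2 : ∫ r in (0 : ℝ)..1, ((Real.pi * Real.cos (Real.pi * r)) ^ 2 -
        Real.pi ^ 2 * Real.sin (Real.pi * r) ^ 2) = 0 := by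
      rw [intervalIntegral.integral_eq_sub_of_hasDerivAt
        (f := fun r => Real.pi * (Real.sin (Real.pi * r) * Real.cos (Real.pi * r)))
        (fun r _ => by
          have a3 : HasDerivAt (fun t => Real.pi * t) Real.pi r := by
            simpa using (hasDerivAt_id r).const_mul Real.pi
          refine ((a3.sin.fun_mul a3.cos).const_mul Real.pi).congr_deriv ?_
          ring)
        (Continuous.intervalIntegrable (by fun_prop) _ _)]
      simp
    rw [intervalIntegral.integral_sub (Continuous.intervalIntegrable (by fun_prop) _ _)
      (Continuous.intervalIntegrable (by fun_prop) _ _), intervalIntegral.integral_const_mul] at h2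
    linarith
  have key : ∀ e : ℝ, 0 < e → e < 1 / 4 → 0 ≤ L → L * (S - 4 * e) ≤ Real.pi ^ 2 * S := by
    intro e he he4 hL
    obtain ⟨η, hsm, hz, hpos, hge, hder⟩ := exists_smooth_truncation he
    set z : ℝ → ℝ := fun r => η (Real.sin (Real.pi * r)) with hzdef
    have hzsm : ContDiff ℝ (⊤ : ℕ∞) z :=
      hsm.comp (Real.contDiff_sin.comp (contDiff_const.mul contDiff_id))
    set q : ℝ → ℝ := fun r => if 0 < r ∧ r < 1 then z r / r else 0 with hq
    obtain ⟨δ, hδ0, hδ1, hδ⟩ : ∃ δ, 0 < δ ∧ δ < 1 / 2 ∧ Real.pi * δ ≤ e := by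
      refine ⟨e / 4, by positivity, by linarith, ?_⟩
      nlinarith [Real.pi_le_four]
    have hsle : ∀ r, 0 ≤ r → r ≤ δ → Real.sin (Real.pi * r) ≤ e := fun r h0 h1 =>
      (Real.sin_le (by positivity)).trans (le_trans (by gcongr) hδ)
    have h0 : ∀ r ≤ δ, q r = 0 := fun r hr => by
      simp only [hq]
      split_ifs with h
      · rw [hzdef]; simp only; rw [hz _ (hsle r h.1.le hr), zero_div]
      · rfl
    have h1 : ∀ r, 1 - δ ≤ r → q r = 0 := fun r hr => by
      simp only [hq]
      split_ifs with h
      · have : Real.sin (Real.pi * r) ≤ e := by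
          rw [← Real.sin_pi_sub, show Real.pi - Real.pi * r = Real.pi * (1 - r) by ring]
          exact hsle _ (by linarith [h.2]) (by linarith)
        rw [hzdef]; simp only; rw [hz _ this, zero_div]
      · rfl
    have hqz : ∀ r, 0 < r → r < 1 → q =ᶠ[𝓝 r] fun r => z r / r := fun r hr0 hr1 => by
      filter_upwards [Ioo_mem_nhds hr0 hr1] with r' hr'
      simp only [hq]
      rw [if_pos ⟨hr'.1, hr'.2⟩]
    have hqsm : ContDiff ℝ (⊤ : ℕ∞) q := by
      rw [contDiff_iff_contDiffAt]
      intro r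
      rcases lt_or_ge r δ with h | h
      · refine (contDiffAt_const (c := (0 : ℝ))).congr_of_eventuallyEq ?_
        filter_upwards [gt_mem_nhds h] with r' hr' using h0 _ (le_of_lt hr')
      · rcases lt_or_ge (1 - δ) r with h' | h'
        · refine (contDiffAt_const (c := (0 : ℝ))).congr_of_eventuallyEq ?_
          filter_upwards [lt_mem_nhds h'] with r' hr' using h1 _ (le_of_lt hr')
        · have hr0 : 0 < r := by linarith
          exact (hzsm.contDiffAt.div contDiffAt_id hr0.ne').congr_of_eventuallyEq
            (hqz r hr0 (by linarith))
    have hhalf : q (1 / 2) ≠ 0 := by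
      have h2 := hge (Real.sin (Real.pi * (1 / 2)))
      rw [mul_one_div, Real.sin_pi_div_two] at h2
      simp only [hq, hzdef]
      rw [if_pos (by norm_num), mul_one_div, Real.sin_pi_div_two]
      have : 0 < η 1 := by linarith
      positivity
    have hmain := firstEig_mul_le hqsm hδ0 h0 h1 hhalf
    have hq'c : Continuous (deriv q) := hqsm.continuous_deriv (by simp)
    have hqc := hqsm.continuous
    have hN : ∫ r in (0 : ℝ)..1, (q r + r * deriv q r) ^ 2 ≤ Real.pi ^ 2 * S := by
      rw [← hcos]
      refine intervalIntegral.integral_mono_on zero_le_one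
        (Continuous.intervalIntegrable (by fun_prop) _ _)
        (Continuous.intervalIntegrable (by fun_prop) _ _) fun r hr => ?_
      rcases le_or_gt r 0 with hr0 | hr0
      · rw [le_antisymm hr0 hr.1, h0 0 hδ0.le]
        simp only [zero_mul, add_zero, ne_eq, OfNat.ofNat_ne_zero, not_false_eq_true, zero_pow]
        positivity
      rcases hr.2.eq_or_lt with rfl | hr1
      · have hd0 : deriv q 1 = 0 := by
          have : q =ᶠ[𝓝 1] fun _ => 0 := by
            filter_upwards [lt_mem_nhds (show 1 - δ < 1 by linarith)] with r' hr'
              using h1 _ (le_of_lt hr')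
          rw [this.deriv_eq]; simp
        rw [h1 1 (by linarith), hd0]
        simp only [mul_zero, add_zero, ne_eq, OfNat.ofNat_ne_zero, not_false_eq_true, zero_pow]
        positivity
      have a3 : HasDerivAt (fun t => Real.pi * t) Real.pi r := by
        simpa using (hasDerivAt_id r).const_mul Real.pi
      have a4 := ((hsm.differentiable (by simp)) (Real.sin (Real.pi * r))).hasDerivAt.comp r a3.sin
      have a5 : HasDerivAt q _ r :=
        (a4.fun_div (hasDerivAt_id r) hr0.ne').congr_of_eventuallyEq (hqz r hr0 hr1)
      have a6 : q r + r * deriv q r =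
          deriv η (Real.sin (Real.pi * r)) * (Real.pi * Real.cos (Real.pi * r)) := by
        rw [a5.deriv, (hqz r hr0 hr1).eq_of_nhds]
        simp only [hzdef, Function.comp_apply, id]
        field_simp
        ring
      rw [a6, mul_pow]
      have := (sq_le_one_iff_abs_le_one _).2 (hder (Real.sin (Real.pi * r)))
      have h7 := sq_nonneg (Real.pi * Real.cos (Real.pi * r))
      nlinarith
    have hD : S - 4 * e ≤ ∫ r in (0 : ℝ)..1, (r * q r) ^ 2 := by
      have h2 : ∫ r in (0 : ℝ)..1, (Real.sin (Real.pi * r) ^ 2 - 4 * e) = S - 4 * e := by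
        rw [intervalIntegral.integral_sub (Continuous.intervalIntegrable (by fun_prop) _ _)
          (Continuous.intervalIntegrable (by fun_prop) _ _)]
        simp [hS]
      rw [← h2]
      refine intervalIntegral.integral_mono_on zero_le_one
        (Continuous.intervalIntegrable (by fun_prop) _ _)
        (Continuous.intervalIntegrable (by fun_prop) _ _) fun r hr => ?_
      rcases le_or_gt r 0 with hr0 | hr0
      · rw [le_antisymm hr0 hr.1]; simp [he.le]
      rcases hr.2.eq_or_lt with rfl | hr1
      · rw [mul_one, Real.sin_pi]; nlinarith [sq_nonneg (1 * q 1)]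
      have h3 : r * q r = η (Real.sin (Real.pi * r)) := by
        simp only [hq, hzdef]
        rw [if_pos ⟨hr0, hr1⟩]; field_simp
      have h4 := hge (Real.sin (Real.pi * r))
      have h5 := hpos (Real.sin (Real.pi * r))
      have h6 := hsinpos r hr0 hr1
      have h7 := Real.sin_le_one (Real.pi * r)
      rw [h3]
      generalize Real.sin (Real.pi * r) = t at *
      rcases le_total t (2 * e) with h8 | h8
      · nlinarith [sq_nonneg (η t)]
      · have : (t - 2 * e) ^ 2 ≤ η t ^ 2 := by
          have : 0 ≤ t - 2 * e := by linarith
          gcongr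
        nlinarith [sq_nonneg e]
    exact (mul_le_mul_of_nonneg_left hD hL).trans (hmain.trans hN)
  by_contra! hc
  have hL : 0 < L := lt_trans (by positivity) hc
  have hgap : 0 < (L - Real.pi ^ 2) * S := mul_pos (by linarith) hSpos
  set e := min (1 / 8) ((L - Real.pi ^ 2) * S / (8 * L)) with he
  have he0 : 0 < e := lt_min (by norm_num) (by positivity)
  have h1 := key e he0 ((min_le_left _ _).trans_lt (by norm_num)) hL.le
  have h2 : e * (8 * L) ≤ (L - Real.pi ^ 2) * S := by
    rw [← le_div_iff₀ (by positivity)]; exact min_le_right _ _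
  nlinarith

end

section

open scoped Laplacian RealInnerProductSpace

section RadialCalculus

variable {N : ℕ} {x : Euc N} {ρ A A' : ℝ → ℝ} {u : Euc N → ℝ}

theorem hasFDerivAt_norm_of_ne_zero (hx : x ≠ 0) :
    HasFDerivAt (fun x : Euc N => ‖x‖) (innerSL ℝ (‖x‖⁻¹ • x)) x := by
  have hr : 0 < ‖x‖ := norm_pos_iff.2 hx
  have h1 := (hasStrictFDerivAt_norm_sq x).hasFDerivAt.sqrt (by positivity)
  have h2 : (fun y : Euc N => √(‖y‖ ^ 2)) = fun y => ‖y‖ := by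
    ext y; exact Real.sqrt_sq (norm_nonneg y)
  rw [h2, Real.sqrt_sq hr.le] at h1
  refine h1.congr_fderiv ?_
  ext v
  simp
  field_simp

theorem hasFDerivAt_comp_norm {d : ℝ} (hx : x ≠ 0) (h : HasDerivAt ρ d ‖x‖) :
    HasFDerivAt (fun x : Euc N => ρ ‖x‖) (innerSL ℝ ((d / ‖x‖) • x)) x := by
  refine (h.comp_hasFDerivAt x (hasFDerivAt_norm_of_ne_zero hx)).congr_fderiv ?_
  ext v
  simp
  ring

theorem hasFDerivAt_radial_field {d : ℝ} (hx : x ≠ 0) (h : HasDerivAt A d ‖x‖) :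
    HasFDerivAt (fun x : Euc N => A ‖x‖ • x)
      (A ‖x‖ • ContinuousLinearMap.id ℝ (Euc N) + (innerSL ℝ ((d / ‖x‖) • x)).smulRight x) x :=
  (hasFDerivAt_comp_norm hx h).smul (hasFDerivAt_id x)

theorem tendsto_comp_norm_zero (hA : Tendsto A (𝓝[>] 0) (𝓝 (A 0))) :
    Tendsto (fun x : Euc N => A ‖x‖) (𝓝 0) (𝓝 (A 0)) := by
  have h1 : ContinuousWithinAt A (Ici 0) 0 := by
    rw [← continuousWithinAt_Ioi_iff_Ici]; exact hA
  have h2 : Tendsto (fun x : Euc N => ‖x‖) (𝓝 0) (𝓝[≥] 0) := by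
    refine tendsto_nhdsWithin_iff.2 ⟨?_, Eventually.of_forall fun x => norm_nonneg x⟩
    simpa using (continuous_norm (E := Euc N)).tendsto 0
  exact h1.tendsto.comp h2

theorem hasFDerivAt_radial_field_zero (hA : Tendsto A (𝓝[>] 0) (𝓝 (A 0))) :
    HasFDerivAt (fun x : Euc N => A ‖x‖ • x) (A 0 • ContinuousLinearMap.id ℝ (Euc N)) 0 := by
  have h1 := tendsto_comp_norm_zero (N := N) hA
  rw [hasFDerivAt_iff_isLittleO_nhds_zero, Asymptotics.isLittleO_iff]
  intro c hc
  filter_upwards [h1 (Metric.ball_mem_nhds _ hc)] with y hy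
  rw [mem_preimage, Metric.mem_ball, Real.dist_eq] at hy
  simp only [zero_add, smul_zero, sub_zero, _root_.smul_apply,
    ContinuousLinearMap.id_apply]
  rw [← sub_smul, norm_smul, Real.norm_eq_abs]
  gcongr

theorem lap_eq_sum_of_hasFDerivAt {F : Euc N → Euc N} {D : Euc N →L[ℝ] Euc N}
    (hu : ∀ᶠ y in 𝓝 x, HasFDerivAt u (innerSL ℝ (F y)) y) (hF : HasFDerivAt F D x) :
    lap u x = ∑ i, D (EuclideanSpace.single i 1) i := by
  unfold lap
  refine Finset.sum_congr rfl fun i _ => ?_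
  have h1 : (fun y => fderiv ℝ u y (EuclideanSpace.single i 1)) =ᶠ[𝓝 x] fun y => F y i := by
    filter_upwards [hu] with y hy
    rw [hy.fderiv]
    simp [EuclideanSpace.inner_single_right]
  have h2 : HasFDerivAt (fun y => F y i) ((EuclideanSpace.proj i : Euc N →L[ℝ] ℝ).comp D) x :=
    (EuclideanSpace.proj i : Euc N →L[ℝ] ℝ).hasFDerivAt.comp x hF
  rw [h1.fderiv_eq, h2.fderiv]
  rfl

theorem lap_of_radial_field {d : ℝ} (hx : x ≠ 0) (h : HasDerivAt A d ‖x‖)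
    (hu : ∀ᶠ y in 𝓝 x, HasFDerivAt u (innerSL ℝ (A ‖y‖ • y)) y) :
    lap u x = d * ‖x‖ + N * A ‖x‖ := by
  have hr : ‖x‖ ≠ 0 := norm_ne_zero_iff.2 hx
  rw [lap_eq_sum_of_hasFDerivAt hu (hasFDerivAt_radial_field hx h)]
  simp only [_root_.add_apply, _root_.smul_apply,
    ContinuousLinearMap.id_apply, ContinuousLinearMap.smulRight_apply, innerSL_apply_apply,
    PiLp.add_apply, PiLp.smul_apply, EuclideanSpace.inner_single_right, smul_eq_mul]
  simp only [PiLp.single_apply, Finset.sum_add_distrib, if_true]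
  have h1 : ∑ i, x i * x i = ‖x‖ ^ 2 := by
    rw [EuclideanSpace.norm_sq_eq]
    simp [sq]
  have h2 : ∀ i, 1 * (starRingEnd ℝ) (d / ‖x‖ * x i) * x i = d / ‖x‖ * (x i * x i) := fun i => by
    simp; ring
  have h3 : ∑ i, d / ‖x‖ * (x i * x i) = d / ‖x‖ * ‖x‖ ^ 2 := by rw [← Finset.mul_sum, h1]
  simp only [h2]
  rw [h3]
  simp
  field_simp
  ring

theorem lap_of_radial_field_zero (hA : Tendsto A (𝓝[>] 0) (𝓝 (A 0)))
    (hu : ∀ᶠ y in 𝓝 0, HasFDerivAt u (innerSL ℝ (A ‖y‖ • y)) y) : lap u 0 = N * A 0 := by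
  rw [lap_eq_sum_of_hasFDerivAt hu (hasFDerivAt_radial_field_zero hA)]
  simp

theorem contDiffOn_two_of_radial_field (hd : ∀ r, 0 < r → r < 1 → HasDerivAt A (A' r) r)
    (hA'c : ContinuousOn A' (Ioo 0 1)) (hA : Tendsto A (𝓝[>] 0) (𝓝 (A 0)))
    (hA' : Tendsto (fun r => r * A' r) (𝓝[>] 0) (𝓝 0))
    (hu : ∀ y : Euc N, ‖y‖ < 1 → HasFDerivAt u (innerSL ℝ (A ‖y‖ • y)) y) :
    ContDiffOn ℝ 2 u (Metric.ball 0 1) := by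
  set F : Euc N → Euc N := fun x => A ‖x‖ • x with hF
  set D : Euc N → Euc N →L[ℝ] Euc N := fun x =>
    A ‖x‖ • ContinuousLinearMap.id ℝ (Euc N) + (innerSL ℝ ((A' ‖x‖ / ‖x‖) • x)).smulRight x with hD
  have hFD : ∀ x : Euc N, ‖x‖ < 1 → HasFDerivAt F (D x) x := fun x hx1 => by
    rcases eq_or_ne x 0 with rfl | hx
    · refine (hasFDerivAt_radial_field_zero hA).congr_fderiv ?_
      ext v i
      simp [hD]
    · exact hasFDerivAt_radial_field hx (hd _ (norm_pos_iff.2 hx) hx1)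
  have hAc : ∀ x : Euc N, ‖x‖ < 1 → ContinuousAt (fun x : Euc N => A ‖x‖) x := fun x hx1 => by
    rcases eq_or_ne x 0 with rfl | hx
    · have := tendsto_comp_norm_zero (N := N) hA
      rwa [ContinuousAt, norm_zero]
    · exact ContinuousAt.comp (g := A) (hd _ (norm_pos_iff.2 hx) hx1).continuousAt
        continuous_norm.continuousAt
  have hDc : ∀ x : Euc N, ‖x‖ < 1 → ContinuousAt D x := fun x hx1 => by
    refine ((hAc x hx1).smul continuousAt_const).add ?_
    rcases eq_or_ne x 0 with rfl | hx
    · have h0 : (innerSL ℝ ((A' ‖(0 : Euc N)‖ / ‖(0 : Euc N)‖) • (0 : Euc N))).smulRight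
          (0 : Euc N) = 0 := by ext; simp
      rw [ContinuousAt, h0]
      have h1 : Tendsto (fun x : Euc N => (fun r => if r = 0 then 0 else r * A' r) ‖x‖) (𝓝 0)
          (𝓝 0) := by
        have := tendsto_comp_norm_zero (N := N) (A := fun r => if r = 0 then 0 else r * A' r) (by
          simp only [if_true]
          refine hA'.congr' ?_
          filter_upwards [self_mem_nhdsWithin] with r hr
          rw [if_neg (ne_of_gt hr)])
        simpa using this
      refine squeeze_zero_norm (fun x => ?_) (by simpa using h1.norm)
      rcases eq_or_ne x 0 with rfl | hx
      · simp
      · have hr := norm_pos_iff.2 hx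
        rw [ContinuousLinearMap.norm_smulRight_apply, innerSL_apply_norm, norm_smul, if_neg hx,
          Real.norm_eq_abs, abs_div, abs_mul, abs_norm]
        apply le_of_eq
        field_simp
    · have hr := norm_pos_iff.2 hx
      have h1 : ContinuousAt (fun x : Euc N => A' ‖x‖) x :=
        ContinuousAt.comp (g := A') (hA'c.continuousAt (Ioo_mem_nhds hr hx1))
          continuous_norm.continuousAt
      have h2 : ContinuousAt (fun x : Euc N => (A' ‖x‖ / ‖x‖) • x) x :=
        (h1.div continuous_norm.continuousAt hr.ne').smul continuousAt_id
      have h3 : ContinuousAt (fun x : Euc N => innerSL ℝ ((A' ‖x‖ / ‖x‖) • x)) x :=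
        ContinuousAt.comp (g := innerSL ℝ) (innerSL ℝ).continuous.continuousAt h2
      exact ((ContinuousLinearMap.smulRightL ℝ (Euc N) (Euc N)).continuous.continuousAt.comp
        h3).clm_apply continuousAt_id
  have hmem : ∀ x : Euc N, x ∈ Metric.ball 0 1 ↔ ‖x‖ < 1 := fun x => mem_ball_zero_iff
  have hF1 : ContDiffOn ℝ 1 F (Metric.ball 0 1) := by
    rw [show (1 : WithTop ℕ∞) = 0 + 1 by norm_num,
      contDiffOn_succ_iff_fderiv_of_isOpen Metric.isOpen_ball]
    refine ⟨fun x hx => (hFD x ((hmem x).1 hx)).differentiableAt.differentiableWithinAt,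
      by simp, ?_⟩
    rw [contDiffOn_zero]
    refine ContinuousOn.congr (f := D) (fun x hx => (hDc x ((hmem x).1 hx)).continuousWithinAt)
      fun x hx => (hFD x ((hmem x).1 hx)).fderiv
  rw [show (2 : WithTop ℕ∞) = 1 + 1 by norm_num,
    contDiffOn_succ_iff_fderiv_of_isOpen Metric.isOpen_ball]
  refine ⟨fun x hx => (hu x ((hmem x).1 hx)).differentiableAt.differentiableWithinAt, by simp, ?_⟩
  exact (((innerSL ℝ).contDiff).comp_contDiffOn hF1).congr
    fun x hx => (hu x ((hmem x).1 hx)).fderiv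

end RadialCalculus

end

section

open scoped Laplacian RealInnerProductSpace

variable {mu k s p r : ℝ} {w y : ℝ → ℝ}

/-- The radial function `w r / r`, extended by `y 0` at the origin. -/
def profileFun (w y : ℝ → ℝ) (r : ℝ) : ℝ := if r ≤ 0 then y 0 else w r / r

/-- The right-hand side of the radial equation. -/
def profileRhs (mu k s p : ℝ) (w y : ℝ → ℝ) (r : ℝ) : ℝ :=
  mu * profileFun w y r + weight k s r * profileFun w y r ^ (p - 1)

/-- The factor `A` for which the gradient of the radial solution is `A ‖x‖ • x`. -/
def profileSlope (mu k s p : ℝ) (w y : ℝ → ℝ) (r : ℝ) : ℝ :=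
  if r ≤ 0 then -profileRhs mu k s p w y 0 / 3 else (r * y r - w r) / r ^ 3

theorem profileFun_of_pos (hr : 0 < r) : profileFun w y r = w r / r := if_neg hr.not_ge

theorem profileFun_zero : profileFun w y 0 = y 0 := if_pos le_rfl

theorem profileSlope_of_pos (hr : 0 < r) :
    profileSlope mu k s p w y r = (r * y r - w r) / r ^ 3 := if_neg hr.not_ge

theorem eventuallyEq_profileFun (hr : 0 < r) : profileFun w y =ᶠ[𝓝 r] fun r => w r / r := by
  filter_upwards [lt_mem_nhds hr] with t ht using profileFun_of_pos ht

namespace IsProfile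

theorem profileFun_pos (h : IsProfile mu k s p w y) (hr : 0 ≤ r) (hr1 : r < 1) :
    0 < profileFun w y r := by
  rcases hr.eq_or_lt with rfl | hr0
  · rw [profileFun_zero]; exact h.y_zero
  · rw [profileFun_of_pos hr0]; exact h.div_pos hr0 hr1

theorem tendsto_profileFun (h : IsProfile mu k s p w y) :
    Tendsto (profileFun w y) (𝓝[>] 0) (𝓝 (profileFun w y 0)) := by
  rw [profileFun_zero]
  refine h.tendsto_div.congr' ?_
  filter_upwards [self_mem_nhdsWithin] with r hr using (profileFun_of_pos hr).symm

theorem tendsto_profileRhs (h : IsProfile mu k s p w y) (hk : 0 ≤ k) :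
    Tendsto (profileRhs mu k s p w y) (𝓝[>] 0) (𝓝 (profileRhs mu k s p w y 0)) := by
  have h1 := h.tendsto_profileFun
  have h2 : Tendsto (weight k s) (𝓝[>] 0) (𝓝 (weight k s 0)) :=
    (continuousAt_weight hk le_rfl).tendsto.mono_left nhdsWithin_le_nhds
  refine (h1.const_mul mu).add (h2.mul (h1.rpow_const (Or.inl ?_)))
  rw [profileFun_zero]; exact h.y_zero.ne'

theorem profileRhs_pos (h : IsProfile mu k s p w y) (hmu : 0 < mu) (hr : 0 ≤ r) (hr1 : r < 1) :
    0 < profileRhs mu k s p w y r := by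
  have h1 := h.profileFun_pos hr hr1
  have h2 := weight_pos (k := k) (s := s) hr
  unfold profileRhs
  positivity

theorem hasDerivAt_gap (h : IsProfile mu k s p w y) (hr : 0 < r) (hr1 : r ≤ 1) :
    HasDerivAt (fun r => r * y r - w r) (-(r ^ 2 * profileRhs mu k s p w y r)) r := by
  refine (((hasDerivAt_id r).fun_mul (h.hy r hr.le hr1)).fun_sub (h.hw r hr.le hr1)).congr_deriv ?_
  rw [profileRhs, profileFun_of_pos hr]
  simp only [id]
  ring

theorem tendsto_profileSlope (h : IsProfile mu k s p w y) (hk : 0 ≤ k) :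
    Tendsto (profileSlope mu k s p w y) (𝓝[>] 0) (𝓝 (profileSlope mu k s p w y 0)) := by
  have h0 : profileSlope mu k s p w y 0 = -profileRhs mu k s p w y 0 / 3 := if_pos le_rfl
  have hc : ContinuousAt (fun r => r * y r - w r) 0 :=
    (continuousAt_id.mul (h.hy 0 le_rfl zero_le_one).continuousAt).sub
      (h.hw 0 le_rfl zero_le_one).continuousAt
  have key := HasDerivAt.lhopital_zero_right_on_Ioo (a := 0) (b := 1) (g := fun r => r ^ 3)
    (g' := fun r => 3 * r ^ 2) one_pos (fun r hr => h.hasDerivAt_gap hr.1 hr.2.le)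
    (fun r _ => by simpa using hasDerivAt_pow 3 r) (fun r hr => by have := hr.1; positivity)
    (by
      have := hc.tendsto.mono_left (nhdsWithin_le_nhds (s := Ioi 0))
      simpa [h.w_zero] using this)
    (by
      have : Tendsto (fun r : ℝ => r ^ 3) (𝓝[>] 0) (𝓝 (0 ^ 3)) :=
        ((continuous_pow 3).tendsto (0 : ℝ)).mono_left nhdsWithin_le_nhds
      simpa using this)
    (l := 𝓝 (profileSlope mu k s p w y 0)) (by
      rw [h0]
      refine (((h.tendsto_profileRhs hk).neg).div_const 3).congr' ?_
      filter_upwards [self_mem_nhdsWithin] with r hr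
      have : r ≠ 0 := ne_of_gt hr
      field_simp)
  refine key.congr' ?_
  filter_upwards [self_mem_nhdsWithin] with r hr using (profileSlope_of_pos hr).symm

theorem hasDerivAt_profileFun (h : IsProfile mu k s p w y) (hr : 0 < r) (hr1 : r ≤ 1) :
    HasDerivAt (profileFun w y) (profileSlope mu k s p w y r * r) r := by
  refine (((h.hw r hr.le hr1).fun_div (hasDerivAt_id r) hr.ne').congr_of_eventuallyEq
    (eventuallyEq_profileFun hr)).congr_deriv ?_
  rw [profileSlope_of_pos hr]
  simp only [id]
  field_simp

theorem gap_neg (h : IsProfile mu k s p w y) (hmu : 0 < mu) (hr : 0 < r) (hr1 : r ≤ 1) :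
    r * y r - w r < 0 := by
  have hc : ContinuousOn (fun r => r * y r - w r) (Icc 0 r) := fun t ht =>
    ((continuousAt_id.mul (h.hy t ht.1 (ht.2.trans hr1)).continuousAt).sub
      (h.hw t ht.1 (ht.2.trans hr1)).continuousAt).continuousWithinAt
  have := lt_of_hasDerivAt_neg hr hc
    (fun t ht => h.hasDerivAt_gap ht.1 (ht.2.le.trans hr1)) (fun t ht => by
      have := h.profileRhs_pos hmu ht.1.le (ht.2.trans_le hr1)
      have := ht.1
      rw [neg_lt_zero]; positivity)
  simpa [h.w_zero] using this

theorem continuousOn_profileFun (h : IsProfile mu k s p w y) :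
    ContinuousOn (profileFun w y) (Icc 0 1) := fun r hr => by
  rcases hr.1.eq_or_lt with rfl | hr0
  · exact (continuousWithinAt_Ioi_iff_Ici.1 h.tendsto_profileFun).mono Icc_subset_Ici_self
  · exact (h.hasDerivAt_profileFun hr0 hr.2).continuousAt.continuousWithinAt

theorem strictAntiOn_profileFun (h : IsProfile mu k s p w y) (hmu : 0 < mu) :
    StrictAntiOn (profileFun w y) (Icc 0 1) := fun a ha b hb hab => by
  refine lt_of_hasDerivAt_neg hab (h.continuousOn_profileFun.mono (Icc_subset_Icc ha.1 hb.2))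
    (fun r hr => h.hasDerivAt_profileFun (ha.1.trans_lt hr.1) (hr.2.le.trans hb.2)) fun r hr => ?_
  have hr0 : 0 < r := ha.1.trans_lt hr.1
  rw [profileSlope_of_pos hr0]
  exact mul_neg_of_neg_of_pos (div_neg_of_neg_of_pos (h.gap_neg hmu hr0 (hr.2.le.trans hb.2))
    (by positivity)) hr0

theorem hasDerivAt_profileSlope (h : IsProfile mu k s p w y) (hr : 0 < r) (hr1 : r < 1) :
    HasDerivAt (profileSlope mu k s p w y)
      (-(profileRhs mu k s p w y r + 3 * profileSlope mu k s p w y r) / r) r := by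
  have h1 : profileSlope mu k s p w y =ᶠ[𝓝 r] fun r => (r * y r - w r) / r ^ 3 := by
    filter_upwards [lt_mem_nhds hr] with t ht using profileSlope_of_pos ht
  refine (((h.hasDerivAt_gap hr hr1.le).fun_div ((hasDerivAt_id r).fun_pow 3)
    (by simp [hr.ne'])).congr_of_eventuallyEq h1).congr_deriv ?_
  rw [profileSlope_of_pos hr]
  simp only [id]
  field_simp
  push_cast
  ring

theorem continuousAt_profileRhs (h : IsProfile mu k s p w y) (hk : 0 ≤ k) (hr : 0 < r)
    (hr1 : r < 1) : ContinuousAt (profileRhs mu k s p w y) r := by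
  have h1 := (h.hasDerivAt_profileFun hr hr1.le).continuousAt
  exact (continuousAt_const.mul h1).add ((continuousAt_weight hk hr.le).mul
    (h1.rpow_const (Or.inl (h.profileFun_pos hr.le hr1).ne')))

theorem isLittleO_profileFun (h : IsProfile mu k s p w y) :
    Tendsto (fun r => (profileFun w y r - profileFun w y 0) / r) (𝓝[>] 0) (𝓝 0) := by
  have hc : ContinuousAt (fun r => w r - y 0 * r) 0 :=
    (h.hw 0 le_rfl zero_le_one).continuousAt.sub (continuousAt_const.mul continuousAt_id)
  have hy0 := h.hy 0 le_rfl zero_le_one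
  rw [zero_mul, neg_zero, hasDerivAt_iff_tendsto_slope] at hy0
  have hy1 := hy0.mono_left (nhdsWithin_mono 0 (fun t (ht : 0 < t) => ht.ne'))
  have key := HasDerivAt.lhopital_zero_right_on_Ioo (a := 0) (b := 1) (g := fun r => r ^ 2)
    (g' := fun r => 2 * r) (f := fun r => w r - y 0 * r) (f' := fun r => y r - y 0) one_pos
    (fun r hr => ((h.hw r hr.1.le hr.2.le).fun_sub ((hasDerivAt_id r).const_mul (y 0))).congr_deriv
      (by ring))
    (fun r _ => by simpa using hasDerivAt_pow 2 r) (fun r hr => by have := hr.1; positivity)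
    (by
      have := hc.tendsto.mono_left (nhdsWithin_le_nhds (s := Ioi 0))
      simpa [h.w_zero] using this)
    (by
      have : Tendsto (fun r : ℝ => r ^ 2) (𝓝[>] 0) (𝓝 (0 ^ 2)) :=
        ((continuous_pow 2).tendsto (0 : ℝ)).mono_left nhdsWithin_le_nhds
      simpa using this)
    (l := 𝓝 0) (by
      have := hy1.div_const 2
      rw [zero_div] at this
      refine this.congr' ?_
      filter_upwards [self_mem_nhdsWithin] with r hr
      have : r ≠ 0 := ne_of_gt hr
      rw [slope_def_field, sub_zero]
      field_simp)
  refine key.congr' ?_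
  filter_upwards [self_mem_nhdsWithin] with r hr
  have : r ≠ 0 := ne_of_gt hr
  rw [profileFun_of_pos hr, profileFun_zero]
  field_simp

theorem hasFDerivAt_profileFun {N : ℕ} (h : IsProfile mu k s p w y) {x : Euc N} (hx : ‖x‖ < 1) :
    HasFDerivAt (fun x : Euc N => profileFun w y ‖x‖)
      (innerSL ℝ (profileSlope mu k s p w y ‖x‖ • x)) x := by
  rcases eq_or_ne x 0 with rfl | hx0
  · have h1 := tendsto_comp_norm_zero (N := N)
      (A := fun r => (profileFun w y r - profileFun w y 0) / r)
      (by simpa using h.isLittleO_profileFun)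
    simp only [div_zero] at h1
    rw [smul_zero, map_zero, hasFDerivAt_iff_isLittleO_nhds_zero, Asymptotics.isLittleO_iff]
    intro c hc
    filter_upwards [h1 (Metric.ball_mem_nhds _ hc)] with v hv
    rw [mem_preimage, mem_ball_zero_iff] at hv
    simp only [zero_add, norm_zero, _root_.zero_apply, sub_zero]
    rcases eq_or_ne v 0 with rfl | hv0
    · simp
    · have hr := norm_pos_iff.2 hv0
      rw [norm_div, norm_norm, div_lt_iff₀ hr] at hv
      exact hv.le
  · have hr := norm_pos_iff.2 hx0
    have := hasFDerivAt_comp_norm hx0 (h.hasDerivAt_profileFun hr hx.le)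
    rwa [mul_div_cancel_right₀ _ hr.ne'] at this

theorem isPosSolution (h : IsProfile mu k s p w y) (hk : 0 ≤ k) :
    IsPosSolution (Metric.ball (0 : Euc 3) 1) (fker 3 k s p) (-mu)
      (fun x => profileFun w y ‖x‖) := by
  have hmem : ∀ x : Euc 3, x ∈ Metric.ball 0 1 ↔ ‖x‖ < 1 := fun x => mem_ball_zero_iff
  have hev : ∀ x : Euc 3, ‖x‖ < 1 → ∀ᶠ z in 𝓝 x, HasFDerivAt (fun x => profileFun w y ‖x‖)
      (innerSL ℝ (profileSlope mu k s p w y ‖z‖ • z)) z := fun x hx => by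
    filter_upwards [Metric.isOpen_ball.mem_nhds ((hmem x).2 hx)] with z hz
      using h.hasFDerivAt_profileFun ((hmem z).1 hz)
  refine ⟨?_, ?_, fun x hx => h.profileFun_pos (norm_nonneg x) ((hmem x).1 hx), fun x hx => ?_,
    fun x hx => ?_⟩
  · refine contDiffOn_two_of_radial_field (fun r hr hr1 => h.hasDerivAt_profileSlope hr hr1)
      (fun r hr => ?_) (h.tendsto_profileSlope hk) ?_ fun z hz => h.hasFDerivAt_profileFun hz
    · exact ((((h.continuousAt_profileRhs hk hr.1 hr.2).add (continuousAt_const.mul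
        (h.hasDerivAt_profileSlope hr.1 hr.2).continuousAt)).neg).div continuousAt_id
          hr.1.ne').continuousWithinAt
    · have h1 := ((h.tendsto_profileRhs hk).add ((h.tendsto_profileSlope hk).const_mul 3)).neg
      have h0 : profileSlope mu k s p w y 0 = -profileRhs mu k s p w y 0 / 3 := if_pos le_rfl
      rw [h0, show -(profileRhs mu k s p w y 0 + 3 * (-profileRhs mu k s p w y 0 / 3)) = 0 by
        ring] at h1
      refine h1.congr' ?_
      filter_upwards [self_mem_nhdsWithin] with r hr
      have : r ≠ 0 := ne_of_gt hr
      field_simp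
  · rw [closure_ball _ one_ne_zero]
    exact h.continuousOn_profileFun.comp continuous_norm.continuousOn
      fun x hx => ⟨norm_nonneg x, mem_closedBall_zero_iff.1 hx⟩
  · rw [frontier_ball _ one_ne_zero, mem_sphere_zero_iff_norm] at hx
    simp only [hx]
    rw [profileFun_of_pos one_pos, h.w_one, zero_div]
  · have hx1 := (hmem x).1 hx
    have hlap : lap (fun x : Euc 3 => profileFun w y ‖x‖) x = -profileRhs mu k s p w y ‖x‖ := by
      rcases eq_or_ne x 0 with rfl | hx0
      · rw [lap_of_radial_field_zero (h.tendsto_profileSlope hk) (hev 0 (by simp)), norm_zero]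
        have h0 : profileSlope mu k s p w y 0 = -profileRhs mu k s p w y 0 / 3 := if_pos le_rfl
        rw [h0]; push_cast; ring
      · have hr := norm_pos_iff.2 hx0
        rw [lap_of_radial_field hx0 (h.hasDerivAt_profileSlope hr hx1) (hev x hx1)]
        push_cast
        field_simp
        ring
    rw [hlap, fker, profileRhs, weight]
    ring

end IsProfile

end

section

open scoped Laplacian RealInnerProductSpace

variable {mu k s p Λ r : ℝ} {w y w₁ y₁ w₂ y₂ ρ : ℝ → ℝ} {v : Euc 3 → ℝ}

theorem IsProfile.isShot (h : IsProfile mu k s p w y) (hmu : 0 ≤ mu) (hΛ : y 0 ≤ Λ) :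
    IsShot mu k s p Λ (y 0) w y := by
  have hw0 : ∀ r, 0 ≤ r → r ≤ 1 → 0 ≤ w r := fun r hr hr1 => by
    rcases hr.eq_or_lt with rfl | hr0
    · rw [h.w_zero]
    rcases hr1.eq_or_lt with rfl | hr1
    · rw [h.w_one]
    exact (h.pos r hr0 hr1).le
  have hy0 : ∀ r, 0 ≤ r → r ≤ 1 → y r ≤ y 0 := fun r hr hr1 => by
    have := le_of_hasDerivAt_nonneg (f := fun t => -y t) hr
      (fun t ht => (h.hy t ht.1 (ht.2.trans hr1)).fun_neg)
      (fun t ht => by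
        have h1 := hw0 t ht.1.le (ht.2.le.trans hr1)
        have h2 := weight_pos (k := k) (s := s) ht.1.le
        have h3 := ht.1.le
        rw [neg_neg]; positivity)
    linarith
  have hle : ∀ r, 0 ≤ r → r ≤ 1 → w r ≤ y 0 * r := fun r hr hr1 => by
    have := le_of_hasDerivAt_nonneg (f := fun t => y 0 * t - w t) hr
      (fun t ht => (((hasDerivAt_id t).const_mul (y 0)).fun_sub
        (h.hw t ht.1 (ht.2.trans hr1))))
      (fun t ht => by
        have := hy0 t ht.1.le (ht.2.le.trans hr1)
        linarith)
    rw [h.w_zero] at this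
    linarith
  refine ⟨h.w_zero, rfl, h.y_zero, hΛ, h.hw, fun r hr hr1 => (h.hy r hr hr1).congr_deriv ?_⟩
  have h1 : w r / r ≤ Λ := by
    rcases hr.eq_or_lt with rfl | hr0
    · simpa using h.y_zero.le.trans hΛ
    · rw [div_le_iff₀ hr0]
      exact (hle r hr hr1).trans (mul_le_mul_of_nonneg_right hΛ hr)
  have h2 := hw0 r hr hr1
  rw [clampG, clamp_eq (by positivity) h1, abs_of_nonneg hr]

theorem IsShot.eqOn (h₁ : IsShot mu k s p Λ (y₂ 0) w₁ y₁) (hA : Admissible mu k s p)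
    (hΛ : 0 ≤ Λ) {b : ℝ} (hb : b ≤ 1) (h0 : w₂ 0 = 0)
    (h₂ : ∀ r, 0 ≤ r → r ≤ b →
      HasDerivAt w₂ (y₂ r) r ∧ HasDerivAt y₂ (-clampG mu k s p Λ r (w₂ r)) r)
    (hr : 0 ≤ r) (hrb : r ≤ b) : w₁ r = w₂ r := by
  have hp := hA.two_lt_p
  have hmu := hA.mu_pos
  have hK : 0 ≤ mu + (p - 1) * Λ ^ (p - 2) := by
    have : 0 ≤ p - 1 := by linarith
    positivity
  have := (second_order_dist_le hK
    (clampG_lip hA.mu_pos.le (by linarith [hA.one_lt_s]) hp.le hΛ) (h₁.w_zero.trans h0.symm)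
    (fun r hr hrb => ⟨h₁.hw r hr (hrb.trans hb), h₁.hy r hr (hrb.trans hb)⟩) h₂ r hr hrb).1
  rw [h₁.y_zero, sub_self, abs_zero, zero_mul] at this
  exact sub_eq_zero.1 (abs_nonpos_iff.1 this)

theorem IsProfile.unique (h₁ : IsProfile mu k s p w₁ y₁) (h₂ : IsProfile mu k s p w₂ y₂)
    (hA : Admissible mu k s p) (hr : 0 ≤ r) (hr1 : r ≤ 1) :
    profileFun w₁ y₁ r = profileFun w₂ y₂ r := by
  have h0 := h₁.y_zero_unique h₂ hA
  have hs := h₁.isShot hA.mu_pos.le le_rfl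
  have hs2 := h₂.isShot hA.mu_pos.le h0.ge
  rcases hr.eq_or_lt with rfl | hr0
  · rw [profileFun_zero, profileFun_zero, h0]
  · rw [profileFun_of_pos hr0, profileFun_of_pos hr0]
    have hs1 : IsShot mu k s p (y₁ 0) (y₂ 0) w₁ y₁ := ⟨hs.w_zero, h0, hs2.pos, hs2.le, hs.hw, hs.hy⟩
    rw [hs1.eqOn hA h₁.y_zero.le le_rfl h₂.w_zero
      (fun r hr hr1 => ⟨hs2.hw r hr hr1, hs2.hy r hr hr1⟩) hr hr1]

theorem IsPosSolution.isBallSolution (hA : Admissible mu k s p)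
    (h : IsPosSolution (Metric.ball (0 : Euc 3) 1) (fker 3 k s p) (-mu) v) :
    IsBallSolution (fun r t => mu * t + weight k s r * t ^ (p - 1)) v := by
  have hmu := hA.mu_pos
  have hk := hA.k_nonneg
  have hs := hA.one_lt_s
  have hp := hA.two_lt_p
  obtain ⟨hsm, hc, hpos, hz, heq⟩ := h
  rw [closure_ball _ one_ne_zero] at hc
  rw [frontier_ball _ one_ne_zero] at hz
  have hsm' : ∀ x : Euc 3, ‖x‖ < 1 → ContDiffAt ℝ 2 v x := fun x hx =>
    hsm.contDiffAt (Metric.isOpen_ball.mem_nhds (mem_ball_zero_iff.2 hx))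
  refine ⟨fun r₁ r₂ t hr hrr ht => ?_, fun r a b hr ha hab => ?_, fun M => ?_, hsm', hc,
    fun x hx => hpos x (mem_ball_zero_iff.2 hx), fun x hx => hz x (mem_sphere_zero_iff_norm.2 hx),
    fun x hx => ?_⟩
  · have h1 : weight k s r₂ ≤ weight k s r₁ := by
      have : r₁ ^ k ≤ r₂ ^ k := Real.rpow_le_rpow hr hrr hk
      have : 0 ≤ r₁ ^ k := by positivity
      exact Real.rpow_le_rpow_of_nonpos (by linarith) (by linarith) (by linarith)
    have h2 : 0 ≤ t ^ (p - 1) := by positivity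
    have := mul_le_mul_of_nonneg_right h1 h2
    linarith
  · have h1 := (weight_pos (k := k) (s := s) hr).le
    have h2 : a ^ (p - 1) ≤ b ^ (p - 1) := Real.rpow_le_rpow ha hab (by linarith)
    have := mul_le_mul_of_nonneg_left h2 h1
    have := mul_le_mul_of_nonneg_left hab hmu.le
    linarith
  · have hp1 : 0 ≤ p - 1 := by linarith
    refine ⟨mu + (p - 1) * |M| ^ (p - 1 - 1), by positivity, fun r a b hr ha hab hbM => ?_⟩
    have h1 := rpow_sub_rpow_le (q := p - 1) (by linarith) ha hab (hbM.trans (le_abs_self M))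
    have h2 : a ^ (p - 1) ≤ b ^ (p - 1) := Real.rpow_le_rpow ha hab hp1
    have h3 := weight_le_one (k := k) (s := s) (by linarith) hr
    have h4 : weight k s r * (b ^ (p - 1) - a ^ (p - 1)) ≤ b ^ (p - 1) - a ^ (p - 1) :=
      mul_le_of_le_one_left (by linarith) h3
    linarith
  · have := heq x (mem_ball_zero_iff.2 hx)
    rw [lap_eq_laplacian (hsm' x hx), fker] at this
    simp only [weight]
    linarith

theorem deriv_zero_of_even {f : ℝ → ℝ} (hf : ∀ r, f (-r) = f r) : deriv f 0 = 0 := by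
  have h1 : deriv (fun r => f (-r)) 0 = -deriv f (-0) := deriv_comp_neg f 0
  rw [funext hf, neg_zero] at h1
  linarith

/-- A positive solution on the unit ball is the radial solution attached to some profile. -/
theorem IsPosSolution.exists_profile (hA : Admissible mu k s p)
    (h : IsPosSolution (Metric.ball (0 : Euc 3) 1) (fker 3 k s p) (-mu) v) :
    ∃ w y, IsProfile mu k s p w y ∧ ∀ x : Euc 3, ‖x‖ ≤ 1 → v x = profileFun w y ‖x‖ := by
  have hB := h.isBallSolution hA
  obtain ⟨e, he⟩ := exists_norm_eq (Euc 3) zero_le_one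
  have hne : ∀ r : ℝ, ‖r • e‖ = |r| := fun r => by rw [norm_smul, he, mul_one, Real.norm_eq_abs]
  set ρ : ℝ → ℝ := fun r => v (|r| • e) with hρ
  have hρv : ∀ x : Euc 3, ‖x‖ ≤ 1 → ρ ‖x‖ = v x := fun x hx =>
    hB.radial (by rw [hne, abs_abs, abs_norm]; exact hx) (by rw [hne, abs_abs, abs_norm])
  have hρe : ∀ r, |r| ≤ 1 → ρ r = v (r • e) := fun r hr => by
    rw [← hρv _ ((hne r).trans_le hr), hne, hρ]
    simp only [abs_abs]
  have hsm : ContDiffOn ℝ 2 ρ (Ioo (-1) 1) := by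
    have : ContDiffOn ℝ 2 (fun r : ℝ => v (r • e)) (Ioo (-1) 1) := fun r hr => by
      refine (ContDiffAt.comp r (hB.smooth _ ?_) (by fun_prop)).contDiffWithinAt
      rw [hne, abs_lt]; exact hr
    exact this.congr fun r hr => hρe r (abs_le.2 ⟨hr.1.le, hr.2.le⟩)
  have hd1 : ∀ r, 0 ≤ r → r < 1 → HasDerivAt ρ (deriv ρ r) r := fun r hr hr1 =>
    ((hsm.contDiffAt (Ioo_mem_nhds (by linarith) hr1)).differentiableAt (by norm_num)).hasDerivAt
  have hsm1 : ContDiffOn ℝ 1 (deriv ρ) (Ioo (-1) 1) := by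
    have h2 : ContDiffOn ℝ (1 + 1) ρ (Ioo (-1) 1) := by rwa [one_add_one_eq_two]
    exact ((contDiffOn_succ_iff_deriv_of_isOpen isOpen_Ioo).1 h2).2.2
  have hd2 : ∀ r, 0 ≤ r → r < 1 → HasDerivAt (deriv ρ) (deriv (deriv ρ) r) r := fun r hr hr1 =>
    ((hsm1.contDiffAt (Ioo_mem_nhds (by linarith) hr1)).differentiableAt (by norm_num)).hasDerivAt
  have hρ0 : deriv ρ 0 = 0 := deriv_zero_of_even fun r => by simp only [hρ, abs_neg]
  have hρnn : ∀ r, |r| ≤ 1 → 0 ≤ ρ r := fun r hr =>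
    hB.nonneg (by rw [hne, abs_abs]; exact hr)
  obtain ⟨Λ, hΛ⟩ : ∃ Λ, ∀ x : Euc 3, ‖x‖ ≤ 1 → v x ≤ Λ := by
    obtain ⟨Λ, hΛ⟩ := (isCompact_closedBall (0 : Euc 3) 1).bddAbove_image hB.cont
    exact ⟨Λ, fun x hx => hΛ ⟨x, mem_closedBall_zero_iff.2 hx, rfl⟩⟩
  have hρΛ : ∀ r, |r| ≤ 1 → ρ r ≤ Λ := fun r hr => hΛ _ (by rw [hne, abs_abs]; exact hr)
  have hode : ∀ r, 0 < r → r < 1 → deriv (deriv ρ) r * r + 2 * deriv ρ r =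
      -(r * (mu * ρ r + weight k s r * ρ r ^ (p - 1))) := fun r hr hr1 => by
    have hnr : ‖r • e‖ = r := (hne r).trans (abs_of_pos hr)
    have hx0 : r • e ≠ 0 := by rw [← norm_pos_iff, hnr]; exact hr
    have hA' : HasDerivAt (fun t => deriv ρ t / t)
        ((deriv (deriv ρ) r * r - deriv ρ r * 1) / r ^ 2) ‖r • e‖ := by
      rw [hnr]
      exact (hd2 r hr.le hr1).fun_div (hasDerivAt_id r) hr.ne'
    have hlap := lap_of_radial_field (u := v) hx0 hA' (by
      have h1 : ∀ᶠ z : Euc 3 in 𝓝 (r • e), ‖z‖ < 1 :=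
        continuous_norm.continuousAt.eventually_lt_const (hnr.trans_lt hr1)
      filter_upwards [h1, isOpen_ne.mem_nhds hx0] with z hz hz0
      refine (hasFDerivAt_comp_norm hz0 (hd1 _ (norm_nonneg z) hz)).congr_of_eventuallyEq ?_
      filter_upwards [continuous_norm.continuousAt.eventually_lt_const hz] with z' hz'
        using (hρv z' hz'.le).symm)
    have heq := h.2.2.2.2 (r • e) (mem_ball_zero_iff.2 (by rw [hnr]; exact hr1))
    rw [hlap, fker, hnr, ← hρe r (by rw [abs_of_pos hr]; exact hr1.le)] at heq
    rw [weight]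
    push_cast at heq
    field_simp at heq
    linarith
  have hα : 0 < ρ 0 := hB.pos _ (by simp)
  have hΛ0 : ρ 0 ≤ Λ := hρΛ 0 (by simp)
  obtain ⟨w, y, hS⟩ := exists_shot hA hα hΛ0
  have hyρ : ρ 0 = (fun r => ρ r + r * deriv ρ r) 0 := by simp
  have hcl : ∀ r, 0 ≤ r → r < 1 → deriv ρ r + (deriv ρ r + r * deriv (deriv ρ) r) =
      -clampG mu k s p Λ r (r * ρ r) := fun r hr hr1 => by
    rcases hr.eq_or_lt with rfl | hr0
    · simp [clampG, hρ0]
    · have hab : |r| ≤ 1 := by rw [abs_of_pos hr0]; exact hr1.le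
      rw [clampG, mul_div_cancel_left₀ _ hr0.ne', clamp_eq (hρnn r hab) (hρΛ r hab),
        abs_of_pos hr0, ← hode r hr0 hr1]
      ring
  have heq : ∀ r, 0 ≤ r → r < 1 → w r = r * ρ r := fun r hr hr1 => by
    rw [hyρ] at hS
    refine hS.eqOn (w₂ := fun r => r * ρ r) (y₂ := fun r => ρ r + r * deriv ρ r)
      hA (hα.le.trans hΛ0) hr1.le (zero_mul _)
      (fun t ht htr => ⟨?_, ?_⟩) hr le_rfl
    · exact ((hasDerivAt_id t).fun_mul (hd1 t ht (htr.trans_lt hr1))).congr_deriv (by simp)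
    · refine ((hd1 t ht (htr.trans_lt hr1)).fun_add ((hasDerivAt_id t).fun_mul
        (hd2 t ht (htr.trans_lt hr1)))).congr_deriv ?_
      rw [← hcl t ht (htr.trans_lt hr1)]
      simp
  have hρ1 : ρ 1 = 0 := hB.zero _ (by simp [he])
  have hw1 : w 1 = 0 := by
    have h1 : Tendsto w (𝓝[<] 1) (𝓝 (w 1)) :=
      (hS.hw 1 zero_le_one le_rfl).continuousAt.tendsto.mono_left nhdsWithin_le_nhds
    have hc : ContinuousOn (fun r : ℝ => r * v (r • e)) (Icc 0 1) := by
      refine continuousOn_id.mul (hB.cont.comp (by fun_prop) fun r hr => ?_)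
      rw [mem_closedBall_zero_iff, hne, abs_of_nonneg hr.1]; exact hr.2
    have h2 := (hc 1 ⟨zero_le_one, le_rfl⟩).tendsto.mono_left
      (nhdsWithin_le_of_mem (Icc_mem_nhdsLT one_pos))
    rw [one_smul, one_mul, hB.zero e he] at h2
    refine tendsto_nhds_unique h1 (h2.congr' ?_)
    filter_upwards [Ioo_mem_nhdsLT one_pos] with r hr
    rw [heq r hr.1.le hr.2, hρe r (by rw [abs_of_pos hr.1]; exact hr.2.le)]
  refine ⟨w, y, hS.isProfile hA.mu_pos.le hw1, fun x hx => ?_⟩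
  rw [← hρv x hx]
  rcases (norm_nonneg x).eq_or_lt with h0 | h0
  · rw [← h0, profileFun_zero, hS.y_zero]
  rw [profileFun_of_pos h0]
  rcases hx.eq_or_lt with h1 | h1
  · rw [h1, hw1, hρ1, zero_div]
  · rw [heq _ h0.le h1, mul_div_cancel_left₀ _ h0.ne']

end

/-- for `-Δu + λu = (1+|x|^k)^{-s} u^{p-1}` on the unit ball, with `N = 3`,
`-λ₁(B) < λ < 0`, `2 < p ≤ 4` and `ks ≤ 4 - p`, there is exactly one positive solution,
and it is radially symmetric and decreasing in `r = |x|`. -/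
theorem statement12 {N : ℕ} (hN3 : N = 3) {s k p lam : ℝ} (hs : 1 < s) (hk : 0 ≤ k)
    (hp2 : 2 < p) (hpcrit : 3 ≤ N → p < 2 * N / ((N : ℝ) - 2))
    (hlam1 : - firstEig (Metric.ball (0 : Euc N) 1) < lam) (hlam0 : lam < 0)
    (hp4 : p ≤ 4) (hks : k * s ≤ 4 - p) :
    ∃ u : Euc N → ℝ,
      IsPosSolution (Metric.ball (0 : Euc N) 1) (fker N k s p) lam u ∧
      (∀ v : Euc N → ℝ, IsPosSolution (Metric.ball (0 : Euc N) 1) (fker N k s p) lam v →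
        EqOn v u (closure (Metric.ball (0 : Euc N) 1))) ∧
      ∃ ρ : ℝ → ℝ, (∀ x ∈ closure (Metric.ball (0 : Euc N) 1), u x = ρ ‖x‖) ∧
        StrictAntiOn ρ (Icc (0 : ℝ) 1) := by
  subst hN3
  obtain ⟨mu, rfl⟩ : ∃ mu, lam = -mu := ⟨-lam, (neg_neg lam).symm⟩
  have hmu : 0 < mu := neg_lt_zero.1 hlam0
  have hA : Admissible mu k s p := ⟨hmu, hk, hs, hp2, hp4, hks⟩
  obtain ⟨w, y, hP⟩ := exists_profile hA ((neg_lt_neg_iff.1 hlam1).trans_le firstEig_unit_ball_le)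
  refine ⟨fun x => profileFun w y ‖x‖, hP.isPosSolution hk, fun v hv x hx => ?_,
    profileFun w y, fun x _ => rfl, hP.strictAntiOn_profileFun hmu⟩
  rw [closure_ball _ one_ne_zero, mem_closedBall_zero_iff] at hx
  obtain ⟨w', y', hP', hv'⟩ := hv.exists_profile hA
  rw [hv' x hx]
  exact hP'.unique hP hA (norm_nonneg x) hx
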